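/- If |λ| ≤ (1 − |α|)², then for every θ ∈ ℝ and every E ∈ σ(H_{α,θ,b}), the Lyapunov exponent L(E) equals 0. -/

import Mathlib

open scoped Real

/-- The quasi-periodic potential `v(x) = 2λcos(2πx)/(1 - αcos(2πx))`. -/
noncomputable def potV (α lam : ℝ) (x : ℝ) : ℝ :=
  2 * lam * Real.cos (2 * Real.pi * x) / (1 - α * Real.cos (2 * Real.pi * x))

/-- One-step transfer matrix `A(x,z) = [[z - V x, -1],[1,0]]`. -/
noncomputable def tMat (V : ℝ → ℝ) (x : ℝ) (z : ℂ) : Matrix (Fin 2) (Fin 2) ℂ :=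
  !![z - (V x : ℝ), -1; 1, 0]

/-- The `n`-step transfer matrix `A_n(x,z) = A(x+(n-1)b,z) ⋯ A(x+b,z) A(x,z)`. -/
noncomputable def tProd (V : ℝ → ℝ) (b : ℝ) (n : ℕ) (x : ℝ) (z : ℂ) :
    Matrix (Fin 2) (Fin 2) ℂ :=
  (((List.range n).reverse).map (fun j => tMat V (x + (j : ℝ) * b) z)).prod

/-- The operator norm of a 2×2 complex matrix, acting on the Euclidean space `ℂ²`. -/
noncomputable def opNorm2 (M : Matrix (Fin 2) (Fin 2) ℂ) : ℝ :=
  ‖Matrix.toEuclideanCLM (𝕜 := ℂ) M‖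

/-- The Lyapunov exponent `L(z) = lim_n (1/n)∫₀¹ log‖A_n(x,z)‖ dx`; the limit exists and
equals `inf_{n ≥ 1} (1/n)∫₀¹ log‖A_n(x,z)‖ dx` by subadditivity, so we take that as the
definition. -/
noncomputable def lyap (V : ℝ → ℝ) (b : ℝ) (z : ℂ) : ℝ :=
  ⨅ n : ℕ+, ((n : ℝ))⁻¹ * ∫ x in (0:ℝ)..(1:ℝ), Real.log (opNorm2 (tProd V b n x z))

/-- `IsSchrodingerOp V b θ H` says that `H` is the bounded operator on `ℓ²(ℤ)` given by
`(Hu)ₙ = u_{n+1} + u_{n-1} + V(nb+θ)uₙ`. -/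
def IsSchrodingerOp (V : ℝ → ℝ) (b θ : ℝ)
    (H : lp (fun _ : ℤ => ℂ) 2 →L[ℂ] lp (fun _ : ℤ => ℂ) 2) : Prop :=
  ∀ u : lp (fun _ : ℤ => ℂ) 2, ∀ n : ℤ,
    (H u : ∀ _ : ℤ, ℂ) n = (u : ∀ _ : ℤ, ℂ) (n + 1) + (u : ∀ _ : ℤ, ℂ) (n - 1)
      + (V ((n : ℝ) * b + θ) : ℂ) * (u : ∀ _ : ℤ, ℂ) n

namespace Lyap
open Real Filter Topology

/-- Sum of entry norms. -/
noncomputable def nrm (A : Matrix (Fin 2) (Fin 2) ℂ) : ℝ :=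
  ‖A 0 0‖ + ‖A 0 1‖ + ‖A 1 0‖ + ‖A 1 1‖

lemma nrm_nonneg (A : Matrix (Fin 2) (Fin 2) ℂ) : 0 ≤ nrm A := by
  unfold nrm; positivity

lemma entry_le_nrm (A : Matrix (Fin 2) (Fin 2) ℂ) (i j : Fin 2) : ‖A i j‖ ≤ nrm A := by
  unfold nrm
  have h1 := norm_nonneg (A 0 0)
  have h2 := norm_nonneg (A 0 1)
  have h3 := norm_nonneg (A 1 0)
  have h4 := norm_nonneg (A 1 1)
  fin_cases i <;> fin_cases j <;> simp <;> linarith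

lemma nrm_mul_le (A B : Matrix (Fin 2) (Fin 2) ℂ) : nrm (A * B) ≤ nrm A * nrm B := by
  unfold nrm
  simp only [Matrix.mul_apply, Fin.sum_univ_two]
  have h : ∀ i j : Fin 2, ‖A i 0 * B 0 j + A i 1 * B 1 j‖ ≤ ‖A i 0‖ * ‖B 0 j‖ + ‖A i 1‖ * ‖B 1 j‖ := by
    intro i j
    refine (norm_add_le _ _).trans ?_
    rw [norm_mul, norm_mul]
  have a1 := norm_nonneg (A 0 0)
  have a2 := norm_nonneg (A 0 1)
  have a3 := norm_nonneg (A 1 0)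
  have a4 := norm_nonneg (A 1 1)
  have b1 := norm_nonneg (B 0 0)
  have b2 := norm_nonneg (B 0 1)
  have b3 := norm_nonneg (B 1 0)
  have b4 := norm_nonneg (B 1 1)
  have := h 0 0
  have := h 0 1
  have := h 1 0
  have := h 1 1
  nlinarith [mul_nonneg a1 b3, mul_nonneg a1 b4, mul_nonneg a2 b1, mul_nonneg a2 b2, mul_nonneg a3 b3,
    mul_nonneg a3 b4, mul_nonneg a4 b1, mul_nonneg a4 b2]

lemma nrm_add_le (A B : Matrix (Fin 2) (Fin 2) ℂ) : nrm (A + B) ≤ nrm A + nrm B := by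
  unfold nrm
  simp only [Matrix.add_apply]
  linarith [norm_add_le (A 0 0) (B 0 0), norm_add_le (A 0 1) (B 0 1), norm_add_le (A 1 0) (B 1 0),
    norm_add_le (A 1 1) (B 1 1)]

lemma nrm_smul (c : ℂ) (A : Matrix (Fin 2) (Fin 2) ℂ) : nrm (c • A) = ‖c‖ * nrm A := by
  unfold nrm
  simp only [Matrix.smul_apply, smul_eq_mul, norm_mul]; ring

lemma det_le_nrm (A : Matrix (Fin 2) (Fin 2) ℂ) : ‖A.det‖ ≤ nrm A ^ 2 := by
  rw [Matrix.det_fin_two]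
  refine (norm_sub_le _ _).trans ?_
  rw [norm_mul, norm_mul]
  unfold nrm
  have a1 := norm_nonneg (A 0 0)
  have a2 := norm_nonneg (A 0 1)
  have a3 := norm_nonneg (A 1 0)
  have a4 := norm_nonneg (A 1 1)
  nlinarith [mul_nonneg a1 a2, mul_nonneg a1 a3, mul_nonneg a1 a4, mul_nonneg a2 a3,
    mul_nonneg a2 a4, mul_nonneg a3 a4]

lemma nrm_pos_of_det (A : Matrix (Fin 2) (Fin 2) ℂ) (h : A.det ≠ 0) : 0 < nrm A := by
  have := det_le_nrm A
  have h2 : 0 < ‖A.det‖ := norm_pos_iff.2 h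
  have h3 := nrm_nonneg A
  rcases h3.lt_or_eq with h4 | h4
  · exact h4
  · rw [← h4] at this; norm_num at this; exact absurd this h

lemma nrm_one : nrm 1 = 2 := by
  unfold nrm; norm_num

lemma continuous_nrm : Continuous nrm := by
  unfold nrm; fun_prop

/-- parameters -/
structure Sys where
  α : ℝ
  lam : ℝ
  b : ℝ
  hα : |α| < 1
  hb : Irrational b

namespace Sys
variable (S : Sys)

noncomputable def β : ℂ := Complex.exp ((2 * π * S.b : ℝ) * Complex.I)

lemma norm_β : ‖S.β‖ = 1 := Complex.norm_exp_ofReal_mul_I _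

lemma β_ne : S.β ≠ 0 := Complex.exp_ne_zero _

lemma norm_βpow (k : ℕ) : ‖S.β ^ k‖ = 1 := by rw [norm_pow, S.norm_β, one_pow]

lemma norm_βzpow (k : ℤ) : ‖S.β ^ k‖ = 1 := by rw [norm_zpow, S.norm_β, one_zpow]

/-- `d` -/
noncomputable def d (ζ : ℂ) : ℂ := ζ - S.α * (ζ ^ 2 + 1) / 2

noncomputable def M (E ζ : ℂ) : Matrix (Fin 2) (Fin 2) ℂ :=
  !![E * S.d ζ - S.lam * (ζ ^ 2 + 1), - S.d ζ; S.d ζ, 0]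

noncomputable def Mn (E : ℂ) : ℕ → ℂ → Matrix (Fin 2) (Fin 2) ℂ
  | 0, _ => 1
  | n + 1, ζ => S.M E (S.β ^ n * ζ) * Mn E n ζ

noncomputable def Dn (n : ℕ) (ζ : ℂ) : ℂ := ∏ k ∈ Finset.range n, S.d (S.β ^ k * ζ)

lemma Mn_zero (E ζ : ℂ) : S.Mn E 0 ζ = 1 := rfl
lemma Mn_succ (E ζ : ℂ) (n : ℕ) : S.Mn E (n + 1) ζ = S.M E (S.β ^ n * ζ) * S.Mn E n ζ := rfl

lemma Mn_add (E ζ : ℂ) (m n : ℕ) : S.Mn E (m + n) ζ = S.Mn E m (S.β ^ n * ζ) * S.Mn E n ζ := by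
  induction m with
  | zero => simp [Mn_zero]
  | succ m ih =>
    rw [show m + 1 + n = (m + n) + 1 by ring, Mn_succ, ih, Mn_succ, ← Matrix.mul_assoc]
    congr 3
    ring

lemma det_M (E ζ : ℂ) : (S.M E ζ).det = S.d ζ ^ 2 := by
  simp [M, Matrix.det_fin_two]; ring

lemma det_Mn (E ζ : ℂ) (n : ℕ) : (S.Mn E n ζ).det = S.Dn n ζ ^ 2 := by
  induction n with
  | zero => simp [Mn_zero, Dn]
  | succ n ih =>
    rw [Mn_succ, Matrix.det_mul, ih, det_M]
    unfold Dn
    rw [Finset.prod_range_succ]; ring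

lemma Dn_add (ζ : ℂ) (m n : ℕ) : S.Dn (m + n) ζ = S.Dn m (S.β ^ n * ζ) * S.Dn n ζ := by
  unfold Dn
  rw [add_comm, Finset.prod_range_add, mul_comm]
  congr 1
  refine Finset.prod_congr rfl fun k _ => ?_
  congr 1; ring

/-- good range of `t` -/
def ok (t : ℝ) : Prop := |S.α| * cosh t < 1

lemma ok_zero : S.ok 0 := by simpa [ok] using S.hα

variable {S}

lemma ok.mono {t t' : ℝ} (h : S.ok t) (h' : |t'| ≤ |t|) : S.ok t' := by
  unfold ok at *
  have : cosh t' ≤ cosh t := cosh_le_cosh.2 h'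
  nlinarith [abs_nonneg S.α]

lemma ok.neg {t : ℝ} (h : S.ok t) : S.ok (-t) := h.mono (by simp)

lemma ok.conv {t1 t2 t : ℝ} (h1 : S.ok t1) (h2 : S.ok t2) (ht : t1 ≤ t) (ht2 : t ≤ t2) : S.ok t := by
  rcases le_total |t1| |t2| with h | h
  · exact h2.mono (abs_le_max_abs_abs ht ht2 |>.trans (by simp [h]))
  · exact h1.mono (abs_le_max_abs_abs ht ht2 |>.trans (by simp [h]))

variable (S) in
lemma isOpen_ok : IsOpen {t | S.ok t} := by
  unfold ok
  exact isOpen_lt (by fun_prop) continuous_const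

lemma d_lower {t : ℝ} {ζ : ℂ} (h : ‖ζ‖ = exp t) : exp t * (1 - |S.α| * cosh t) ≤ ‖S.d ζ‖ := by
  have h1 : ‖ζ ^ 2 + 1‖ ≤ exp t ^ 2 + 1 := by
    refine (norm_add_le _ _).trans ?_
    rw [norm_pow, h, norm_one]
  have h2 : ‖(S.α : ℂ) * (ζ ^ 2 + 1) / 2‖ ≤ |S.α| * (exp t * cosh t) := by
    rw [norm_div, norm_mul, Complex.norm_real, Real.norm_eq_abs, cosh_eq]
    have : exp t * ((exp t + exp (-t)) / 2) = (exp t ^ 2 + 1) / 2 := by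
      rw [exp_neg]; field_simp
    rw [this, mul_div_assoc]
    norm_num
    exact mul_le_mul_of_nonneg_left (by linarith) (abs_nonneg _)
  have h3 := norm_sub_norm_le ζ ((S.α : ℂ) * (ζ ^ 2 + 1) / 2)
  unfold d
  rw [h] at h3
  linarith

lemma d_ne {t : ℝ} (ht : S.ok t) {ζ : ℂ} (h : ‖ζ‖ = exp t) : S.d ζ ≠ 0 := by
  have := d_lower (S := S) h
  have h2 : 0 < exp t * (1 - |S.α| * cosh t) := by
    have := exp_pos t
    unfold ok at ht
    have : 0 < 1 - |S.α| * cosh t := by linarith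
    positivity
  intro h0
  rw [h0, norm_zero] at this
  linarith

lemma norm_rot {t : ℝ} {ζ : ℂ} (h : ‖ζ‖ = exp t) (k : ℕ) : ‖S.β ^ k * ζ‖ = exp t := by
  rw [norm_mul, S.norm_βpow, one_mul, h]

lemma Dn_ne {t : ℝ} (ht : S.ok t) {ζ : ℂ} (h : ‖ζ‖ = exp t) (n : ℕ) : S.Dn n ζ ≠ 0 := by
  unfold Dn
  exact Finset.prod_ne_zero_iff.2 fun k _ => d_ne ht (norm_rot h k)

lemma nrm_Mn_pos {t : ℝ} (ht : S.ok t) {ζ : ℂ} (h : ‖ζ‖ = exp t) (E : ℂ) (n : ℕ) :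
    0 < nrm (S.Mn E n ζ) := by
  apply nrm_pos_of_det
  rw [det_Mn]
  exact pow_ne_zero _ (Dn_ne ht h n)

variable (S)

lemma continuous_d : Continuous S.d := by unfold d; fun_prop

lemma continuous_Dn (n : ℕ) : Continuous (S.Dn n) := by
  unfold Dn
  have := S.continuous_d
  fun_prop

lemma continuous_M2 : Continuous (fun p : ℂ × ℂ => S.M p.1 p.2) := by
  have := S.continuous_d
  apply continuous_matrix
  intro i j
  fin_cases i <;> fin_cases j <;> simp [M] <;> fun_prop

lemma continuous_Mn2 (n : ℕ) : Continuous (fun p : ℂ × ℂ => S.Mn p.1 n p.2) := by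
  induction n with
  | zero => simp only [Mn_zero]; fun_prop
  | succ n ih =>
    simp only [Mn_succ]
    refine Continuous.mul ?_ ih
    exact S.continuous_M2.comp (by fun_prop : Continuous fun p : ℂ × ℂ => (p.1, S.β ^ n * p.2))

lemma continuous_Mn (E : ℂ) (n : ℕ) : Continuous (S.Mn E n) :=
  (S.continuous_Mn2 n).comp (by fun_prop : Continuous fun ζ : ℂ => (E, ζ))

end Sys

/-- circle average at radius `e^t` -/
noncomputable def CA (f : ℂ → ℝ) (t : ℝ) : ℝ := circleAverage f 0 (exp t)

lemma CA_rot (f : ℂ → ℝ) (t : ℝ) {w : ℂ} (hw : ‖w‖ = 1) : CA (fun ζ => f (w * ζ)) t = CA f t := by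
  unfold CA
  rw [circleAverage_eq_integral_add (f := f) (Complex.arg w), circleAverage_def]
  congr 2
  ext θ
  congr 1
  simp only [circleMap_zero]
  have : w = Complex.exp (Complex.arg w * Complex.I) := by
    conv_lhs => rw [← Complex.norm_mul_exp_arg_mul_I w, hw]
    simp
  conv_lhs => rw [this]
  push_cast
  rw [add_mul, Complex.exp_add]; ring

lemma sphere_exp (t : ℝ) {ζ : ℂ} : ζ ∈ Metric.sphere (0:ℂ) |exp t| ↔ ‖ζ‖ = exp t := by
  rw [mem_sphere_zero_iff_norm, abs_of_pos (exp_pos t)]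

lemma CA_integrable {f : ℂ → ℝ} {t : ℝ} (hf : ContinuousOn f {ζ | ‖ζ‖ = exp t}) :
    CircleIntegrable f 0 (exp t) := by
  apply ContinuousOn.circleIntegrable (exp_pos t).le
  refine hf.mono ?_
  intro ζ hζ
  simpa using hζ

lemma CA_mono {f g : ℂ → ℝ} {t : ℝ} (hf : CircleIntegrable f 0 (exp t))
    (hg : CircleIntegrable g 0 (exp t)) (h : ∀ ζ, ‖ζ‖ = exp t → f ζ ≤ g ζ) : CA f t ≤ CA g t :=
  circleAverage_mono hf hg fun x hx => h x ((sphere_exp t).1 hx)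

lemma CA_add {f g : ℂ → ℝ} {t : ℝ} (hf : CircleIntegrable f 0 (exp t))
    (hg : CircleIntegrable g 0 (exp t)) : CA (fun ζ => f ζ + g ζ) t = CA f t + CA g t :=
  circleAverage_fun_add hf hg

lemma CA_const (c t : ℝ) : CA (fun _ => c) t = c := circleAverage_const c 0 _

lemma CA_sum {ι : Type*} {s : Finset ι} {f : ι → ℂ → ℝ} {t : ℝ}
    (h : ∀ i ∈ s, CircleIntegrable (f i) 0 (exp t)) :
    CA (fun z ↦ ∑ i ∈ s, f i z) t = ∑ i ∈ s, CA (f i) t := circleAverage_fun_sum h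

lemma CA_mul (c : ℝ) (f : ℂ → ℝ) (t : ℝ) : CA (fun ζ => c * f ζ) t = c * CA f t :=
  circleAverage_fun_smul (a := c) (f := f)

lemma CA_congr {f g : ℂ → ℝ} {t : ℝ} (h : ∀ ζ, ‖ζ‖ = exp t → f ζ = g ζ) : CA f t = CA g t :=
  circleAverage_congr_sphere fun x hx => h x ((sphere_exp t).1 hx)

lemma CA_le_const {f : ℂ → ℝ} {t c : ℝ} (hf : CircleIntegrable f 0 (exp t))
    (h : ∀ ζ, ‖ζ‖ = exp t → f ζ ≤ c) : CA f t ≤ c :=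
  circleAverage_mono_on_of_le_circle hf fun x hx => h x ((sphere_exp t).1 hx)

lemma CA_log_sub (a : ℂ) (t : ℝ) : CA (fun ζ => log ‖ζ - a‖) t = log (max (exp t) ‖a‖) := by
  unfold CA
  rw [circleAverage_log_norm_sub_const_eq_log_radius_add_posLog (exp_pos t).ne', zero_sub, norm_neg]
  have hp := exp_pos t
  rcases le_total ‖a‖ (exp t) with h | h
  · rw [max_eq_left h, posLog_eq_zero_iff _ |>.2, add_zero]
    rw [abs_of_nonneg (by positivity)]
    rw [inv_mul_le_iff₀ hp]; simpa using h
  · have ha : 0 < ‖a‖ := hp.trans_le h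
    rw [max_eq_right h, posLog_eq_log, log_mul (by positivity) (by positivity), log_inv]; ring
    rw [abs_of_nonneg (by positivity), le_inv_mul_iff₀ hp]; simpa using h

lemma CA_log_sub_integrable (a : ℂ) (t : ℝ) :
    CircleIntegrable (fun ζ => log ‖ζ - a‖) 0 (exp t) :=
  circleIntegrable_log_norm_sub_const _

namespace Sys
variable {S : Sys}

lemma cont_log_nrm {t : ℝ} (ht : S.ok t) (E : ℂ) (n : ℕ) :
    ContinuousOn (fun ζ => log (nrm (S.Mn E n ζ))) {ζ | ‖ζ‖ = exp t} := by
  apply ContinuousOn.log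
  · exact (continuous_nrm.comp (S.continuous_Mn E n)).continuousOn
  · intro ζ hζ
    exact (nrm_Mn_pos ht hζ E n).ne'

lemma int_log_nrm {t : ℝ} (ht : S.ok t) (E : ℂ) (n : ℕ) :
    CircleIntegrable (fun ζ => log (nrm (S.Mn E n ζ))) 0 (exp t) := CA_integrable (cont_log_nrm ht E n)

lemma cont_log_d {t : ℝ} (ht : S.ok t) :
    ContinuousOn (fun ζ => log ‖S.d ζ‖) {ζ | ‖ζ‖ = exp t} := by
  apply ContinuousOn.log
  · exact S.continuous_d.norm.continuousOn
  · intro ζ hζ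
    exact norm_ne_zero_iff.2 (d_ne ht hζ)

lemma cont_log_d_rot {t : ℝ} (ht : S.ok t) (k : ℕ) :
    ContinuousOn (fun ζ => log ‖S.d (S.β ^ k * ζ)‖) {ζ | ‖ζ‖ = exp t} := by
  apply (cont_log_d ht).comp (f := fun ζ => S.β ^ k * ζ) (by fun_prop)
  intro ζ hζ
  exact norm_rot hζ k

variable (S)
noncomputable def K : ℝ := (1 + √(1 - S.α ^ 2)) / 2
noncomputable def κ : ℝ := log S.K

lemma alpha_sq : S.α ^ 2 < 1 := by
  have := S.hα
  rw [sq_lt_one_iff_abs_lt_one]; exact this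

lemma K_pos : 0 < S.K := by unfold K; positivity

lemma K_half : 1 / 2 ≤ S.K := by
  unfold K
  have := sqrt_nonneg (1 - S.α ^ 2)
  linarith

lemma K_eq : S.K ^ 2 - S.K + S.α ^ 2 / 4 = 0 := by
  unfold K
  have := S.alpha_sq
  have h := sq_sqrt (show 0 ≤ 1 - S.α ^ 2 by linarith)
  nlinarith

lemma d_factor (ζ : ℂ) : S.d ζ = S.K * (1 - ((S.α / (2 * S.K) : ℝ) : ℂ) * ζ) * (ζ - ((S.α / (2 * S.K) : ℝ) : ℂ)) := by
  have h := S.K_pos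
  have hK : (S.K : ℂ) ≠ 0 := by exact_mod_cast h.ne'
  have h2 : (S.K : ℂ) ^ 2 - S.K + S.α ^ 2 / 4 = 0 := by exact_mod_cast S.K_eq
  unfold d
  push_cast
  field_simp
  linear_combination (-4 * ζ) * h2

variable {S}
lemma eta_lt {t : ℝ} (ht : S.ok t) : |S.α / (2 * S.K)| < exp (- |t|) := by
  by_contra! h
  have hK := S.K_pos
  have h1 : |S.α / (2 * S.K)| ≤ 1 := by
    rw [abs_div, abs_of_pos (show 0 < 2 * S.K by positivity), div_le_one (by positivity)]
    have := S.hα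
    have := S.K_half
    linarith
  have h0 : 0 < |S.α / (2 * S.K)| := (exp_pos _).trans_le h
  set s := log |S.α / (2 * S.K)| with hs
  have hs1 : s ≤ 0 := log_nonpos h0.le h1
  have hs2 : -|t| ≤ s := by rw [hs]; exact (le_log_iff_exp_le h0).2 h
  have hok : S.ok s := ht.mono (by rw [abs_of_nonpos hs1]; linarith)
  refine d_ne (S := S) hok (ζ := ((S.α / (2 * S.K) : ℝ) : ℂ)) ?_ ?_
  · rw [Complex.norm_real, Real.norm_eq_abs, hs, exp_log h0]
  · rw [d_factor]; simp

lemma CA_log_d {t : ℝ} (ht : S.ok t) : CA (fun ζ => log ‖S.d ζ‖) t = S.κ + t := by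
  have hη := eta_lt ht
  set η := S.α / (2 * S.K) with hηd
  have hK := S.K_pos
  have e1 : |η| ≤ exp t := hη.le.trans (exp_le_exp.2 (neg_abs_le t))
  have e2 : |η| * exp t < 1 := by
    calc |η| * exp t < exp (-|t|) * exp t := by gcongr
      _ = exp (-|t| + t) := by rw [exp_add]
      _ ≤ 1 := by rw [exp_le_one_iff]; linarith [le_abs_self t]
  have hne : ∀ ζ : ℂ, ‖ζ‖ = exp t → (1 - (η : ℂ) * ζ) ≠ 0 ∧ ζ - (η : ℂ) ≠ 0 := by
    intro ζ hζ
    have := d_ne ht hζ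
    rw [d_factor] at this
    constructor
    · intro h0; apply this; rw [← hηd, h0]; ring
    · intro h0; apply this; rw [← hηd, h0]; ring
  have step : CA (fun ζ => log ‖S.d ζ‖) t
      = CA (fun ζ => log S.K + (log ‖1 - (η : ℂ) * ζ‖ + log ‖ζ - (η : ℂ)‖)) t := by
    apply CA_congr
    intro ζ hζ
    obtain ⟨h1, h2⟩ := hne ζ hζ
    rw [d_factor, norm_mul, norm_mul, log_mul, log_mul, Complex.norm_real, Real.norm_eq_abs, abs_of_pos hK]
    · ring
    · simp [hK.ne']
    · exact norm_ne_zero_iff.2 h1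
    · rw [← norm_mul, norm_ne_zero_iff]; exact mul_ne_zero (by exact_mod_cast hK.ne') h1
    · exact norm_ne_zero_iff.2 h2
  have i1 : CircleIntegrable (fun ζ => log ‖1 - (η : ℂ) * ζ‖) 0 (exp t) := by
    apply CA_integrable
    apply ContinuousOn.log (by fun_prop)
    intro ζ hζ
    exact norm_ne_zero_iff.2 (hne ζ hζ).1
  have i2 := CA_log_sub_integrable (η : ℂ) t
  have v1 : CA (fun ζ => log ‖1 - (η : ℂ) * ζ‖) t = 0 := by
    by_cases h0 : η = 0
    · simp [h0, CA_const]
    · have : CA (fun ζ => log ‖1 - (η : ℂ) * ζ‖) t = CA (fun ζ => log |η| + log ‖ζ - ((η⁻¹ : ℝ) : ℂ)‖) t := by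
        apply CA_congr
        intro ζ hζ
        have e : 1 - (η : ℂ) * ζ = -(η : ℂ) * (ζ - ((η⁻¹ : ℝ) : ℂ)) := by
          push_cast
          have : (η : ℂ) ≠ 0 := by exact_mod_cast h0
          field_simp; ring
        rw [e, norm_mul, norm_neg, Complex.norm_real, Real.norm_eq_abs, log_mul]
        · simpa using h0
        · have := (hne ζ hζ).1
          rw [e] at this
          exact norm_ne_zero_iff.2 (right_ne_zero_of_mul this)
      have ha : 0 < |η| := abs_pos.2 h0
      rw [this, CA_add (CA_integrable continuousOn_const) (CA_log_sub_integrable _ t), CA_const, CA_log_sub,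
        max_eq_right, Complex.norm_real, Real.norm_eq_abs, abs_inv, log_inv]
      · ring
      · rw [Complex.norm_real, Real.norm_eq_abs, abs_inv, le_inv_comm₀ (exp_pos t) ha]
        rw [← one_div, le_div_iff₀ (exp_pos t)]; exact e2.le
  rw [step, CA_add (g := fun ζ => log ‖1 - (η : ℂ) * ζ‖ + log ‖ζ - (η : ℂ)‖) (CA_integrable continuousOn_const) (i1.add i2), CA_const, CA_add i1 i2, v1, CA_log_sub,
    max_eq_left, log_exp]
  · unfold κ; ring
  · rw [Complex.norm_real, Real.norm_eq_abs]; exact e1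

/-- the averages -/
noncomputable def a (S : Sys) (E : ℂ) (t : ℝ) (n : ℕ) : ℝ := CA (fun ζ => log (nrm (S.Mn E n ζ))) t

noncomputable def F (S : Sys) (E : ℂ) (t : ℝ) : ℝ := sInf ((fun n : ℕ => S.a E t n / n) '' Set.Ici 1)

lemma a_subadd {t : ℝ} (ht : S.ok t) (E : ℂ) : Subadditive (S.a E t) := by
  intro m n
  unfold a
  have rot : CA (fun ζ => log (nrm (S.Mn E m ζ))) t = CA (fun ζ => log (nrm (S.Mn E m (S.β ^ n * ζ)))) t :=
    (CA_rot (fun ζ => log (nrm (S.Mn E m ζ))) t (S.norm_βpow n)).symm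
  rw [rot]
  have i1 : CircleIntegrable (fun ζ => log (nrm (S.Mn E m (S.β ^ n * ζ)))) 0 (exp t) := by
    apply CA_integrable
    apply (cont_log_nrm ht E m).comp (f := fun ζ => S.β ^ n * ζ) (by fun_prop)
    intro ζ hζ
    exact norm_rot hζ n
  rw [← CA_add i1 (int_log_nrm ht E n)]
  refine CA_mono (int_log_nrm ht E _) (i1.add (int_log_nrm ht E n)) ?_
  intro ζ hζ
  have p1 := nrm_Mn_pos ht hζ E n
  have p2 := nrm_Mn_pos ht (norm_rot (S := S) hζ n) E m
  rw [← log_mul p2.ne' p1.ne']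
  apply log_le_log (nrm_Mn_pos ht hζ E _)
  rw [Mn_add]
  exact nrm_mul_le _ _

lemma log_Dn {t : ℝ} (ht : S.ok t) {ζ : ℂ} (hζ : ‖ζ‖ = exp t) (n : ℕ) :
    log ‖S.Dn n ζ‖ = ∑ k ∈ Finset.range n, log ‖S.d (S.β ^ k * ζ)‖ := by
  unfold Dn
  rw [norm_prod, log_prod]
  intro k _
  exact norm_ne_zero_iff.2 (d_ne ht (norm_rot hζ k))

lemma log_Dn_le {t : ℝ} (ht : S.ok t) {ζ : ℂ} (hζ : ‖ζ‖ = exp t) (E : ℂ) (n : ℕ) :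
    log ‖S.Dn n ζ‖ ≤ log (nrm (S.Mn E n ζ)) := by
  apply log_le_log (norm_pos_iff.2 (Dn_ne ht hζ n))
  have := det_le_nrm (S.Mn E n ζ)
  rw [det_Mn, norm_pow] at this
  exact (pow_le_pow_iff_left₀ (norm_nonneg _) (nrm_nonneg _) two_ne_zero).1 this

lemma CA_log_Dn {t : ℝ} (ht : S.ok t) (n : ℕ) :
    CA (fun ζ => log ‖S.Dn n ζ‖) t = n * (S.κ + t) := by
  rw [CA_congr (fun ζ hζ => log_Dn ht hζ n), CA_sum]
  · rw [Finset.sum_congr rfl (fun k _ => (CA_rot (fun ζ => log ‖S.d ζ‖) t (S.norm_βpow k)).trans (CA_log_d ht))]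
    simp [mul_add]
  · intro k _
    exact CA_integrable (cont_log_d_rot ht k)

lemma int_log_Dn {t : ℝ} (ht : S.ok t) (n : ℕ) :
    CircleIntegrable (fun ζ => log ‖S.Dn n ζ‖) 0 (exp t) := by
  apply CA_integrable
  apply ContinuousOn.log (S.continuous_Dn n).norm.continuousOn
  intro ζ hζ
  exact norm_ne_zero_iff.2 (Dn_ne ht hζ n)

lemma a_lower {t : ℝ} (ht : S.ok t) (E : ℂ) (n : ℕ) : n * (S.κ + t) ≤ S.a E t n := by
  rw [← CA_log_Dn ht]
  exact CA_mono (int_log_Dn ht n) (int_log_nrm ht E n) fun ζ hζ => log_Dn_le ht hζ E n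

lemma a_bdd {t : ℝ} (ht : S.ok t) (E : ℂ) : BddBelow (Set.range fun n : ℕ => S.a E t n / n) := by
  refine ⟨min 0 (S.κ + t), ?_⟩
  rintro _ ⟨n, rfl⟩
  rcases Nat.eq_zero_or_pos n with h | h
  · simp [h]
  · have := a_lower ht E n
    refine (min_le_right _ _).trans ?_
    simp only
    rw [le_div_iff₀ (by exact_mod_cast h)]; linarith

lemma F_eq {t : ℝ} (ht : S.ok t) (E : ℂ) : (a_subadd ht E).lim = S.F E t := by
  rw [Subadditive.lim]; rfl

lemma F_tendsto {t : ℝ} (ht : S.ok t) (E : ℂ) :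
    Tendsto (fun n : ℕ => S.a E t n / n) atTop (𝓝 (S.F E t)) := by
  rw [← F_eq ht E]; exact (a_subadd ht E).tendsto_lim (a_bdd ht E)

lemma F_le {t : ℝ} (ht : S.ok t) (E : ℂ) {n : ℕ} (hn : n ≠ 0) : S.F E t ≤ S.a E t n / n := by
  rw [← F_eq ht E]; exact (a_subadd ht E).lim_le_div (a_bdd ht E) hn

lemma F_lower {t : ℝ} (ht : S.ok t) (E : ℂ) : S.κ + t ≤ S.F E t := by
  refine le_of_tendsto_of_tendsto tendsto_const_nhds (F_tendsto ht E) ?_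
  filter_upwards [eventually_gt_atTop 0] with n hn
  rw [le_div_iff₀ (by exact_mod_cast hn)]; linarith [a_lower ht E n]

end Sys
end Lyap

namespace Lyap
open Real Filter Topology MeasureTheory

/-- normalized measure on the angle -/
noncomputable def cm : Measure ℝ := ENNReal.ofReal (2 * π)⁻¹ • volume.restrict (Set.Ioc 0 (2 * π))

instance : IsProbabilityMeasure cm := by
  constructor
  have : (0:ℝ) < 2 * π := two_pi_pos
  simp only [cm, Measure.smul_apply, Measure.restrict_apply_univ, Real.volume_Ioc, sub_zero, smul_eq_mul]
  rw [← ENNReal.ofReal_mul (by positivity), inv_mul_cancel₀ this.ne', ENNReal.ofReal_one]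

lemma CA_eq_cm (f : ℂ → ℝ) (t : ℝ) : CA f t = ∫ θ, f (circleMap 0 (exp t) θ) ∂cm := by
  unfold CA cm
  have : (0:ℝ) < 2 * π := two_pi_pos
  rw [circleAverage_def, intervalIntegral.integral_of_le this.le, integral_smul_measure,
    ENNReal.toReal_ofReal (by positivity)]

lemma circleAverage_eq_cm (f : ℂ → ℝ) : circleAverage f 0 1 = ∫ θ, f (circleMap 0 1 θ) ∂cm := by
  have := CA_eq_cm f 0
  unfold CA at this
  simpa using this

lemma cm_integrable {f : ℂ → ℝ} {t : ℝ} (h : CircleIntegrable f 0 (exp t)) :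
    Integrable (fun θ => f (circleMap 0 (exp t) θ)) cm := by
  have : (0:ℝ) < 2 * π := two_pi_pos
  unfold cm
  apply Integrable.smul_measure _ ENNReal.ofReal_ne_top
  unfold CircleIntegrable at h
  rwa [intervalIntegrable_iff_integrableOn_Ioc_of_le this.le] at h

lemma cm_null {N : Set ℝ} (h : volume N = 0) : cm N = 0 := by
  unfold cm
  simp only [Measure.smul_apply, smul_eq_mul, mul_eq_zero]
  right
  exact le_antisymm ((Measure.restrict_apply_le _ _).trans h.le) bot_le

lemma cm_countable {N : Set ℝ} (h : N.Countable) : cm N = 0 := cm_null (h.measure_zero _)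

/-- cubic in `s` -/
noncomputable def hs (A : Matrix (Fin 2) (Fin 2) ℂ) (s : ℂ) : ℂ :=
  A 0 0 + s * A 0 1 + s ^ 2 * A 1 0 + s ^ 3 * A 1 1

open Polynomial in
noncomputable def hpol (A : Matrix (Fin 2) (Fin 2) ℂ) : ℂ[X] :=
  C (A 0 0) + C (A 0 1) * X + C (A 1 0) * X ^ 2 + C (A 1 1) * X ^ 3

open Polynomial in
lemma hpol_eval (A : Matrix (Fin 2) (Fin 2) ℂ) (s : ℂ) : (hpol A).eval s = hs A s := by
  simp [hpol, hs]; ring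

open Polynomial in
lemma hpol_coeff (A : Matrix (Fin 2) (Fin 2) ℂ) : (hpol A).coeff 0 = A 0 0 ∧ (hpol A).coeff 1 = A 0 1 ∧
    (hpol A).coeff 2 = A 1 0 ∧ (hpol A).coeff 3 = A 1 1 := by
  simp [hpol, coeff_X, coeff_one, coeff_C]

open Polynomial in
lemma hpol_deg (A : Matrix (Fin 2) (Fin 2) ℂ) : (hpol A).natDegree ≤ 3 := by
  unfold hpol; compute_degree

lemma hpol_ne {A : Matrix (Fin 2) (Fin 2) ℂ} (hA : 0 < nrm A) : hpol A ≠ 0 := by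
  intro h
  obtain ⟨h0, h1, h2, h3⟩ := hpol_coeff A
  rw [h] at h0 h1 h2 h3
  simp only [Polynomial.coeff_zero] at h0 h1 h2 h3
  rw [nrm, ← h0, ← h1, ← h2, ← h3] at hA
  simp at hA

lemma hs_le (A : Matrix (Fin 2) (Fin 2) ℂ) {s : ℂ} (h : ‖s‖ = 1) : ‖hs A s‖ ≤ nrm A := by
  unfold hs nrm
  refine (norm_add_le _ _).trans ?_
  refine add_le_add ((norm_add_le _ _).trans (add_le_add ((norm_add_le _ _).trans ?_) ?_)) ?_ <;> simp [h]

lemma hs_avg {A : Matrix (Fin 2) (Fin 2) ℂ} (hA : 0 < nrm A) :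
    log (nrm A) - log 12 ≤ ∫ θ, log ‖hs A (circleMap 0 1 θ)‖ ∂cm := by
  have hne := hpol_ne hA
  have h1 : ∫ θ, log ‖hs A (circleMap 0 1 θ)‖ ∂cm = log (hpol A).mahlerMeasure := by
    rw [← Polynomial.logMahlerMeasure_eq_log_MahlerMeasure, Polynomial.logMahlerMeasure_def,
      circleAverage_eq_cm]
    simp [hpol_eval]
  rw [h1, ← log_div hA.ne' (by norm_num)]
  apply log_le_log (by positivity)
  have hc : ∀ n, ‖(hpol A).coeff n‖ ≤ 3 * (hpol A).mahlerMeasure := by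
    intro n
    refine (Polynomial.norm_coeff_le_choose_mul_mahlerMeasure n _).trans ?_
    apply mul_le_mul_of_nonneg_right _ (Polynomial.mahlerMeasure_nonneg _)
    have := hpol_deg A
    have h3 : (hpol A).natDegree.choose n ≤ 3 := by
      generalize (hpol A).natDegree = D at this
      rcases Nat.lt_or_ge 3 n with hn | hn
      · rw [Nat.choose_eq_zero_of_lt (by omega)]; norm_num
      · interval_cases D <;> interval_cases n <;> decide
    exact_mod_cast h3
  obtain ⟨h0, h1, h2, h3⟩ := hpol_coeff A
  have c0 := hc 0
  have c1 := hc 1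
  have c2 := hc 2
  have c3 := hc 3
  rw [h0] at c0
  rw [h1] at c1
  rw [h2] at c2
  rw [h3] at c3
  unfold nrm
  linarith

lemma hs_integrable (A : Matrix (Fin 2) (Fin 2) ℂ) :
    Integrable (fun θ => log ‖hs A (circleMap 0 1 θ)‖) cm := by
  have := Polynomial.intervalIntegrable_mahlerMeasure (hpol A)
  have h2 : CircleIntegrable (fun z => log ‖(hpol A).eval z‖) 0 (exp 0) := by
    unfold CircleIntegrable
    simpa using this
  have h3 := cm_integrable h2
  simpa [hpol_eval] using h3

lemma hs_lint {A : Matrix (Fin 2) (Fin 2) ℂ} (hA : 0 < nrm A) :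
    ∫⁻ θ, ENNReal.ofReal (log (nrm A) - log ‖hs A (circleMap 0 1 θ)‖) ∂cm ≤ ENNReal.ofReal (log 12) := by
  rw [← ofReal_integral_eq_lintegral_ofReal]
  · apply ENNReal.ofReal_le_ofReal
    rw [integral_sub (integrable_const _) (hs_integrable A)]
    have := hs_avg hA
    simp; linarith
  · exact (integrable_const _).sub (hs_integrable A)
  · have hfin : {s | hs A s = 0}.Countable := by
      have : {s | hs A s = 0} = ((hpol A).roots.toFinset : Set ℂ) := by
        ext s
        simp [hpol_ne hA, hpol_eval]
      rw [this]
      exact (Finset.finite_toSet _).countable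
    have hz := cm_countable (hfin.preimage_circleMap 0 one_ne_zero)
    have : ∀ᵐ θ ∂cm, θ ∉ circleMap 0 1 ⁻¹' {s | hs A s = 0} := measure_eq_zero_iff_ae_notMem.1 hz
    filter_upwards [this] with θ hθ
    simp only [Set.mem_preimage, Set.mem_ofPred_eq] at hθ
    simp only [Pi.zero_apply, sub_nonneg]
    apply log_le_log (norm_pos_iff.2 hθ)
    exact hs_le _ (by simp)

lemma continuous_hs2 : Continuous fun p : Matrix (Fin 2) (Fin 2) ℂ × ℂ => hs p.1 p.2 := by
  unfold hs
  have h : ∀ i j, Continuous fun p : Matrix (Fin 2) (Fin 2) ℂ × ℂ => p.1 i j :=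
    fun i j => continuous_fst.matrix_elem i j
  exact (((h 0 0).add (continuous_snd.mul (h 0 1))).add ((continuous_snd.pow 2).mul (h 1 0))).add
    ((continuous_snd.pow 3).mul (h 1 1))

lemma selection {Q : ℂ → Matrix (Fin 2) (Fin 2) ℂ} (hQ : Continuous Q) {t : ℝ}
    (hpos : ∀ ζ, ‖ζ‖ = exp t → 0 < nrm (Q ζ))
    (hIntg : ∀ s, CircleIntegrable (fun ζ => log ‖hs (Q ζ) s‖) 0 (exp t)) :
    ∃ s, ‖s‖ = 1 ∧ (∃ ζ, hs (Q ζ) s ≠ 0) ∧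
      CA (fun ζ => log (nrm (Q ζ))) t - log 12 ≤ CA (fun ζ => log ‖hs (Q ζ) s‖) t := by
  set c := circleMap 0 (exp t) with hc
  have hcn : ∀ θ, ‖c θ‖ = exp t := fun θ => by simp [hc, abs_of_pos (exp_pos t)]
  have hcc : Continuous c := continuous_circleMap _ _
  let f : ℝ → ℝ → ENNReal := fun φ θ =>
    ENNReal.ofReal (log (nrm (Q (c θ))) - log ‖hs (Q (c θ)) (circleMap 0 1 φ)‖)
  have hmeas : Measurable (Function.uncurry f) := by
    apply ENNReal.measurable_ofReal.comp
    apply Measurable.sub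
    · apply Real.measurable_log.comp
      have : Continuous fun p : ℝ × ℝ => nrm (Q (c p.2)) :=
        continuous_nrm.comp (hQ.comp (hcc.comp continuous_snd))
      exact this.measurable
    · apply Real.measurable_log.comp
      have : Continuous fun p : ℝ × ℝ => ‖hs (Q (c p.2)) (circleMap 0 1 p.1)‖ := by
        have h1 : Continuous fun p : ℝ × ℝ => Q (c p.2) := hQ.comp (hcc.comp continuous_snd)
        have h2 : Continuous fun p : ℝ × ℝ => circleMap 0 1 p.1 := (continuous_circleMap _ _).comp continuous_fst
        exact (continuous_hs2.comp (h1.prodMk h2)).norm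
      exact this.measurable
  have hT : ∫⁻ φ, ∫⁻ θ, f φ θ ∂cm ∂cm ≤ ENNReal.ofReal (log 12) := by
    rw [lintegral_lintegral_swap hmeas.aemeasurable]
    calc ∫⁻ θ, ∫⁻ φ, f φ θ ∂cm ∂cm ≤ ∫⁻ θ, ENNReal.ofReal (log 12) ∂cm :=
          lintegral_mono fun θ => hs_lint (hpos _ (hcn θ))
      _ = _ := by simp
  have hm1 : AEMeasurable (fun φ => ∫⁻ θ, f φ θ ∂cm) cm := (hmeas.lintegral_prod_right).aemeasurable
  set A := Q (c 0) with hA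
  have hfin : {s | hs A s = 0}.Countable := by
    have : {s | hs A s = 0} = ((hpol A).roots.toFinset : Set ℂ) := by
      ext s
      simp [hpol_ne (hpos _ (hcn 0)), hpol_eval, hA]
    rw [this]
    exact (Finset.finite_toSet _).countable
  obtain ⟨φ, hφ, hle⟩ := exists_notMem_null_le_lintegral hm1
    (cm_countable (hfin.preimage_circleMap 0 one_ne_zero))
  refine ⟨circleMap 0 1 φ, by simp, ⟨c 0, hφ⟩, ?_⟩
  have hle2 := hle.trans hT
  have i1 : Integrable (fun θ => log (nrm (Q (c θ)))) cm := by
    apply cm_integrable (f := fun ζ => log (nrm (Q ζ)))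
    apply CA_integrable
    apply ContinuousOn.log (continuous_nrm.comp hQ).continuousOn
    intro ζ hζ
    exact (hpos ζ hζ).ne'
  have i2 : Integrable (fun θ => log ‖hs (Q (c θ)) (circleMap 0 1 φ)‖) cm := cm_integrable (hIntg _)
  have h3 := integral_eq_lintegral_pos_part_sub_lintegral_neg_part (i1.sub i2)
  simp only [Pi.sub_apply] at h3
  rw [integral_sub i1 i2] at h3
  have h4 : (∫⁻ θ, f φ θ ∂cm).toReal ≤ log 12 := by
    apply ENNReal.toReal_le_of_le_ofReal (log_nonneg (by norm_num)) hle2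
  have h5 : 0 ≤ (∫⁻ θ, ENNReal.ofReal (-(log (nrm (Q (c θ))) - log ‖hs (Q (c θ)) (circleMap 0 1 φ)‖)) ∂cm).toReal :=
    ENNReal.toReal_nonneg
  rw [CA_eq_cm, CA_eq_cm]
  change _ = (∫⁻ θ, f φ θ ∂cm).toReal - _ at h3
  linarith

/-! Jensen for products -/
noncomputable def jen {m : ℕ} (c : ℂ) (z : Fin m → ℂ) (t : ℝ) : ℝ :=
  log ‖c‖ + ∑ i, log (max (exp t) ‖z i‖)

lemma CA_congr_finite {f g : ℂ → ℝ} {t : ℝ} {s : Set ℂ} (hs : s.Finite)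
    (h : ∀ ζ, ‖ζ‖ = exp t → ζ ∉ s → f ζ = g ζ) : CA f t = CA g t := by
  rw [CA_eq_cm, CA_eq_cm]
  apply integral_congr_ae
  have hz := cm_countable (hs.countable.preimage_circleMap 0 (exp_pos t).ne')
  have : ∀ᵐ θ ∂cm, θ ∉ circleMap 0 (exp t) ⁻¹' s := measure_eq_zero_iff_ae_notMem.1 hz
  filter_upwards [this] with θ hθ
  exact h _ (by simp [abs_of_pos (exp_pos t)]) hθ

lemma CA_jen {m : ℕ} {c : ℂ} (hc : c ≠ 0) (z : Fin m → ℂ) (t : ℝ) :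
    CA (fun ζ => log ‖c * ∏ i, (ζ - z i)‖) t = jen c z t := by
  have : CA (fun ζ => log ‖c * ∏ i, (ζ - z i)‖) t = CA (fun ζ => log ‖c‖ + ∑ i, log ‖ζ - z i‖) t := by
    apply CA_congr_finite (Set.finite_range z)
    intro ζ _ hζ
    have : ∀ i, ζ - z i ≠ 0 := fun i h => hζ ⟨i, (sub_eq_zero.1 h).symm⟩
    rw [norm_mul, norm_prod, log_mul (norm_ne_zero_iff.2 hc), log_prod]
    · intro i _; exact norm_ne_zero_iff.2 (this i)
    · exact Finset.prod_ne_zero_iff.2 fun i _ => norm_ne_zero_iff.2 (this i)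
  have hi : ∀ i ∈ Finset.univ, CircleIntegrable (fun ζ => log ‖ζ - z i‖) 0 (exp t) :=
    fun i _ => CA_log_sub_integrable (z i) t
  have hi2 : CircleIntegrable (fun ζ => ∑ i, log ‖ζ - z i‖) 0 (exp t) := by
    have := CircleIntegrable.sum Finset.univ hi
    convert this using 1
    ext ζ; simp
  rw [this, CA_add (g := fun ζ => ∑ i, log ‖ζ - z i‖) (CA_integrable continuousOn_const) hi2, CA_const,
    CA_sum hi]
  unfold jen
  congr 1
  exact Finset.sum_congr rfl fun i _ => CA_log_sub _ _

open Polynomial in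
lemma poly_factor {p : ℂ[X]} (hp : p ≠ 0) : ∃ (c : ℂ) (z : Fin p.natDegree → ℂ), c ≠ 0 ∧
    ∀ ζ, p.eval ζ = c * ∏ i, (ζ - z i) := by
  have hs := IsAlgClosed.splits p
  have hcard : p.roots.card = p.natDegree := (hs.natDegree_eq_card_roots).symm
  refine ⟨p.leadingCoeff, fun i => p.roots.toList.get (i.cast (by simp [hcard])), leadingCoeff_ne_zero.2 hp, ?_⟩
  intro ζ
  conv_lhs => rw [hs.eq_prod_roots]
  rw [eval_mul, eval_C, eval_multiset_prod]
  congr 1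
  rw [Multiset.map_map]
  have h1 : (Multiset.map (eval ζ ∘ fun a => X - C a) p.roots).prod = (List.map (fun a => ζ - a) p.roots.toList).prod := by
    conv_lhs => rw [← Multiset.coe_toList p.roots]
    simp [Function.comp_def]
  rw [h1]
  have hl : p.roots.toList.length = p.natDegree := by simp [hcard]
  rw [← Equiv.prod_comp (finCongr hl)]
  have : ∀ i : Fin p.roots.toList.length, (ζ - p.roots.toList.get (Fin.cast (by simp [hcard]) ((finCongr hl) i)))
     = (List.map (fun a => ζ - a) p.roots.toList).get (i.cast (by simp)) := by
    intro i; simp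
  rw [← List.prod_ofFn]
  congr 1
  apply List.ext_getElem <;> simp

/-! single log max function -/
lemma lmax_mono (a : ℝ) {t1 t2 : ℝ} (h : t1 ≤ t2) : log (max (exp t1) a) ≤ log (max (exp t2) a) := by
  apply log_le_log
  · exact lt_max_of_lt_left (exp_pos _)
  · exact max_le_max_right _ (exp_le_exp.2 h)

lemma lmax_slope (a : ℝ) {t1 t2 : ℝ} (h : t1 ≤ t2) :
    log (max (exp t2) a) ≤ log (max (exp t1) a) + (t2 - t1) := by
  have h1 : 0 < max (exp t1) a := lt_max_of_lt_left (exp_pos _)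
  rw [log_le_iff_le_exp (lt_max_of_lt_left (exp_pos _)), exp_add, exp_log h1]
  have h2 : 1 ≤ exp (t2 - t1) := one_le_exp (by linarith)
  apply max_le
  · calc exp t2 = exp t1 * exp (t2 - t1) := by rw [← exp_add]; ring_nf
      _ ≤ _ := by gcongr; exact le_max_left _ _
  · calc a ≤ max (exp t1) a := le_max_right _ _
      _ ≤ _ := le_mul_of_one_le_right h1.le h2

lemma lmax_ge (a t : ℝ) : t ≤ log (max (exp t) a) := by
  rw [le_log_iff_exp_le (lt_max_of_lt_left (exp_pos _))]; exact le_max_left _ _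

lemma lmax_convex {a : ℝ} (ha : 0 ≤ a) : ConvexOn ℝ Set.univ (fun t => log (max (exp t) a)) := by
  rcases ha.eq_or_lt with h | h
  · have : (fun t => log (max (exp t) a)) = fun t => t := by
      ext t; rw [← h, max_eq_left (exp_pos t).le, log_exp]
    rw [this]
    exact convexOn_id convex_univ
  · have : (fun t => log (max (exp t) a)) = (fun t => t) ⊔ (fun _ => log a) := by
      ext t
      simp only [Pi.sup_apply]
      rcases le_total (exp t) a with h1 | h1
      · rw [max_eq_right h1, sup_eq_right.2]; rw [le_log_iff_exp_le h]; exact h1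
      · rw [max_eq_left h1, log_exp, sup_eq_left.2]; rw [log_le_iff_le_exp h]; exact h1
    rw [this]
    exact (convexOn_id convex_univ).sup (convexOn_const _ convex_univ)

lemma jen_mono {m : ℕ} (c : ℂ) (z : Fin m → ℂ) {t1 t2 : ℝ} (h : t1 ≤ t2) : jen c z t1 ≤ jen c z t2 := by
  unfold jen
  gcongr with i

lemma jen_slope {m : ℕ} (c : ℂ) (z : Fin m → ℂ) {t1 t2 : ℝ} (h : t1 ≤ t2) :
    jen c z t2 ≤ jen c z t1 + m * (t2 - t1) := by
  unfold jen
  have : ∑ i, log (max (exp t2) ‖z i‖) ≤ ∑ i, (log (max (exp t1) ‖z i‖) + (t2 - t1)) :=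
    Finset.sum_le_sum fun i _ => lmax_slope _ h
  rw [Finset.sum_add_distrib] at this
  simp at this
  linarith

lemma jen_convex {m : ℕ} (c : ℂ) (z : Fin m → ℂ) : ConvexOn ℝ Set.univ (jen c z) := by
  unfold jen
  apply (convexOn_const _ convex_univ).add
  have : (fun t : ℝ => ∑ i, log (max (exp t) ‖z i‖)) = ∑ i, fun t : ℝ => log (max (exp t) ‖z i‖) := by
    ext t; simp
  rw [this]
  apply Finset.sum_induction _ (fun f => ConvexOn ℝ Set.univ f) (fun _ _ => ConvexOn.add) (convexOn_const 0 convex_univ)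
  intro i _
  exact lmax_convex (norm_nonneg _)

namespace Sys
variable (S : Sys)
open Polynomial in
lemma M_poly (E w : ℂ) (i j : Fin 2) : ∃ q : ℂ[X], q.natDegree ≤ 2 ∧ ∀ ζ, q.eval ζ = S.M E (w * ζ) i j := by
  let dp : ℂ[X] := C w * X - C (S.α / 2 : ℂ) * (C (w ^ 2) * X ^ 2 + 1)
  have hdp : dp.natDegree ≤ 2 := by simp only [dp]; compute_degree
  have hde : ∀ ζ, dp.eval ζ = S.d (w * ζ) := by intro ζ; simp [dp, d]; ring
  fin_cases i <;> fin_cases j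
  · refine ⟨C E * dp - C (S.lam : ℂ) * (C (w ^ 2) * X ^ 2 + 1), ?_, fun ζ => by simp [hde, M]; left; ring⟩
    apply (natDegree_sub_le _ _).trans (max_le ((natDegree_C_mul_le _ _).trans hdp) _)
    compute_degree
  · exact ⟨-dp, by simpa using hdp, fun ζ => by simp [hde, M]⟩
  · exact ⟨dp, hdp, fun ζ => by simp [hde, M]⟩
  · exact ⟨0, by simp, fun ζ => by simp [M]⟩

open Polynomial in
lemma Mn_poly (E : ℂ) (n : ℕ) (i j : Fin 2) :
    ∃ q : ℂ[X], q.natDegree ≤ 2 * n ∧ ∀ ζ, q.eval ζ = S.Mn E n ζ i j := by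
  induction n generalizing i with
  | zero => exact ⟨C ((1 : Matrix (Fin 2) (Fin 2) ℂ) i j), by simp, fun ζ => by simp [Mn_zero]⟩
  | succ n ih =>
    obtain ⟨q0, h0, e0⟩ := S.M_poly E (S.β ^ n) i 0
    obtain ⟨q1, h1, e1⟩ := S.M_poly E (S.β ^ n) i 1
    obtain ⟨p0, g0, f0⟩ := ih 0
    obtain ⟨p1, g1, f1⟩ := ih 1
    refine ⟨q0 * p0 + q1 * p1, ?_, fun ζ => ?_⟩
    · apply (natDegree_add_le _ _).trans
      apply max_le
      · exact natDegree_mul_le.trans (by omega)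
      · exact natDegree_mul_le.trans (by omega)
    · rw [Mn_succ, Matrix.mul_apply, Fin.sum_univ_two]
      simp [e0, e1, f0, f1]

open Polynomial in
lemma h_poly (E : ℂ) (n : ℕ) (s : ℂ) :
    ∃ q : ℂ[X], q.natDegree ≤ 2 * n ∧ ∀ ζ, q.eval ζ = hs (S.Mn E n ζ) s := by
  obtain ⟨p0, h0, e0⟩ := S.Mn_poly E n 0 0
  obtain ⟨p1, h1, e1⟩ := S.Mn_poly E n 0 1
  obtain ⟨p2, h2, e2⟩ := S.Mn_poly E n 1 0
  obtain ⟨p3, h3, e3⟩ := S.Mn_poly E n 1 1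
  refine ⟨p0 + C s * p1 + C (s ^ 2) * p2 + C (s ^ 3) * p3, ?_, fun ζ => by simp [e0, e1, e2, e3, hs]⟩
  apply (natDegree_add_le _ _).trans (max_le _ ((natDegree_C_mul_le _ _).trans h3))
  apply (natDegree_add_le _ _).trans (max_le _ ((natDegree_C_mul_le _ _).trans h2))
  apply (natDegree_add_le _ _).trans (max_le h0 ((natDegree_C_mul_le _ _).trans h1))

lemma h_integrable (E : ℂ) (n : ℕ) (s : ℂ) (t : ℝ) :
    CircleIntegrable (fun ζ => log ‖hs (S.Mn E n ζ) s‖) 0 (exp t) := by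
  obtain ⟨q, _, hq⟩ := S.h_poly E n s
  simp only [← hq]
  exact (analyticOnNhd_id.aeval_polynomial q).meromorphicOn.circleIntegrable_log_norm

variable {S}

/-- Main selection: a product `c ∏ (ζ - z i)` dominated by `nrm (Mn)` and almost optimal at `t`. -/
lemma exists_h {t : ℝ} (ht : S.ok t) (E : ℂ) (n : ℕ) : ∃ (m : ℕ) (c : ℂ) (z : Fin m → ℂ),
    m ≤ 2 * n ∧ c ≠ 0 ∧ (∀ ζ, ‖c * ∏ i, (ζ - z i)‖ ≤ nrm (S.Mn E n ζ)) ∧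
    S.a E t n - log 12 ≤ jen c z t := by
  obtain ⟨s, hs1, ⟨ζ0, h0⟩, hle⟩ := selection (Q := S.Mn E n) (S.continuous_Mn E n)
    (fun ζ hζ => nrm_Mn_pos ht hζ E n) (fun s => S.h_integrable E n s t)
  obtain ⟨q, hq, he⟩ := S.h_poly E n s
  have hq0 : q ≠ 0 := by
    rintro rfl
    apply h0
    rw [← he]; simp
  obtain ⟨c, z, hc, hz⟩ := poly_factor hq0
  refine ⟨q.natDegree, c, z, hq, hc, ?_, ?_⟩
  · intro ζ
    rw [← hz, he]
    exact hs_le _ hs1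
  · rw [← CA_jen hc]
    refine hle.trans (le_of_eq ?_)
    apply CA_congr
    intro ζ _
    rw [← hz, he]

lemma jen_le_a {t : ℝ} (ht : S.ok t) {E : ℂ} {n m : ℕ} {c : ℂ} {z : Fin m → ℂ} (hc : c ≠ 0)
    (h : ∀ ζ, ‖c * ∏ i, (ζ - z i)‖ ≤ nrm (S.Mn E n ζ)) : jen c z t ≤ S.a E t n := by
  have key : jen c z t = CA (fun ζ => log ‖c‖ + ∑ i, log ‖ζ - z i‖) t := by
    rw [← CA_jen hc]
    apply CA_congr_finite (Set.finite_range z)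
    intro ζ _ hζ
    have : ∀ i, ζ - z i ≠ 0 := fun i h => hζ ⟨i, (sub_eq_zero.1 h).symm⟩
    rw [norm_mul, norm_prod, log_mul (norm_ne_zero_iff.2 hc), log_prod]
    · intro i _; exact norm_ne_zero_iff.2 (this i)
    · exact Finset.prod_ne_zero_iff.2 fun i _ => norm_ne_zero_iff.2 (this i)
  rw [key]
  unfold a
  rw [CA_eq_cm, CA_eq_cm]
  apply integral_mono_ae
  · apply cm_integrable (f := fun ζ => log ‖c‖ + ∑ i, log ‖ζ - z i‖)
    have hi : ∀ i ∈ Finset.univ, CircleIntegrable (fun ζ => log ‖ζ - z i‖) 0 (exp t) :=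
      fun i _ => CA_log_sub_integrable (z i) t
    have hi2 : CircleIntegrable (fun ζ => ∑ i, log ‖ζ - z i‖) 0 (exp t) := by
      have := CircleIntegrable.sum Finset.univ hi
      convert this using 1
      ext ζ; simp
    have i1 : CircleIntegrable (fun _ => log ‖c‖) 0 (exp t) := CA_integrable continuousOn_const
    exact i1.add hi2
  · exact cm_integrable (int_log_nrm ht E n)
  · have hz := cm_countable ((Set.finite_range z).countable.preimage_circleMap 0 (exp_pos t).ne')
    have : ∀ᵐ θ ∂cm, θ ∉ circleMap 0 (exp t) ⁻¹' (Set.range z) := measure_eq_zero_iff_ae_notMem.1 hz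
    filter_upwards [this] with θ hθ
    set ζ := circleMap 0 (exp t) θ
    have hne : ∀ i, ζ - z i ≠ 0 := fun i h => hθ ⟨i, (sub_eq_zero.1 h).symm⟩
    have e : log ‖c‖ + ∑ i, log ‖ζ - z i‖ = log ‖c * ∏ i, (ζ - z i)‖ := by
      rw [norm_mul, norm_prod, log_mul (norm_ne_zero_iff.2 hc), log_prod]
      · intro i _; exact norm_ne_zero_iff.2 (hne i)
      · exact Finset.prod_ne_zero_iff.2 fun i _ => norm_ne_zero_iff.2 (hne i)
    simp only [e]
    apply log_le_log _ (h ζ)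
    rw [norm_pos_iff]
    exact mul_ne_zero hc (Finset.prod_ne_zero_iff.2 fun i _ => hne i)

end Sys
end Lyap

namespace Lyap
open Real Filter Topology MeasureTheory

lemma CA_inv (f : ℂ → ℝ) (t : ℝ) : CA (fun ζ => f ζ⁻¹) t = CA f (-t) := by
  unfold CA
  rw [circleAverage_eq_circleAverage_zero_one, circleAverage_eq_circleAverage_zero_one (f := f),
    ← circleAverage_zero_one_congr_inv]
  congr 1
  ext z
  congr 1
  rw [Real.exp_neg]
  simp [mul_comm]

namespace Sys
variable {S : Sys}

lemma Fn_tendsto_sub {t : ℝ} (ht : S.ok t) (E : ℂ) (C : ℝ) :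
    Tendsto (fun n : ℕ => (S.a E t n - C) / n) atTop (𝓝 (S.F E t)) := by
  have h1 := F_tendsto ht E
  have h2 : Tendsto (fun n : ℕ => C / (n : ℝ)) atTop (𝓝 0) := tendsto_const_div_atTop_nhds_zero_nat C
  have := h1.sub h2
  simp only [sub_zero] at this
  refine this.congr fun n => ?_
  ring

lemma F_mono {t1 t2 : ℝ} (h1 : S.ok t1) (h2 : S.ok t2) (h : t1 ≤ t2) (E : ℂ) : S.F E t1 ≤ S.F E t2 := by
  refine le_of_tendsto_of_tendsto (Fn_tendsto_sub h1 E (log 12)) (F_tendsto h2 E) ?_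
  filter_upwards with n
  obtain ⟨m, c, z, hm, hc, hle, hopt⟩ := exists_h h1 E n
  gcongr
  exact hopt.trans ((jen_mono c z h).trans (jen_le_a h2 hc hle))

lemma F_slope {t1 t2 : ℝ} (h1 : S.ok t1) (h2 : S.ok t2) (h : t1 ≤ t2) (E : ℂ) :
    S.F E t2 ≤ S.F E t1 + 2 * (t2 - t1) := by
  refine le_of_tendsto_of_tendsto (Fn_tendsto_sub h2 E (log 12)) ((F_tendsto h1 E).add_const (2 * (t2 - t1))) ?_
  filter_upwards [eventually_gt_atTop 0] with n hn
  obtain ⟨m, c, z, hm, hc, hle, hopt⟩ := exists_h h2 E n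
  have hn' : (0:ℝ) < n := by exact_mod_cast hn
  rw [div_add' _ _ _ hn'.ne']
  gcongr
  have := jen_slope c z h
  have h3 := jen_le_a h1 hc hle
  have hm' : (m : ℝ) ≤ 2 * n := by exact_mod_cast hm
  have : (m : ℝ) * (t2 - t1) ≤ 2 * n * (t2 - t1) := mul_le_mul_of_nonneg_right hm' (by linarith)
  linarith

lemma F_convex {t1 t t2 : ℝ} (h1 : S.ok t1) (h2 : S.ok t2) (ht1 : t1 ≤ t) (ht2 : t ≤ t2) (E : ℂ) :
    (t2 - t1) * S.F E t ≤ (t2 - t) * S.F E t1 + (t - t1) * S.F E t2 := by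
  have ht := h1.conv h2 ht1 ht2
  refine le_of_tendsto_of_tendsto ((Fn_tendsto_sub ht E (log 12)).const_mul (t2 - t1))
    (((F_tendsto h1 E).const_mul (t2 - t)).add ((F_tendsto h2 E).const_mul (t - t1))) ?_
  filter_upwards [eventually_gt_atTop 0] with n hn
  obtain ⟨m, c, z, hm, hc, hle, hopt⟩ := exists_h ht E n
  have hn' : (0:ℝ) < n := by exact_mod_cast hn
  have e1 := jen_le_a h1 hc hle
  have e2 := jen_le_a h2 hc hle
  have key : (t2 - t1) * jen c z t ≤ (t2 - t) * jen c z t1 + (t - t1) * jen c z t2 := by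
    rcases (ht1.trans ht2).eq_or_lt with h | h
    · have : t = t1 := by linarith
      have : t = t2 := by linarith
      subst_vars; simp
    · have hpos : 0 < t2 - t1 := by linarith
      have := (jen_convex c z).2 (Set.mem_univ t1) (Set.mem_univ t2)
        (show 0 ≤ (t2 - t) / (t2 - t1) from div_nonneg (by linarith) hpos.le)
        (show 0 ≤ (t - t1) / (t2 - t1) from div_nonneg (by linarith) hpos.le) (by field_simp; ring)
      have e : ((t2 - t) / (t2 - t1)) • t1 + ((t - t1) / (t2 - t1)) • t2 = t := by
        simp only [smul_eq_mul]; field_simp; ring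
      rw [e] at this
      simp only [smul_eq_mul] at this
      calc (t2 - t1) * jen c z t ≤ (t2 - t1) * ((t2 - t) / (t2 - t1) * jen c z t1 + (t - t1) / (t2 - t1) * jen c z t2) := by
            gcongr
        _ = _ := by field_simp
  have : (t2 - t1) * (S.a E t n - log 12) ≤ (t2 - t) * S.a E t1 n + (t - t1) * S.a E t2 n := by
    calc (t2 - t1) * (S.a E t n - log 12) ≤ (t2 - t1) * jen c z t := by
          apply mul_le_mul_of_nonneg_left hopt; linarith
      _ ≤ _ := key
      _ ≤ _ := by
        apply add_le_add <;> apply mul_le_mul_of_nonneg_left <;> linarith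
  calc (t2 - t1) * ((S.a E t n - log 12) / n) = ((t2 - t1) * (S.a E t n - log 12)) / n := by ring
    _ ≤ ((t2 - t) * S.a E t1 n + (t - t1) * S.a E t2 n) / n := by gcongr
    _ = _ := by ring

/-! symmetry -/

lemma M_inv (E : ℂ) {ζ : ℂ} (h : ζ ≠ 0) : S.M E ζ⁻¹ = (ζ ^ 2)⁻¹ • S.M E ζ := by
  have hd : S.d ζ⁻¹ = (ζ ^ 2)⁻¹ * S.d ζ := by
    unfold d; field_simp; ring
  ext i j
  fin_cases i <;> fin_cases j <;> simp [M, hd]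
  field_simp; ring

noncomputable def R (S : Sys) (E : ℂ) : ℕ → ℂ → Matrix (Fin 2) (Fin 2) ℂ
  | 0, _ => 1
  | n + 1, ζ => R S E n ζ * S.M E (S.β ^ n * ζ)

lemma R_eq (E ζ : ℂ) (n : ℕ) :
    S.R E n ζ = !![1, 0; 0, -1] * (S.Mn E n ζ).transpose * !![1, 0; 0, -1] := by
  induction n with
  | zero =>
    simp only [R, Mn_zero]
    ext i j
    fin_cases i <;> fin_cases j <;> simp [Matrix.mul_apply]
  | succ n ih =>
    simp only [R]
    rw [ih, Mn_succ, Matrix.transpose_mul]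
    have hM : ∀ w, (S.M E w) = !![1, 0; 0, -1] * (S.M E w).transpose * !![1, 0; 0, -1] := by
      intro w
      ext i j
      fin_cases i <;> fin_cases j <;> simp [M, Matrix.mul_apply, Matrix.vecMul, dotProduct, Fin.sum_univ_two]
    have hJ : (!![1, 0; 0, -1] : Matrix (Fin 2) (Fin 2) ℂ) * !![1, 0; 0, -1] = 1 := by
      ext i j
      fin_cases i <;> fin_cases j <;> simp [Matrix.mul_apply]
    conv_lhs => rw [hM]
    simp only [Matrix.mul_assoc]
    congr 2
    rw [← Matrix.mul_assoc _ _ ((S.M E (S.β ^ n * ζ)).transpose * _), hJ, Matrix.one_mul]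

lemma nrm_R (E ζ : ℂ) (n : ℕ) : nrm (S.R E n ζ) = nrm (S.Mn E n ζ) := by
  rw [R_eq]
  simp [nrm, Matrix.mul_apply, Matrix.vecMul, dotProduct, Fin.sum_univ_two]
  ring

lemma Mn_inv (E : ℂ) {t : ℝ} {ζ : ℂ} (hζ : ‖ζ‖ = exp t) (n : ℕ) :
    ∃ c : ℂ, ‖c‖ = exp (-(2 * n * t)) ∧ S.Mn E n (S.β * (S.β ^ n * ζ)⁻¹) = c • S.R E n ζ := by
  have h0 : ζ ≠ 0 := by
    intro h; rw [h, norm_zero] at hζ; exact (exp_pos t).ne hζ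
  have hβ := S.β_ne
  induction n with
  | zero => exact ⟨1, by simp, by simp [Mn_zero, R]⟩
  | succ n ih =>
    obtain ⟨c, hc, he⟩ := ih
    refine ⟨c * ((S.β ^ n * ζ) ^ 2)⁻¹, ?_, ?_⟩
    · rw [norm_mul, hc, norm_inv, norm_pow, norm_rot hζ, ← exp_nat_mul, ← exp_neg, ← exp_add]
      congr 1; push_cast; ring
    · have e : S.β * (S.β ^ (n + 1) * ζ)⁻¹ = (S.β ^ n * ζ)⁻¹ := by field_simp; ring
      rw [e, Mn_add, pow_one, he]
      simp only [Mn_succ, Mn_zero, pow_zero, one_mul, Matrix.mul_one, R]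
      rw [M_inv E (mul_ne_zero (pow_ne_zero _ hβ) h0)]
      rw [Matrix.smul_mul, Matrix.mul_smul, smul_smul]

lemma a_symm {t : ℝ} (ht : S.ok t) (E : ℂ) (n : ℕ) : S.a E (-t) n = S.a E t n - 2 * n * t := by
  unfold a
  rw [← CA_inv (fun ζ => log (nrm (S.Mn E n ζ)))]
  have hn : ‖(S.β * (S.β ^ n)⁻¹)⁻¹‖ = 1 := by
    rw [norm_inv, norm_mul, norm_inv, S.norm_β, S.norm_βpow]; simp
  rw [← CA_rot _ t hn]
  have : ∀ ζ, ‖ζ‖ = exp t → log (nrm (S.Mn E n ((S.β * (S.β ^ n)⁻¹)⁻¹ * ζ)⁻¹)) =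
      -(2 * n * t) + log (nrm (S.Mn E n ζ)) := by
    intro ζ hζ
    obtain ⟨c, hc, he⟩ := Mn_inv (S := S) E hζ n
    have e : ((S.β * (S.β ^ n)⁻¹)⁻¹ * ζ)⁻¹ = S.β * (S.β ^ n * ζ)⁻¹ := by
      have hβ := S.β_ne
      simp only [mul_inv, inv_inv]; ring
    rw [e, he, nrm_smul, hc, nrm_R, log_mul (exp_pos _).ne' (nrm_Mn_pos ht hζ E n).ne', log_exp]
  rw [CA_congr this, CA_add (CA_integrable continuousOn_const) (int_log_nrm ht E n), CA_const]
  ring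

lemma F_symm {t : ℝ} (ht : S.ok t) (E : ℂ) : S.F E (-t) = S.F E t - 2 * t := by
  refine tendsto_nhds_unique (F_tendsto ht.neg E) (((F_tendsto ht E).sub_const (2 * t)).congr' ?_)
  filter_upwards [eventually_gt_atTop 0] with n hn
  have hn' : (0:ℝ) < n := by exact_mod_cast hn
  rw [a_symm ht]
  field_simp

/-- `F - t` is at least its value at 0 -/
lemma F_ge_zero {t : ℝ} (ht : S.ok t) (E : ℂ) : S.F E 0 + t ≤ S.F E t := by
  rcases le_total 0 t with h | h
  · have := F_convex (S := S) ht.neg ht (by linarith) h E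
    rw [F_symm ht] at this
    rcases h.eq_or_lt with h0 | h0
    · rw [← h0]; simp
    · nlinarith
  · have := F_convex (S := S) ht ht.neg h (by linarith) E
    rw [F_symm ht] at this
    rcases h.eq_or_lt with h0 | h0
    · rw [h0]; simp
    · nlinarith

end Sys
end Lyap

namespace Lyap
open Real Filter Topology MeasureTheory

section weyl
local instance fact2pi : Fact ((0:ℝ) < 2 * π) := ⟨two_pi_pos⟩

noncomputable def Av (f : C(AddCircle (2 * π), ℂ)) : ℂ := ∫ θ in (0:ℝ)..(2 * π), (2 * π : ℂ)⁻¹ * f (θ : AddCircle (2 * π))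

lemma Av_cont (f : C(AddCircle (2 * π), ℂ)) : Continuous fun θ : ℝ => (2 * π : ℂ)⁻¹ * f (θ : AddCircle (2 * π)) :=
  continuous_const.mul (f.continuous.comp (AddCircle.continuous_mk' _))

lemma Av_add (f g : C(AddCircle (2 * π), ℂ)) : Av (f + g) = Av f + Av g := by
  unfold Av
  rw [← intervalIntegral.integral_add ((Av_cont f).intervalIntegrable _ _) ((Av_cont g).intervalIntegrable _ _)]
  congr 1; ext θ; simp; ring

lemma Av_smul (c : ℂ) (f : C(AddCircle (2 * π), ℂ)) : Av (c • f) = c * Av f := by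
  unfold Av
  rw [← intervalIntegral.integral_const_mul]
  congr 1; ext θ; simp; ring

lemma Av_norm (f : C(AddCircle (2 * π), ℂ)) : ‖Av f‖ ≤ ‖f‖ := by
  unfold Av
  have hp := two_pi_pos
  have := intervalIntegral.norm_integral_le_of_norm_le_const (a := 0) (b := 2 * π) (C := (2 * π)⁻¹ * ‖f‖)
    (f := fun θ : ℝ => (2 * π : ℂ)⁻¹ * f (θ : AddCircle (2 * π))) (by
      intro θ _
      rw [norm_mul]
      gcongr
      · simp [abs_of_pos pi_pos]
      · exact f.norm_coe_le_norm _)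
  refine this.trans (le_of_eq ?_)
  rw [sub_zero, abs_of_pos hp]; field_simp

lemma Av_fourier {k : ℤ} (hk : k ≠ 0) : Av (fourier k) = 0 := by
  unfold Av
  have hpi : (π : ℂ) ≠ 0 := by exact_mod_cast pi_ne_zero
  have hk' : (k : ℂ) ≠ 0 := by exact_mod_cast hk
  have : ∀ θ : ℝ, (2 * π : ℂ)⁻¹ * (fourier k) (θ : AddCircle (2 * π)) = (2 * π : ℂ)⁻¹ * Complex.exp (Complex.I * k * θ) := by
    intro θ
    rw [fourier_coe_apply]
    congr 2
    push_cast
    field_simp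
  simp only [this]
  rw [intervalIntegral.integral_const_mul, integral_exp_mul_complex (mul_ne_zero Complex.I_ne_zero hk')]
  have e : Complex.exp (Complex.I * k * (2 * π : ℝ)) = 1 := by
    rw [Complex.exp_eq_one_iff]
    exact ⟨k, by push_cast; ring⟩
  rw [e]; simp

def UD (x0 : AddCircle (2 * π)) (f : C(AddCircle (2 * π), ℂ)) : Prop :=
  ∀ ε > 0, ∃ N : ℕ, ∀ n ≥ N, ∀ x, ‖∑ l ∈ Finset.range n, f (x + l • x0) - n * Av f‖ ≤ ε * n

lemma UD_fourier (x0 : AddCircle (2 * π)) (hx : ∀ k : ℤ, k ≠ 0 → fourier k x0 ≠ 1) (k : ℤ) :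
    UD x0 (fourier k) := by
  intro ε hε
  by_cases hk : k = 0
  · refine ⟨0, fun n _ x => ?_⟩
    subst hk
    have : Av (fourier 0) = 1 := by
      unfold Av
      have hpi : (π : ℂ) ≠ 0 := by exact_mod_cast pi_ne_zero
      simp
      field_simp
    rw [this]
    simp
    positivity
  · have hq := hx k hk
    set q := fourier k x0 with hqd
    have hqn : ‖q‖ = 1 := by rw [hqd, fourier_apply]; exact Circle.norm_coe _
    have hpos : 0 < ‖q - 1‖ := norm_pos_iff.2 (sub_ne_zero.2 hq)
    obtain ⟨N, hN⟩ := exists_nat_gt (2 / ‖q - 1‖ / ε)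
    refine ⟨N, fun n hn x => ?_⟩
    rw [Av_fourier hk, mul_zero, sub_zero]
    have e : ∀ l ∈ Finset.range n, (fourier k) (x + l • x0) = (fourier k x : ℂ) * q ^ l := by
      intro l _
      simp only [hqd, fourier_apply, smul_add, AddCircle.toCircle_add, Circle.coe_mul]
      congr 1
      rw [smul_comm, AddCircle.toCircle_nsmul]
      simp
    rw [Finset.sum_congr rfl e, ← Finset.mul_sum, norm_mul, geom_sum_eq hq, norm_div]
    have h1 : ‖(fourier k x : ℂ)‖ = 1 := by rw [fourier_apply]; exact Circle.norm_coe _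
    rw [h1, one_mul, div_le_iff₀ hpos]
    have h2 : ‖q ^ n - 1‖ ≤ 2 := by
      refine (norm_sub_le _ _).trans ?_
      rw [norm_pow, hqn]; norm_num
    have h3 : 2 / ‖q - 1‖ < ε * n := by
      rw [div_lt_iff₀ hε] at hN
      have : (N : ℝ) ≤ n := by exact_mod_cast hn
      nlinarith
    rw [div_lt_iff₀ hpos] at h3
    linarith

lemma UD_all (x0 : AddCircle (2 * π)) (hx : ∀ k : ℤ, k ≠ 0 → fourier k x0 ≠ 1) (f : C(AddCircle (2 * π), ℂ)) :
    UD x0 f := by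
  have hspan : ∀ g ∈ Submodule.span ℂ (Set.range (@fourier (2 * π))), UD x0 g := by
    intro g hg
    induction hg using Submodule.span_induction with
    | mem g hg =>
      obtain ⟨k, rfl⟩ := hg
      exact UD_fourier x0 hx k
    | zero =>
      intro ε hε
      refine ⟨0, fun n _ x => ?_⟩
      have : Av 0 = 0 := by simp [Av]
      rw [this]; simp; positivity
    | add f g _ _ h1 h2 =>
      intro ε hε
      obtain ⟨N1, h1⟩ := h1 (ε / 2) (by positivity)
      obtain ⟨N2, h2⟩ := h2 (ε / 2) (by positivity)
      refine ⟨max N1 N2, fun n hn x => ?_⟩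
      have a1 := h1 n (le_trans (le_max_left _ _) hn) x
      have a2 := h2 n (le_trans (le_max_right _ _) hn) x
      rw [Av_add]
      simp only [ContinuousMap.add_apply, Finset.sum_add_distrib]
      calc _ = ‖(∑ l ∈ Finset.range n, f (x + l • x0) - n * Av f) + (∑ l ∈ Finset.range n, g (x + l • x0) - n * Av g)‖ := by
            congr 1; ring
        _ ≤ _ := norm_add_le _ _
        _ ≤ ε * n := by linarith
    | smul c f _ h1 =>
      intro ε hε
      obtain ⟨N1, h1⟩ := h1 (ε / (‖c‖ + 1)) (by positivity)
      refine ⟨N1, fun n hn x => ?_⟩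
      have a1 := h1 n hn x
      rw [Av_smul]
      simp only [ContinuousMap.smul_apply, smul_eq_mul, ← Finset.mul_sum]
      calc _ = ‖c * (∑ l ∈ Finset.range n, f (x + l • x0) - n * Av f)‖ := by congr 1; ring
        _ = ‖c‖ * _ := norm_mul _ _
        _ ≤ (‖c‖ + 1) * (ε / (‖c‖ + 1) * n) := by gcongr; linarith
        _ = ε * n := by field_simp
  intro ε hε
  have hd : f ∈ (Submodule.span ℂ (Set.range (@fourier (2 * π)))).topologicalClosure := by
    rw [span_fourier_closure_eq_top]; trivial
  rw [← SetLike.mem_coe, Submodule.topologicalClosure_coe, Metric.mem_closure_iff] at hd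
  obtain ⟨g, hg, hfg⟩ := hd (ε / 3) (by positivity)
  obtain ⟨N, hN⟩ := hspan g hg (ε / 3) (by positivity)
  refine ⟨N, fun n hn x => ?_⟩
  have a1 := hN n hn x
  have e : Av f = Av g + Av (f - g) := by rw [← Av_add]; congr 1; simp
  have hn1 : ‖f - g‖ ≤ ε / 3 := by rw [← dist_eq_norm]; exact hfg.le
  have e2 : ‖∑ l ∈ Finset.range n, (f - g) (x + l • x0)‖ ≤ ε / 3 * n := by
    refine (norm_sum_le _ _).trans ?_
    calc _ ≤ ∑ l ∈ Finset.range n, ε / 3 := Finset.sum_le_sum fun l _ => ((f - g).norm_coe_le_norm _).trans hn1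
      _ = _ := by simp; ring
  have e3 : ‖(n : ℂ) * Av (f - g)‖ ≤ ε / 3 * n := by
    rw [norm_mul, Complex.norm_natCast, mul_comm]
    gcongr
    exact (Av_norm _).trans hn1
  calc _ = ‖(∑ l ∈ Finset.range n, g (x + l • x0) - n * Av g) + (∑ l ∈ Finset.range n, (f - g) (x + l • x0)) - n * Av (f - g)‖ := by
        rw [e]; simp only [ContinuousMap.sub_apply, Finset.sum_sub_distrib]; congr 1; ring
    _ ≤ ε / 3 * n + ε / 3 * n + ε / 3 * n := (norm_sub_le _ _).trans (add_le_add ((norm_add_le _ _).trans (add_le_add a1 e2)) e3)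
    _ = _ := by ring

theorem weyl {w : ℂ} (hw : ‖w‖ = 1) (hirr : ∀ k : ℕ, 0 < k → w ^ k ≠ 1) (t : ℝ) {φ : ℂ → ℝ}
    (hφ : ContinuousOn φ {ζ | ‖ζ‖ = exp t}) {ε : ℝ} (hε : 0 < ε) :
    ∃ N : ℕ, ∀ n ≥ N, ∀ ζ, ‖ζ‖ = exp t →
      |∑ l ∈ Finset.range n, φ (w ^ l * ζ) - n * CA φ t| ≤ ε * n := by
  have hpi : (π : ℂ) ≠ 0 := by exact_mod_cast pi_ne_zero
  let em : AddCircle (2 * π) → ℂ := fun x => (exp t : ℝ) * (AddCircle.toCircle x : ℂ)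
  have hem : Continuous em := continuous_const.mul (continuous_subtype_val.comp AddCircle.continuous_toCircle)
  have hemn : ∀ x, ‖em x‖ = exp t := fun x => by
    simp only [em, norm_mul, Complex.norm_real, Circle.norm_coe, mul_one, Real.norm_eq_abs,
      abs_of_pos (exp_pos t)]
  let f : C(AddCircle (2 * π), ℂ) := ⟨fun x => (φ (em x) : ℂ), by
    apply Complex.continuous_ofReal.comp
    exact hφ.comp_continuous hem hemn⟩
  have htc : ∀ θ : ℝ, (AddCircle.toCircle (θ : AddCircle (2 * π)) : ℂ) = Complex.exp (θ * Complex.I) := by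
    intro θ
    rw [AddCircle.toCircle_apply_mk, Circle.coe_exp]
    congr 2
    push_cast; field_simp
  have hAv : Av f = (CA φ t : ℂ) := by
    unfold Av CA
    rw [circleAverage_def, ← intervalIntegral.integral_smul, ← intervalIntegral.integral_ofReal]
    congr 1
    ext θ
    simp only [f, ContinuousMap.coe_mk, em, htc, circleMap_zero, smul_eq_mul]
    push_cast; rfl
  set x0 : AddCircle (2 * π) := ((Complex.arg w : ℝ) : AddCircle (2 * π)) with hx0
  have hx0w : (AddCircle.toCircle x0 : ℂ) = w := by
    rw [htc]
    conv_rhs => rw [← Complex.norm_mul_exp_arg_mul_I w, hw]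
    simp
  have hirr' : ∀ k : ℤ, k ≠ 0 → fourier k x0 ≠ 1 := by
    intro k hk h
    rw [fourier_apply, AddCircle.toCircle_zsmul, Circle.coe_zpow, hx0w] at h
    rcases Int.natAbs_eq k with h1 | h1
    · rw [h1, zpow_natCast] at h
      exact hirr _ (Int.natAbs_pos.2 hk) h
    · rw [h1, zpow_neg, zpow_natCast, inv_eq_one] at h
      exact hirr _ (Int.natAbs_pos.2 hk) h
  obtain ⟨N, hN⟩ := UD_all x0 hirr' f ε hε
  refine ⟨N, fun n hn ζ hζ => ?_⟩
  have := hN n hn ((Complex.arg ζ : ℝ) : AddCircle (2 * π))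
  have e : ∀ l ∈ Finset.range n, f (((Complex.arg ζ : ℝ) : AddCircle (2 * π)) + l • x0) = (φ (w ^ l * ζ) : ℂ) := by
    intro l _
    simp only [f, ContinuousMap.coe_mk, em]
    rw [AddCircle.toCircle_add, AddCircle.toCircle_nsmul, Circle.coe_mul, Circle.coe_pow, hx0w, htc]
    congr 2
    conv_rhs => rw [← Complex.norm_mul_exp_arg_mul_I ζ, hζ]
    ring
  rw [Finset.sum_congr rfl e, hAv] at this
  have e2 : (∑ l ∈ Finset.range n, (φ (w ^ l * ζ) : ℂ)) - n * (CA φ t : ℂ) =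
    ((∑ l ∈ Finset.range n, φ (w ^ l * ζ) - n * CA φ t : ℝ) : ℂ) := by push_cast; rfl
  rw [e2, Complex.norm_real, Real.norm_eq_abs] at this
  exact this

end weyl

lemma Sys.β_irr (S : Sys) (k : ℕ) (hk : 0 < k) : S.β ^ k ≠ 1 := by
  intro h
  unfold Sys.β at h
  rw [← Complex.exp_nat_mul, Complex.exp_eq_one_iff] at h
  obtain ⟨n, hn⟩ := h
  have hI : (2 * (π : ℂ) * Complex.I) ≠ 0 := Complex.two_pi_I_ne_zero
  have : (k : ℂ) * S.b = n := by
    apply mul_right_cancel₀ hI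
    rw [← hn]; push_cast; ring
  have h2 : (k : ℝ) * S.b = n := by exact_mod_cast this
  have hk' : (k : ℝ) ≠ 0 := by exact_mod_cast hk.ne'
  apply S.hb
  refine ⟨(n : ℚ) / k, ?_⟩
  push_cast
  rw [← h2]; field_simp

end Lyap

namespace Lyap
open Real Filter Topology MeasureTheory
namespace Sys
variable {S : Sys}

lemma nrm_le_bdd (E : ℂ) (R : ℝ) (n : ℕ) : ∃ C : ℝ, 1 ≤ C ∧ ∀ k ≤ n, ∀ ζ, ‖ζ‖ ≤ R → nrm (S.Mn E k ζ) ≤ C := by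
  induction n with
  | zero =>
    refine ⟨2, by norm_num, fun k hk ζ _ => ?_⟩
    rw [Nat.le_zero.1 hk, Mn_zero, nrm_one]
  | succ n ih =>
    obtain ⟨C, hC1, hC⟩ := ih
    obtain ⟨C', hC'⟩ := (isCompact_closedBall (0:ℂ) R).exists_bound_of_continuousOn
      (continuous_nrm.comp (S.continuous_Mn E (n+1))).continuousOn
    refine ⟨max C C', le_max_of_le_left hC1, fun k hk ζ hζ => ?_⟩
    rcases Nat.lt_or_ge n k with h | h
    · have : k = n + 1 := by omega
      subst this
      refine le_trans ?_ (le_max_right _ _)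
      have := hC' ζ (by simpa using hζ)
      exact (le_abs_self _).trans this
    · exact (hC k h ζ hζ).trans (le_max_left _ _)

lemma Mn_block {t : ℝ} (ht : S.ok t) (E : ℂ) {ζ : ℂ} (hζ : ‖ζ‖ = exp t) (m q : ℕ) :
    nrm (S.Mn E (q * m) ζ) ≤ 2 * exp (∑ l ∈ Finset.range q, log (nrm (S.Mn E m ((S.β ^ m) ^ l * ζ)))) := by
  induction q with
  | zero => simp [Mn_zero, nrm_one]
  | succ q ih =>
    rw [show (q + 1) * m = m + q * m by ring, Mn_add, Finset.sum_range_succ, exp_add]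
    refine (nrm_mul_le _ _).trans ?_
    have e : S.β ^ (q * m) * ζ = (S.β ^ m) ^ q * ζ := by rw [← pow_mul, mul_comm q m]
    rw [e, exp_log, mul_comm, ← mul_assoc]
    · gcongr
      exact nrm_nonneg _
    · rw [← e]
      exact nrm_Mn_pos ht (norm_rot hζ _) E m

lemma upper_circle {t : ℝ} (ht : S.ok t) (E : ℂ) {κ' : ℝ} (hκ : 0 < κ') :
    ∃ C : ℝ, 0 < C ∧ ∀ n : ℕ, ∀ ζ, ‖ζ‖ = exp t → nrm (S.Mn E n ζ) ≤ C * exp (n * (S.F E t + κ')) := by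
  obtain ⟨m, hm0, hm⟩ : ∃ m : ℕ, 0 < m ∧ S.a E t m / m < S.F E t + κ' / 2 := by
    have h1 : ∀ᶠ n : ℕ in atTop, S.a E t n / n < S.F E t + κ' / 2 :=
      (F_tendsto ht E).eventually_lt_const (by linarith)
    obtain ⟨m, h2, h3⟩ := (h1.and (eventually_gt_atTop 0)).exists
    exact ⟨m, h3, h2⟩
  have hm' : (0:ℝ) < m := by exact_mod_cast hm0
  obtain ⟨N, hN⟩ := weyl (w := S.β ^ m) (S.norm_βpow m) (fun k hk => by
    rw [← pow_mul]; exact S.β_irr _ (Nat.mul_pos hm0 hk)) t (cont_log_nrm ht E m) (ε := m * κ' / 2) (by positivity)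
  obtain ⟨C1, hC1, hC1'⟩ := nrm_le_bdd (S := S) E (exp t) ((N + 1) * m)
  set G := S.F E t + κ' with hG
  have hC2 : ∃ c : ℝ, 0 < c ∧ ∀ k : ℕ, k ≤ (N + 1) * m → c ≤ exp (k * G) := by
    refine ⟨exp (- (((N + 1) * m : ℕ) * |G|)), exp_pos _, fun k hk => ?_⟩
    apply exp_le_exp.2
    have : (k : ℝ) ≤ ((N + 1) * m : ℕ) := by exact_mod_cast hk
    have h2 := neg_abs_le G
    have h3 := abs_nonneg G
    have h4 : (0:ℝ) ≤ k := by positivity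
    nlinarith
  obtain ⟨c, hc, hc'⟩ := hC2
  refine ⟨2 * C1 / c, by positivity, fun n ζ hζ => ?_⟩
  have hle : ∀ k ≤ (N + 1) * m, ∀ ξ, ‖ξ‖ = exp t → nrm (S.Mn E k ξ) ≤ C1 / c * exp (k * G) := by
    intro k hk ξ hξ
    refine (hC1' k hk ξ hξ.le).trans ?_
    rw [div_mul_eq_mul_div, le_div_iff₀ hc]
    have := hc' k hk
    nlinarith
  rcases Nat.lt_or_ge n ((N + 1) * m) with h | h
  · refine (hle n h.le ζ hζ).trans ?_
    gcongr
    linarith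
  · obtain ⟨q, r, hr, hn⟩ : ∃ q r, r < m ∧ n = r + q * m :=
      ⟨n / m, n % m, Nat.mod_lt _ hm0, by rw [mul_comm]; exact (Nat.mod_add_div n m).symm⟩
    have hqN : N ≤ q := by
      by_contra! hq
      have : (q + 1) * m ≤ (N + 1) * m := Nat.mul_le_mul_right _ (by omega)
      nlinarith
    have h1 := hN q hqN ζ hζ
    have h2 : ∑ l ∈ Finset.range q, log (nrm (S.Mn E m ((S.β ^ m) ^ l * ζ))) ≤ q * m * G := by
      have h3 : S.a E t m < m * (S.F E t + κ' / 2) := by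
        rw [div_lt_iff₀ hm'] at hm; linarith
      have h4 := (abs_le.1 h1).2
      change _ - q * S.a E t m ≤ _ at h4
      have h5 : (0:ℝ) ≤ q := by positivity
      nlinarith
    rw [hn, Mn_add]
    refine (nrm_mul_le _ _).trans ?_
    have h6 := hle r (hr.le.trans (by nlinarith)) _ (norm_rot (S := S) hζ (q * m))
    have h7 := (Mn_block ht E hζ m q).trans (mul_le_mul_of_nonneg_left (exp_le_exp.2 h2) zero_le_two)
    calc _ ≤ (C1 / c * exp (r * G)) * (2 * exp (q * m * G)) :=
          mul_le_mul h6 h7 (nrm_nonneg _) (by positivity)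
      _ = 2 * C1 / c * exp (((r + q * m : ℕ) : ℝ) * G) := by
        push_cast
        rw [add_mul, exp_add]; ring

lemma Mn_diff (E : ℂ) (n : ℕ) (i j : Fin 2) : Differentiable ℂ (fun ζ => S.Mn E n ζ i j) := by
  have hd : Differentiable ℂ S.d := by unfold d; fun_prop
  have hM : ∀ i j, Differentiable ℂ (fun ζ => S.M E ζ i j) := by
    intro i j
    fin_cases i <;> fin_cases j <;> simp [M] <;> fun_prop
  induction n generalizing i j with
  | zero => simp only [Mn_zero]; fun_prop
  | succ n ih =>
    simp only [Mn_succ, Matrix.mul_apply, Fin.sum_univ_two]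
    have h := fun j => (hM i j).comp (f := fun ζ : ℂ => S.β ^ n * ζ) (by fun_prop)
    exact ((h 0).mul (ih 0 j)).add ((h 1).mul (ih 1 j))

lemma disc_bound {f : ℂ → ℂ} (hf : Differentiable ℂ f) {z0 : ℂ} {r C : ℝ} (hr : 0 < r) (h : ∀ ζ, ‖ζ - z0‖ = r → ‖f ζ‖ ≤ C)
    {ζ : ℂ} (hζ : ‖ζ - z0‖ ≤ r) : ‖f ζ‖ ≤ C := by
  refine Complex.norm_le_of_forall_mem_frontier_norm_le (U := Metric.ball z0 r) Metric.isBounded_ball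
    hf.diffContOnCl ?_ ?_
  · intro z hz
    rw [frontier_ball _ hr.ne'] at hz
    exact h z (by simpa [dist_eq_norm] using hz)
  · rw [closure_ball _ hr.ne']
    simpa [dist_eq_norm] using hζ

lemma upper_disc {t : ℝ} (ht : S.ok t) (E : ℂ) {κ' : ℝ} (hκ : 0 < κ') :
    ∃ C : ℝ, 0 < C ∧ ∀ n : ℕ, ∀ ζ, ‖ζ‖ ≤ exp t → nrm (S.Mn E n ζ) ≤ C * exp (n * (S.F E t + κ')) := by
  obtain ⟨C, hC, h⟩ := upper_circle ht E hκ
  refine ⟨4 * C, by positivity, fun n ζ hζ => ?_⟩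
  have key : ∀ i j, ‖S.Mn E n ζ i j‖ ≤ C * exp (n * (S.F E t + κ')) := by
    intro i j
    refine disc_bound (Mn_diff E n i j) (z0 := 0) (exp_pos t) (fun ξ hξ => ?_) (by simpa using hζ)
    exact (entry_le_nrm _ i j).trans (h n ξ (by simpa using hξ))
  unfold nrm
  linarith [key 0 0, key 0 1, key 1 0, key 1 1]

lemma upper_D {t : ℝ} (ht : S.ok t) {κ' : ℝ} (hκ : 0 < κ') :
    ∃ C : ℝ, 0 < C ∧ ∀ n : ℕ, ∀ ζ, ‖ζ‖ = exp t → ‖S.Dn n ζ‖ ≤ C * exp (n * (S.κ + t + κ')) := by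
  obtain ⟨N, hN⟩ := weyl S.norm_β S.β_irr t (cont_log_d ht) hκ
  have hC2 : ∀ N, ∃ C : ℝ, 1 ≤ C ∧ ∀ k < N, ∀ ζ, ‖ζ‖ = exp t → ‖S.Dn k ζ‖ ≤ C * exp (k * (S.κ + t + κ')) := by
    intro N
    induction N with
    | zero => exact ⟨1, le_rfl, by simp⟩
    | succ N ih =>
      obtain ⟨C, hC1, hC⟩ := ih
      obtain ⟨C', hC'⟩ := (isCompact_closedBall (0:ℂ) (exp t)).exists_bound_of_continuousOn
        ((S.continuous_Dn N).div_const (((exp (N * (S.κ + t + κ'))) : ℝ) : ℂ)).continuousOn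
      refine ⟨max C C', le_max_of_le_left hC1, fun k hk ζ hζ => ?_⟩
      rcases Nat.lt_or_ge k N with h | h
      · refine (hC k h ζ hζ).trans ?_
        gcongr
        exact le_max_left _ _
      · obtain rfl : k = N := by omega
        have := hC' ζ (by simp [hζ])
        rw [norm_div, Complex.norm_real, Real.norm_eq_abs, abs_exp, div_le_iff₀ (exp_pos _)] at this
        refine this.trans ?_
        gcongr
        exact le_max_right _ _
  obtain ⟨C, hC1, hC⟩ := hC2 N
  refine ⟨C, by linarith, fun n ζ hζ => ?_⟩
  rcases Nat.lt_or_ge n N with h | h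
  · exact hC n h ζ hζ
  · have h1 := hN n h ζ hζ
    rw [← log_Dn ht hζ, CA_log_d ht] at h1
    have h2 := (abs_le.1 h1).2
    have h3 : log ‖S.Dn n ζ‖ ≤ n * (S.κ + t + κ') := by linarith
    rw [log_le_iff_le_exp (norm_pos_iff.2 (Dn_ne ht hζ n))] at h3
    refine h3.trans ?_
    have := exp_pos (n * (S.κ + t + κ'))
    nlinarith

end Sys
end Lyap

namespace Lyap
open Real Filter Topology MeasureTheory

lemma dirichlet_large {b : ℝ} (hb : Irrational b) (Q : ℕ) :
    ∃ r : ℚ, Q < r.den ∧ |b - r| < 1 / (r.den : ℝ) ^ 2 := by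
  by_contra! h
  have hinf := Real.infinite_rat_abs_sub_lt_one_div_den_sq_of_irrational hb
  apply hinf
  let B : ℤ := ⌈(|b| + 1) * Q⌉
  have hfin : ((Set.Icc (-B) B) ×ˢ (Set.Iic Q) : Set (ℤ × ℕ)).Finite :=
    (Set.finite_Icc _ _).prod (Set.finite_Iic _)
  refine Set.Finite.of_finite_image (f := fun r : ℚ => (r.num, r.den)) (hfin.subset ?_) ?_
  · rintro _ ⟨r, hr, rfl⟩
    have hr' : |b - r| < 1 / (r.den : ℝ) ^ 2 := hr
    have hden : r.den ≤ Q := by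
      by_contra! h2
      exact absurd hr' (not_lt.2 (h r h2))
    refine ⟨?_, hden⟩
    have hd1 : (1:ℝ) ≤ r.den := by exact_mod_cast r.den_pos
    have h1 : 1 / (r.den : ℝ) ^ 2 ≤ 1 := by
      rw [div_le_one (by positivity)]; nlinarith
    have h2 : |(r:ℝ)| ≤ |b| + 1 := by
      have := abs_sub_abs_le_abs_sub (r:ℝ) b
      rw [abs_sub_comm] at this
      linarith
    have h3 : (r.num : ℝ) = r * r.den := by
      have := Rat.mul_den_eq_num r
      exact_mod_cast this.symm
    have h4 : |(r.num : ℝ)| ≤ (|b| + 1) * Q := by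
      rw [h3, abs_mul, Nat.abs_cast]
      have : (r.den : ℝ) ≤ Q := by exact_mod_cast hden
      gcongr
    have h5 : |(r.num : ℝ)| ≤ (B : ℝ) := h4.trans (Int.le_ceil _)
    have h6 : |r.num| ≤ B := by exact_mod_cast h5
    exact abs_le.1 h6
  · intro r _ s _ hrs
    simp only [Prod.mk.injEq] at hrs
    exact Rat.ext hrs.1 hrs.2

lemma sum_log_le (X : ℝ) (hX : 0 < X) (T : Finset ℕ) (hT : ∀ k ∈ T, 0 < k) :
    ∑ k ∈ T, max 0 (log (X / k)) ≤ X := by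
  have hn0 : 0 ≤ X := hX.le
  set n := ⌊X⌋₊ with hn
  have h1 : ∑ k ∈ T, max 0 (log (X / k)) ≤ ∑ k ∈ Finset.Icc 1 n, max 0 (log (X / k)) := by
    rw [← Finset.sum_filter_add_sum_filter_not T (fun k => k ≤ n)]
    have z : ∑ k ∈ T.filter (fun k => ¬ k ≤ n), max 0 (log (X / k)) = 0 := by
      apply Finset.sum_eq_zero
      intro k hk
      rw [Finset.mem_filter] at hk
      have h2 : X < k := by
        have := hk.2
        rw [hn, not_le] at this
        exact (Nat.floor_lt hn0).1 this
      apply max_eq_left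
      apply log_nonpos (by positivity)
      rw [div_le_one (by linarith)]; exact h2.le
    rw [z, add_zero]
    apply Finset.sum_le_sum_of_subset_of_nonneg
    · intro k hk
      rw [Finset.mem_filter] at hk
      rw [Finset.mem_Icc]
      exact ⟨hT k hk.1, hk.2⟩
    · intros; exact le_max_left _ _
  refine h1.trans ?_
  have h2 : ∀ k ∈ Finset.Icc 1 n, max 0 (log (X / k)) = log X - log k := by
    intro k hk
    rw [Finset.mem_Icc] at hk
    have hk0 : (0:ℝ) < k := by exact_mod_cast hk.1
    have hkX : (k:ℝ) ≤ X := (Nat.le_floor_iff hn0).1 hk.2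
    rw [max_eq_right, log_div hX.ne' hk0.ne']
    apply log_nonneg
    rw [le_div_iff₀ hk0]; linarith
  rw [Finset.sum_congr rfl h2, Finset.sum_sub_distrib]
  have h3 : ∑ k ∈ Finset.Icc 1 n, log (k:ℝ) = log (n.factorial) := by
    rw [← Finset.prod_Ico_id_eq_factorial, Nat.cast_prod, log_prod, Finset.Ico_add_one_right_eq_Icc]
    intro k hk
    rw [Finset.mem_Ico] at hk
    have : k ≠ 0 := by omega
    exact_mod_cast this
  rw [h3]
  have hf : (0:ℝ) < n.factorial := by exact_mod_cast n.factorial_pos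
  have h4 := log_le_log (by positivity) (Real.pow_div_factorial_le_exp X hn0 n)
  rw [log_exp, log_div (by positivity) hf.ne', log_pow] at h4
  simpa using h4

lemma rot_dist (b : ℝ) (k : ℤ) : 4 * |k * b - round (k * b)| ≤ ‖Complex.exp ((2 * π * b : ℝ) * Complex.I) ^ k - 1‖ := by
  set y : ℝ := k * b - round (k * b) with hy
  have e : Complex.exp ((2 * π * b : ℝ) * Complex.I) ^ k = Complex.exp (Complex.I * (2 * π * y : ℝ)) := by
    rw [← Complex.exp_int_mul, Complex.exp_eq_exp_iff_exists_int]
    refine ⟨round (k * b), ?_⟩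
    rw [hy]; push_cast; ring
  rw [e, Complex.norm_exp_I_mul_ofReal_sub_one, norm_mul, Real.norm_eq_abs, Real.norm_eq_abs]
  have hy2 : |y| ≤ 1 / 2 := abs_sub_round _
  have h := Real.mul_abs_le_abs_sin (x := 2 * π * y / 2) (by
    rw [show 2 * π * y / 2 = π * y by ring, abs_mul, abs_of_pos pi_pos]
    nlinarith [pi_pos])
  rw [show 2 * π * y / 2 = π * y by ring] at h ⊢
  rw [abs_mul, abs_of_pos pi_pos] at h
  have : 2 / π * (π * |y|) = 2 * |y| := by field_simp
  rw [this] at h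
  rw [abs_of_pos (by norm_num : (0:ℝ) < 2)]
  linarith

/-- integer labels -/
lemma labels {b : ℝ} {r : ℚ} (hr : |b - r| < 1 / (r.den : ℝ) ^ 2) {N : ℕ} (hN : 2 * N ≤ r.den) (j0 : ℕ) (hj0 : j0 < N) :
    ∃ m : ℕ → ℤ, Set.InjOn m (Set.Iio N) ∧ m j0 = 0 ∧
      ∀ j < N, j ≠ j0 → 2 * (m j).natAbs ≤ (r.den : ℝ) * ‖Complex.exp ((2 * π * b : ℝ) * Complex.I) ^ ((j:ℤ) - j0) - 1‖ := by
  set q := r.den with hq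
  have hq0 : (0:ℝ) < q := by exact_mod_cast r.den_pos
  let m : ℕ → ℤ := fun j => ((j:ℤ) - j0) * r.num - q * round ((((j:ℤ) - j0 : ℤ) : ℝ) * b)
  have hinj : Set.InjOn m (Set.Iio N) := by
    intro j hj j' hj' h
    simp only [Set.mem_Iio] at hj hj'
    have h1 : ((j:ℤ) - j') * r.num = q * (round ((((j:ℤ) - j0 : ℤ) : ℝ) * b) - round ((((j':ℤ) - j0 : ℤ) : ℝ) * b)) := by
      have : m j - m j' = 0 := by rw [h]; ring
      simp only [m] at this
      linarith
    have h2 : (q : ℤ) ∣ ((j:ℤ) - j') * r.num := ⟨_, h1⟩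
    have hcop : IsCoprime (q : ℤ) r.num := by
      rw [Int.isCoprime_iff_gcd_eq_one]
      have := r.reduced
      rw [Nat.Coprime, Nat.gcd_comm] at this
      simpa [Int.gcd] using this
    have h3 : (q : ℤ) ∣ ((j:ℤ) - j') := hcop.dvd_of_dvd_mul_right h2
    have h4 := Int.eq_zero_of_abs_lt_dvd h3 (by rw [abs_lt]; constructor <;> omega)
    omega
  have hm0 : m j0 = 0 := by simp [m]
  refine ⟨m, hinj, hm0, fun j hj hne => ?_⟩
  have hmne : m j ≠ 0 := by
    intro h
    exact hne (hinj hj hj0 (h.trans hm0.symm))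
  set k : ℤ := (j:ℤ) - j0 with hk
  have hd := rot_dist b k
  have hkN : |(k:ℝ)| ≤ q / 2 := by
    have : |k| * 2 ≤ q := by
      have : |k| < N := by rw [abs_lt]; constructor <;> omega
      omega
    have : (|(k:ℝ)|) * 2 ≤ q := by exact_mod_cast this
    linarith
  have hnum : (r.num : ℝ) = r * q := by
    have := Rat.mul_den_eq_num r
    exact_mod_cast this.symm
  have hmr : (m j : ℝ) = q * (k * b - round (k * b)) - q * k * (b - r) := by
    have hkr : (k:ℝ) = j - j0 := by rw [hk]; push_cast; ring
    simp only [m]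
    push_cast
    rw [hnum, ← hkr]; ring
  have h5 : |(q:ℝ) * k * (b - r)| ≤ 1 / 2 := by
    rw [abs_mul, abs_mul, abs_of_pos hq0]
    calc (q:ℝ) * |(k:ℝ)| * |b - r| ≤ q * (q / 2) * (1 / q ^ 2) := by gcongr
      _ = 1 / 2 := by field_simp
  have h6 : |(m j : ℝ)| ≤ q * |k * b - round (k * b)| + 1 / 2 := by
    rw [hmr]
    refine (abs_sub _ _).trans ?_
    rw [abs_mul, abs_of_pos hq0]
    linarith
  have h7 : (1:ℝ) ≤ |(m j : ℝ)| := by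
    have : 1 ≤ |m j| := Int.one_le_abs hmne
    exact_mod_cast this
  have h8 : ((m j).natAbs : ℝ) = |(m j : ℝ)| := by
    rw [Nat.cast_natAbs]; push_cast; rfl
  rw [h8]
  nlinarith

lemma weyl_trunc {w : ℂ} (hw : ‖w‖ = 1) (hirr : ∀ k : ℕ, 0 < k → w ^ k ≠ 1) {τ : ℝ} (hτ : 0 < τ) {ε : ℝ} (hε : 0 < ε) :
    ∃ N : ℕ, ∀ n ≥ N, ∀ ω, ‖ω‖ = 1 → ∀ z, ‖z‖ ≤ 1 →
      - (ε * n) ≤ ∑ l ∈ Finset.range n, log (max ‖w ^ l * ω - z‖ τ) := by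
  obtain ⟨T, hT1, hTf, hT⟩ := (isCompact_closedBall (0:ℂ) 1).finite_cover_balls (e := τ * (ε / 2)) (by positivity)
  have hz : ∀ z : ℂ, ∃ N : ℕ, ∀ n ≥ N, ∀ ω, ‖ω‖ = 1 → z ∈ T →
      - (ε / 2 * n) ≤ ∑ l ∈ Finset.range n, log (max ‖w ^ l * ω - z‖ τ) := by
    intro z
    have hc : ContinuousOn (fun ω : ℂ => log (max ‖ω - z‖ τ)) {ζ | ‖ζ‖ = exp 0} := by
      apply ContinuousOn.log (by fun_prop)
      intro ω _
      exact (lt_of_lt_of_le hτ (le_max_right _ _)).ne'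
    obtain ⟨N, hN⟩ := weyl hw hirr 0 hc (ε := ε / 2) (by positivity)
    refine ⟨N, fun n hn ω hω hzT => ?_⟩
    have h1 := (abs_le.1 (hN n hn ω (by simpa using hω))).1
    have h2 : 0 ≤ CA (fun ω : ℂ => log (max ‖ω - z‖ τ)) 0 := by
      have h3 : CA (fun ω : ℂ => log ‖ω - z‖) 0 = 0 := by
        rw [CA_log_sub, exp_zero, max_eq_left, log_one]
        simpa using hT1 hzT
      refine h3.symm.le.trans ?_
      have e : CA (fun ω : ℂ => log (max ‖ω - z‖ τ)) 0 = CA (fun ω => max (log (max ‖ω - z‖ τ)) (log ‖ω - z‖)) 0 := by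
        apply CA_congr_finite (Set.finite_singleton z)
        intro ζ _ hζ
        symm; apply max_eq_left
        exact log_le_log (norm_pos_iff.2 (sub_ne_zero.2 hζ)) (le_max_left _ _)
      rw [e]
      refine CA_mono (CA_log_sub_integrable z 0) ?_ (fun ζ _ => le_max_right _ _)
      have i1 := CA_integrable hc
      have i2 := CA_log_sub_integrable z 0
      unfold CircleIntegrable at i1 i2 ⊢
      rw [intervalIntegrable_iff] at i1 i2 ⊢
      exact i1.sup i2
    have h4 : (0:ℝ) ≤ n := by positivity
    nlinarith
  choose Nz hNz using hz
  obtain ⟨N, hN⟩ : ∃ N, ∀ z ∈ T, Nz z ≤ N := by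
    obtain ⟨N, hN⟩ := (hTf.image Nz).bddAbove
    exact ⟨N, fun z hz => hN ⟨z, hz, rfl⟩⟩
  refine ⟨N, fun n hn ω hω z hz => ?_⟩
  have := hT (by simpa using hz : z ∈ Metric.closedBall (0:ℂ) 1)
  simp only [Set.mem_iUnion, Metric.mem_ball] at this
  obtain ⟨z', hz'T, hzz'⟩ := this
  have h1 := hNz z' n ((hN z' hz'T).trans hn) ω hω hz'T
  have h2 : ∀ l ∈ Finset.range n, log (max ‖w ^ l * ω - z'‖ τ) - ε / 2 ≤ log (max ‖w ^ l * ω - z‖ τ) := by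
    intro l _
    set A := max ‖w ^ l * ω - z'‖ τ with hA
    set B := max ‖w ^ l * ω - z‖ τ with hB
    have hA0 : 0 < A := lt_of_lt_of_le hτ (le_max_right _ _)
    have hB0 : τ ≤ B := le_max_right _ _
    have hB0' : 0 < B := by linarith
    have hAB : A ≤ B + τ * (ε / 2) := by
      apply max_le
      · have : ‖w ^ l * ω - z'‖ ≤ ‖w ^ l * ω - z‖ + ‖z - z'‖ := by
          simpa using norm_sub_le_norm_sub_add_norm_sub (w ^ l * ω) z z'
        rw [dist_eq_norm] at hzz'
        linarith [le_max_left ‖w ^ l * ω - z‖ τ]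
      · nlinarith
    have h3 := Real.log_le_sub_one_of_pos (div_pos hA0 hB0')
    rw [log_div hA0.ne' hB0'.ne'] at h3
    have h4 : A / B ≤ 1 + ε / 2 := by
      rw [div_le_iff₀ hB0']; nlinarith
    linarith
  have h3 := Finset.sum_le_sum h2
  rw [Finset.sum_sub_distrib] at h3
  simp at h3
  linarith

/-- core sum estimate, `‖z‖ ≤ 1` -/
lemma sumlog_core {b : ℝ} {r : ℚ} (hr : |b - r| < 1 / (r.den : ℝ) ^ 2) {N : ℕ} (hN : 2 * N ≤ r.den) {j0 : ℕ} (hj0 : j0 < N)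
    {w : ℂ} (hwb : w = (Complex.exp ((2 * π * b : ℝ) * Complex.I))⁻¹) {ω z : ℂ} (hω : ‖ω‖ = 1) (hz : ‖z‖ ≤ 1)
    (hmin : ∀ j < N, ‖w ^ j0 * ω - z‖ ≤ ‖w ^ j * ω - z‖) {τ : ℝ} (hτ : 0 < τ) (hτ1 : τ ≤ 1)
    {ε : ℝ} (hw : - (ε * N) ≤ ∑ l ∈ Finset.range N, log (max ‖w ^ l * ω - z‖ τ)) :
    (∀ j < N, j ≠ j0 → 0 < ‖w ^ j * ω - z‖) ∧
    - (ε * N) - log 2 - 2 * (τ * r.den) ≤ ∑ j ∈ (Finset.range N).erase j0, log ‖w ^ j * ω - z‖ := by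
  obtain ⟨m, hinj, hm0, hm⟩ := labels hr hN j0 hj0
  set q := r.den with hq
  have hq0 : (0:ℝ) < q := by exact_mod_cast r.den_pos
  have hw1 : ‖w‖ = 1 := by rw [hwb, norm_inv, Complex.norm_exp_ofReal_mul_I, inv_one]
  have hw0 : w ≠ 0 := norm_ne_zero_iff.1 (by rw [hw1]; norm_num)
  have hx : ∀ j < N, j ≠ j0 → ((m j).natAbs : ℝ) ≤ q * ‖w ^ j * ω - z‖ := by
    intro j hj hne
    have h1 := hm j hj hne
    have h2 : ‖Complex.exp ((2 * π * b : ℝ) * Complex.I) ^ ((j:ℤ) - j0) - 1‖ = ‖w ^ j0 * ω - w ^ j * ω‖ := by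
      have e : Complex.exp ((2 * π * b : ℝ) * Complex.I) = w⁻¹ := by rw [hwb, inv_inv]
      rw [e, ← sub_mul, norm_mul, hω, mul_one]
      have e2 : w ^ j0 - w ^ j = w ^ j * ((w⁻¹) ^ ((j:ℤ) - j0) - 1) := by
        rw [inv_zpow', neg_sub, zpow_sub₀ hw0, zpow_natCast, zpow_natCast]
        field_simp
      rw [e2, norm_mul, norm_pow, hw1, one_pow, one_mul]
    have h3 : ‖w ^ j0 * ω - w ^ j * ω‖ ≤ 2 * ‖w ^ j * ω - z‖ := by
      have := norm_sub_le_norm_sub_add_norm_sub (w ^ j0 * ω) z (w ^ j * ω)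
      rw [norm_sub_rev z] at this
      linarith [hmin j hj]
    rw [h2] at h1
    nlinarith
  have hmne : ∀ j < N, j ≠ j0 → m j ≠ 0 := fun j hj hne h => hne (hinj hj hj0 (h.trans hm0.symm))
  have hpos : ∀ j < N, j ≠ j0 → 0 < ‖w ^ j * ω - z‖ := by
    intro j hj hne
    have h1 := hx j hj hne
    have h2 : (1:ℝ) ≤ (m j).natAbs := by
      have := Int.natAbs_pos.2 (hmne j hj hne)
      exact_mod_cast this
    by_contra! h
    nlinarith
  refine ⟨hpos, ?_⟩
  have hX : 0 < τ * q := by positivity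
  -- close part
  have hclose : ∀ j ∈ (Finset.range N).erase j0,
      log (max ‖w ^ j * ω - z‖ τ) - max 0 (log (τ * q / (m j).natAbs)) ≤ log ‖w ^ j * ω - z‖ := by
    intro j hj
    rw [Finset.mem_erase, Finset.mem_range] at hj
    have h1 := hx j hj.2 hj.1
    have h3 := hpos j hj.2 hj.1
    have h2 : (0:ℝ) < (m j).natAbs := by
      have := Int.natAbs_pos.2 (hmne j hj.2 hj.1)
      exact_mod_cast this
    rcases le_total τ ‖w ^ j * ω - z‖ with h | h
    · rw [max_eq_left h]
      linarith [le_max_left 0 (log (τ * q / (m j).natAbs))]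
    · rw [max_eq_right h]
      have h4 : log (τ / ‖w ^ j * ω - z‖) ≤ log (τ * q / (m j).natAbs) := by
        apply log_le_log (by positivity)
        rw [div_le_div_iff₀ h3 h2]
        nlinarith
      rw [log_div hτ.ne' h3.ne'] at h4
      linarith [le_max_right 0 (log (τ * q / (m j).natAbs))]
  have hsum := Finset.sum_le_sum hclose
  rw [Finset.sum_sub_distrib] at hsum
  have hsplit : ∑ j ∈ (Finset.range N).erase j0, max 0 (log (τ * q / (m j).natAbs)) ≤ 2 * (τ * q) := by
    have hhalf : ∀ P : ℤ → Prop, [DecidablePred P] → (∀ a b, P a → P b → a.natAbs = b.natAbs → a = b) →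
        ∑ j ∈ ((Finset.range N).erase j0).filter (fun j => P (m j)), max 0 (log (τ * q / (m j).natAbs)) ≤ τ * q := by
      intro P _ hP
      have e := Finset.sum_image (f := fun k : ℕ => max 0 (log (τ * q / k)))
        (s := ((Finset.range N).erase j0).filter (fun j => P (m j))) (g := fun j => (m j).natAbs) (by
          intro j hj j' hj' h
          simp only [Finset.coe_filter, Finset.mem_erase, Finset.mem_range, Set.mem_ofPred_eq] at hj hj'
          exact hinj hj.1.2 hj'.1.2 (hP _ _ hj.2 hj'.2 h))
      rw [← e]
      apply sum_log_le _ hX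
      intro k hk
      rw [Finset.mem_image] at hk
      obtain ⟨j, hj, rfl⟩ := hk
      simp only [Finset.mem_filter, Finset.mem_erase, Finset.mem_range] at hj
      exact Int.natAbs_pos.2 (hmne j hj.1.2 hj.1.1)
    rw [← Finset.sum_filter_add_sum_filter_not _ (fun j => 0 ≤ m j)]
    have a1 := hhalf (fun a => 0 ≤ a) (by intro a b; omega)
    have a2 := hhalf (fun a => ¬ 0 ≤ a) (by intro a b; omega)
    linarith
  have hj0s : log (max ‖w ^ j0 * ω - z‖ τ) ≤ log 2 := by
    apply log_le_log (lt_of_lt_of_le hτ (le_max_right _ _))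
    apply max_le _ (by linarith)
    refine (norm_sub_le _ _).trans ?_
    rw [norm_mul, norm_pow, hw1, hω]
    norm_num; linarith
  rw [← Finset.add_sum_erase _ _ (Finset.mem_range.2 hj0)] at hw
  linarith

theorem Sys.sumlog (S : Sys) {κ' : ℝ} (hκ : 0 < κ') (N0 : ℕ) : ∃ N ≥ N0, ∀ (t : ℝ) (ζ : ℂ), ‖ζ‖ = exp t → ∀ z : ℂ,
    ∀ j0 < N, (∀ j < N, ‖(S.β⁻¹) ^ j0 * ζ - z‖ ≤ ‖(S.β⁻¹) ^ j * ζ - z‖) →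
    (∀ j < N, j ≠ j0 → 0 < ‖(S.β⁻¹) ^ j * ζ - z‖) ∧
    - (κ' * N) ≤ ∑ j ∈ (Finset.range N).erase j0, log (‖(S.β⁻¹) ^ j * ζ - z‖ / max (exp t) ‖z‖) := by
  have hw1 : ‖S.β⁻¹‖ = 1 := by rw [norm_inv, S.norm_β, inv_one]
  set τ : ℝ := min 1 (κ' / 24) with hτ
  have hτ0 : 0 < τ := by positivity
  obtain ⟨N1, hN1⟩ := weyl_trunc hw1 (fun k hk h => S.β_irr k hk (by
    rw [inv_pow, inv_eq_one] at h; exact h)) hτ0 (ε := κ' / 4) (by positivity)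
  obtain ⟨N2, hN2⟩ := exists_nat_gt (2 * log 2 / κ')
  obtain ⟨r, hr1, hr2⟩ := dirichlet_large S.hb (2 * (N0 + N1 + N2 + 1))
  set N := r.den / 2 with hN
  have hNge : N0 + N1 + N2 + 1 ≤ N := by omega
  refine ⟨N, by omega, ?_⟩
  have key : ∀ ω, ‖ω‖ = 1 → ∀ z, ‖z‖ ≤ 1 → ∀ j0 < N, (∀ j < N, ‖(S.β⁻¹) ^ j0 * ω - z‖ ≤ ‖(S.β⁻¹) ^ j * ω - z‖) →
    (∀ j < N, j ≠ j0 → 0 < ‖(S.β⁻¹) ^ j * ω - z‖) ∧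
    - (κ' * N) ≤ ∑ j ∈ (Finset.range N).erase j0, log ‖(S.β⁻¹) ^ j * ω - z‖ := by
    intro ω hω z hz j0 hj0 hmin
    have h := sumlog_core hr2 (N := N) (by omega) hj0 rfl hω hz hmin hτ0 (min_le_left _ _)
      (hN1 N (by omega) ω hω z hz)
    refine ⟨h.1, le_trans ?_ h.2⟩
    have hden : (r.den : ℝ) ≤ 3 * N := by
      have : r.den ≤ 3 * N := by omega
      exact_mod_cast this
    have h1 : τ ≤ κ' / 24 := min_le_right _ _
    have hN2' : (N2:ℝ) ≤ N := by
      have : N2 ≤ N := by omega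
      exact_mod_cast this
    rw [div_lt_iff₀ hκ] at hN2
    have h3 : τ * r.den ≤ κ' / 24 * (3 * N) := by gcongr
    have h4 : (N2:ℝ) * κ' ≤ N * κ' := by gcongr
    have h5 : (0:ℝ) ≤ N := by positivity
    nlinarith
  intro t ζ hζ z j0 hj0 hmin
  have ht := exp_pos t
  have htc : ((exp t : ℝ) : ℂ) ≠ 0 := by exact_mod_cast ht.ne'
  set ω := ζ / (exp t : ℝ) with hωd
  have hω : ‖ω‖ = 1 := by rw [hωd, norm_div, hζ, Complex.norm_real, Real.norm_eq_abs, abs_exp, div_self ht.ne']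
  set z1 := z / (exp t : ℝ) with hz1
  have e1 : ∀ j, ‖(S.β⁻¹) ^ j * ζ - z‖ = exp t * ‖(S.β⁻¹) ^ j * ω - z1‖ := by
    intro j
    have : (S.β⁻¹) ^ j * ζ - z = ((exp t : ℝ) : ℂ) * ((S.β⁻¹) ^ j * ω - z1) := by
      rw [hωd, hz1]; field_simp
    rw [this, norm_mul, Complex.norm_real, Real.norm_eq_abs, abs_exp]
  have e2 : max (exp t) ‖z‖ = exp t * max 1 ‖z1‖ := by
    have : ‖z‖ = exp t * ‖z1‖ := by
      rw [hz1, norm_div, Complex.norm_real, Real.norm_eq_abs, abs_exp]; field_simp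
    rw [this, mul_max_of_nonneg _ _ ht.le, mul_one]
  have e3 : ∃ z2 : ℂ, ‖z2‖ ≤ 1 ∧ ∀ j, ‖(S.β⁻¹) ^ j * ω - z1‖ = max 1 ‖z1‖ * ‖(S.β⁻¹) ^ j * ω - z2‖ := by
    rcases le_total ‖z1‖ 1 with h | h
    · exact ⟨z1, h, fun j => by rw [max_eq_left h, one_mul]⟩
    · have hz0 : z1 ≠ 0 := norm_pos_iff.1 (by linarith)
      refine ⟨(starRingEnd ℂ z1)⁻¹, ?_, fun j => ?_⟩
      · rw [norm_inv, Complex.norm_conj]; exact inv_le_one_of_one_le₀ h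
      · set u := (S.β⁻¹) ^ j * ω with hu
        have hun : ‖u‖ = 1 := by rw [hu, norm_mul, norm_pow, hw1, hω]; norm_num
        rw [max_eq_right h]
        have hcz : starRingEnd ℂ z1 ≠ 0 := (map_ne_zero _).2 hz0
        have huu : u * starRingEnd ℂ u = 1 := by
          rw [Complex.mul_conj, Complex.normSq_eq_norm_sq, hun]; norm_num
        calc ‖u - z1‖ = ‖starRingEnd ℂ (u - z1)‖ := (Complex.norm_conj _).symm
          _ = ‖u‖ * ‖starRingEnd ℂ (u - z1)‖ := by rw [hun, one_mul]
          _ = ‖u * starRingEnd ℂ (u - z1)‖ := (norm_mul _ _).symm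
          _ = ‖- (starRingEnd ℂ z1 * (u - (starRingEnd ℂ z1)⁻¹))‖ := by
            congr 1
            rw [map_sub, mul_sub, mul_sub, huu, mul_inv_cancel₀ hcz]; ring
          _ = _ := by rw [norm_neg, norm_mul, Complex.norm_conj]
  obtain ⟨z2, hz2, e3⟩ := e3
  have hm0 : 0 < max 1 ‖z1‖ := lt_of_lt_of_le one_pos (le_max_left _ _)
  have e4 : ∀ j, ‖(S.β⁻¹) ^ j * ζ - z‖ = exp t * max 1 ‖z1‖ * ‖(S.β⁻¹) ^ j * ω - z2‖ := fun j => by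
    rw [e1, e3, mul_assoc]
  have hc : 0 < exp t * max 1 ‖z1‖ := by positivity
  obtain ⟨k1, k2⟩ := key ω hω z2 hz2 j0 hj0 (fun j hj => by
    have := hmin j hj
    rw [e4, e4] at this
    exact le_of_mul_le_mul_left this hc)
  refine ⟨fun j hj hne => ?_, ?_⟩
  · rw [e4]; exact mul_pos hc (k1 j hj hne)
  · refine k2.trans (le_of_eq ?_)
    refine Finset.sum_congr rfl fun j _ => ?_
    rw [e4, e2, mul_div_cancel_left₀ _ hc.ne']

end Lyap

namespace Lyap
open Real Filter Topology MeasureTheory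

/-- annulus index set -/
noncomputable def ann {m : ℕ} (z : Fin m → ℂ) (t δ : ℝ) : Finset (Fin m) :=
  Finset.univ.filter fun i => exp (t - δ) < ‖z i‖ ∧ ‖z i‖ < exp (t + δ)

lemma K_core {N m : ℕ} {t δ κ' U : ℝ} {ζ : ℕ → ℂ} (hζ : ∀ j, ‖ζ j‖ = exp t) {c : ℂ} (hc : c ≠ 0) {z : Fin m → ℂ}
    (hm : m ≤ 2 * N) (hN : 0 < N) (hδ : 0 < δ) (hκ : 0 < κ')
    (hsum : ∀ z : ℂ, ∀ j0 < N, (∀ j < N, ‖ζ j0 - z‖ ≤ ‖ζ j - z‖) →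
      (∀ j < N, j ≠ j0 → 0 < ‖ζ j - z‖) ∧
      - (κ' * N) ≤ ∑ j ∈ (Finset.range N).erase j0, log (‖ζ j - z‖ / max (exp t) ‖z‖))
    (hub : ∀ ξ, ‖ξ‖ ≤ exp (t + 2 * δ) → ‖c * ∏ i, (ξ - z i)‖ ≤ exp U)
    {B : ℕ → ℝ} (hB : ∀ j < N, ‖c * ∏ i, (ζ j - z i)‖ ≤ exp (U - B j)) :
    ∃ J ⊆ Finset.range N, (N : ℝ) - (ann z t δ).card ≤ J.card ∧
      N * jen c z t + ∑ j ∈ J, B j ≤ N * U + 2 * N * (κ' * N + 2 * log (4 / (2 * (1 - exp (-δ))))) := by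
  classical
  set ρ := 2 * (1 - exp (-δ)) with hρ
  set r := exp t with hr
  have hr0 : 0 < r := exp_pos t
  have hx0 := exp_pos (-δ)
  have hx1 : exp (-δ) < 1 := by rw [exp_lt_one_iff]; linarith
  have hρ0 : 0 < ρ := by rw [hρ]; linarith
  have hρ2 : ρ < 2 := by rw [hρ]; linarith
  set C := log (4 / ρ) with hC
  have hC0 : 0 ≤ C := log_nonneg (by rw [le_div_iff₀ hρ0]; linarith)
  -- nearest index
  have hnear : ∀ i : Fin m, ∃ j0 ∈ Finset.range N, ∀ j ∈ Finset.range N, ‖ζ j0 - z i‖ ≤ ‖ζ j - z i‖ := fun i =>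
    Finset.exists_min_image _ _ ⟨0, Finset.mem_range.2 hN⟩
  choose jj hjj hjmin using hnear
  simp only [Finset.mem_range] at hjj hjmin
  set near : Fin m → Prop := fun i => ‖ζ (jj i) - z i‖ < ρ * r / 2 with hneard
  let I : ℕ → Finset (Fin m) := fun j => Finset.univ.filter fun i => near i ∧ jj i = j
  let v : Fin m → ℕ → ℝ := fun i j => log (‖ζ j - z i‖ / max r ‖z i‖)
  have hmax : ∀ i, 0 < max r ‖z i‖ := fun i => lt_of_lt_of_le hr0 (le_max_left _ _)
  have hpos : ∀ j < N, ∀ i, i ∉ I j → 0 < ‖ζ j - z i‖ := by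
    intro j hj i hi
    by_cases h : j = jj i
    · have : ¬ near i := fun hn => hi (by simp [I, hn, h])
      rw [hneard] at this
      simp only [not_lt] at this
      rw [h]
      have : 0 < ρ * r / 2 := by positivity
      linarith
    · exact (hsum (z i) (jj i) (hjj i) (fun j hj => hjmin i j hj)).1 j hj h
  -- sums over j
  have hTi : ∀ i, - (κ' * N + C) ≤ ∑ j ∈ (Finset.range N).filter (fun j => i ∉ I j), v i j := by
    intro i
    have h1 := (hsum (z i) (jj i) (hjj i) (fun j hj => hjmin i j hj)).2
    by_cases hn : near i
    · have e : (Finset.range N).filter (fun j => i ∉ I j) = (Finset.range N).erase (jj i) := by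
        ext j
        simp only [I, Finset.mem_filter, Finset.mem_range, Finset.mem_univ, true_and, Finset.mem_erase, hn]
        tauto
      rw [e]
      have : - (κ' * N + C) ≤ - (κ' * N) := by linarith
      exact this.trans h1
    · have e : (Finset.range N).filter (fun j => i ∉ I j) = Finset.range N := by
        ext j
        simp [I, hn]
      rw [e, ← Finset.add_sum_erase _ _ (Finset.mem_range.2 (hjj i))]
      have h2 : - C ≤ v i (jj i) := by
        simp only [v, hC]
        rw [← log_inv, inv_div]
        apply log_le_log (by positivity)
        rw [div_le_div_iff₀ (by norm_num) (hmax i)]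
        simp only [hneard, not_lt] at hn
        have h3 : ‖z i‖ - r ≤ ‖ζ (jj i) - z i‖ := by
          rw [← hζ (jj i), norm_sub_rev]; exact norm_sub_norm_le _ _
        rcases le_total ‖z i‖ (2 * r) with h | h
        · have : max r ‖z i‖ ≤ 2 * r := max_le (by linarith) h
          nlinarith
        · have : max r ‖z i‖ = ‖z i‖ := max_eq_right (by linarith)
          rw [this]
          nlinarith
      have h1' : - (κ' * N) ≤ ∑ j ∈ (Finset.range N).erase (jj i), v i j := h1
      linarith
  have hT : - (2 * N * (κ' * N + C)) ≤ ∑ j ∈ Finset.range N, ∑ i ∈ Finset.univ.filter (fun i => i ∉ I j), v i j := by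
    have e : ∑ j ∈ Finset.range N, ∑ i ∈ Finset.univ.filter (fun i => i ∉ I j), v i j
        = ∑ i, ∑ j ∈ (Finset.range N).filter (fun j => i ∉ I j), v i j := by
      simp only [Finset.sum_filter]
      rw [Finset.sum_comm]
    rw [e]
    have h1 := Finset.sum_le_sum (s := Finset.univ) (fun i (_ : i ∈ Finset.univ) => hTi i)
    simp only [Finset.sum_const, Finset.card_univ, Fintype.card_fin, nsmul_eq_mul] at h1
    refine le_trans ?_ h1
    have hm' : (m:ℝ) ≤ 2 * N := by exact_mod_cast hm
    have : 0 ≤ κ' * N + C := by positivity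
    nlinarith
  -- per j
  have hρr : ∀ j i, i ∈ I j → ‖ζ j - z i‖ < ρ * r / 2 := by
    intro j i hi
    simp only [I, Finset.mem_filter, Finset.mem_univ, true_and] at hi
    rw [← hi.2]; exact hi.1
  have hper : ∀ j ∈ Finset.range N, jen c z t + ∑ i ∈ Finset.univ.filter (fun i => i ∉ I j), v i j ≤
      U + (I j).card * C - (if I j = ∅ then B j else 0) := by
    intro j hj
    rw [Finset.mem_range] at hj
    set g : ℂ → ℂ := fun ξ => c * ∏ i ∈ Finset.univ.filter (fun i => i ∉ I j), (ξ - z i) with hg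
    have hsplit : ∀ ξ, c * ∏ i, (ξ - z i) = g ξ * ∏ i ∈ I j, (ξ - z i) := by
      intro ξ
      have : (∏ i ∈ I j, (ξ - z i)) = ∏ i ∈ Finset.univ.filter (fun i => i ∈ I j), (ξ - z i) := by
        congr 1; ext i; simp
      rw [hg, this, ← Finset.prod_filter_mul_prod_filter_not Finset.univ (fun i => i ∈ I j)]; ring
    have hgpos : 0 < ‖g (ζ j)‖ := by
      rw [hg]
      simp only [norm_mul, norm_prod]
      apply mul_pos (norm_pos_iff.2 hc)
      apply Finset.prod_pos
      intro i hi
      simp only [Finset.mem_filter, Finset.mem_univ, true_and] at hi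
      exact hpos j hj i hi
    have hlogg : log ‖g (ζ j)‖ = log ‖c‖ + ∑ i ∈ Finset.univ.filter (fun i => i ∉ I j), log ‖ζ j - z i‖ := by
      rw [hg]
      simp only [norm_mul, norm_prod]
      have hne : ∀ i ∈ Finset.univ.filter (fun i => i ∉ I j), ‖ζ j - z i‖ ≠ 0 := by
        intro i hi
        simp only [Finset.mem_filter, Finset.mem_univ, true_and] at hi
        exact (hpos j hj i hi).ne'
      rw [log_mul (norm_ne_zero_iff.2 hc) (Finset.prod_ne_zero_iff.2 hne), log_prod hne]
    have hjen : jen c z t + ∑ i ∈ Finset.univ.filter (fun i => i ∉ I j), v i j = log ‖g (ζ j)‖ + ∑ i ∈ I j, log (max r ‖z i‖) := by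
      rw [hlogg]
      unfold jen
      rw [← Finset.sum_filter_add_sum_filter_not Finset.univ (fun i => i ∈ I j)]
      have e1 : Finset.univ.filter (fun i => i ∈ I j) = I j := by ext i; simp
      rw [e1]
      have e2 : ∑ i ∈ Finset.univ.filter (fun i => i ∉ I j), v i j = ∑ i ∈ Finset.univ.filter (fun i => i ∉ I j), log ‖ζ j - z i‖
          - ∑ i ∈ Finset.univ.filter (fun i => i ∉ I j), log (max r ‖z i‖) := by
        rw [← Finset.sum_sub_distrib]
        refine Finset.sum_congr rfl fun i hi => ?_
        simp only [Finset.mem_filter, Finset.mem_univ, true_and] at hi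
        exact log_div (hpos j hj i hi).ne' (hmax i).ne'
      rw [e2]; ring
    rw [hjen]
    split_ifs with hI
    · have h1 := hB j hj
      rw [hsplit, hI, Finset.prod_empty, mul_one] at h1
      have h2 := log_le_log hgpos h1
      rw [log_exp] at h2
      rw [hI]; simp; linarith
    · -- max modulus
      have h1 : ‖g (ζ j)‖ ≤ exp U / (ρ * r / 2) ^ (I j).card := by
        refine Sys.disc_bound (f := g) (z0 := ζ j) (r := ρ * r) (by rw [hg]; fun_prop) (by positivity) (fun ξ hξ => ?_) (by simp; positivity)
        rw [le_div_iff₀ (by positivity)]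
        have h2 : ‖ξ‖ ≤ exp (t + 2 * δ) := by
          have : ‖ξ‖ ≤ ‖ξ - ζ j‖ + ‖ζ j‖ := by simpa using norm_add_le (ξ - ζ j) (ζ j)
          rw [hξ, hζ j] at this
          refine this.trans ?_
          rw [exp_add, ← hr]
          have h3 : ρ + 1 ≤ exp (2 * δ) := by
            have e : exp (2 * δ) = 1 / exp (-δ) ^ 2 := by
              rw [← exp_nat_mul, one_div, ← exp_neg]; congr 1; push_cast; ring
            rw [e, le_div_iff₀ (by positivity), hρ]
            nlinarith [sq_nonneg (exp (-δ) - 1)]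
          nlinarith
        have h3 := hub ξ h2
        rw [hsplit, norm_mul] at h3
        refine le_trans ?_ h3
        gcongr
        rw [norm_prod, ← Finset.prod_const]
        apply Finset.prod_le_prod
        · intros; positivity
        · intro i hi
          have h4 := hρr j i hi
          have : ‖ξ - ζ j‖ ≤ ‖ξ - z i‖ + ‖ζ j - z i‖ := by
            have := norm_sub_le (ξ - z i) (ζ j - z i)
            simpa using this
          rw [hξ] at this
          linarith
      have h2 := log_le_log hgpos h1
      rw [log_div (exp_pos _).ne' (by positivity), log_exp, log_pow] at h2
      have h3 : ∑ i ∈ I j, log (max r ‖z i‖) ≤ (I j).card * log (2 * r) := by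
        rw [← nsmul_eq_mul, ← Finset.sum_const]
        apply Finset.sum_le_sum
        intro i hi
        apply log_le_log (hmax i)
        apply max_le (by linarith)
        have h4 := hρr j i hi
        have : ‖z i‖ ≤ ‖ζ j‖ + ‖ζ j - z i‖ := by
          have := norm_sub_le (ζ j) (ζ j - z i)
          simpa using this
        rw [hζ j] at this
        nlinarith
      have h4 : log (2 * r) - log (ρ * r / 2) = C := by
        rw [hC, ← log_div (by positivity) (by positivity)]
        congr 1; field_simp; norm_num
      have h5 : ((I j).card : ℝ) * log (2 * r) - (I j).card * log (ρ * r / 2) = (I j).card * C := by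
        rw [← h4]; ring
      linarith
  -- card
  have hcard : ∑ j ∈ Finset.range N, (I j).card = (Finset.univ.filter near).card := by
    rw [Finset.card_eq_sum_card_fiberwise (f := jj) (t := Finset.range N)]
    · refine Finset.sum_congr rfl fun j _ => ?_
      congr 1; ext i; simp [I]
    · intro i _
      simpa using hjj i
  have hnearm : (Finset.univ.filter near).card ≤ m := by
    simpa using Finset.card_le_univ (Finset.univ.filter near)
  have hnearann : (Finset.univ.filter near).card ≤ (ann z t δ).card := by
    apply Finset.card_le_card
    intro i hi
    simp only [Finset.mem_filter, Finset.mem_univ, true_and, hneard] at hi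
    simp only [ann, Finset.mem_filter, Finset.mem_univ, true_and]
    have h1 : ‖ζ (jj i)‖ - ‖z i‖ ≤ ‖ζ (jj i) - z i‖ := norm_sub_norm_le _ _
    have h2 : ‖z i‖ - ‖ζ (jj i)‖ ≤ ‖ζ (jj i) - z i‖ := by rw [norm_sub_rev]; exact norm_sub_norm_le _ _
    rw [hζ] at h1 h2
    rw [sub_eq_add_neg, exp_add, exp_add, ← hr]
    have h3 : 2 ≤ exp δ + exp (-δ) := by
      have := Real.one_le_cosh δ
      rw [Real.cosh_eq] at this; linarith
    constructor
    · rw [hρ] at hi; nlinarith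
    · rw [hρ] at hi; nlinarith
  refine ⟨(Finset.range N).filter (fun j => I j = ∅), Finset.filter_subset _ _, ?_, ?_⟩
  · have h1 := Finset.card_filter_add_card_filter_not (s := Finset.range N) (fun j => I j = ∅)
    rw [Finset.card_range] at h1
    have h2 : ((Finset.range N).filter (fun j => ¬ I j = ∅)).card ≤ ∑ j ∈ Finset.range N, (I j).card := by
      rw [Finset.card_eq_sum_ones, Finset.sum_filter]
      apply Finset.sum_le_sum
      intro j _
      split_ifs with h
      · exact Nat.zero_le _
      · exact Finset.card_pos.2 (Finset.nonempty_iff_ne_empty.2 h)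
    have h3 : N ≤ ((Finset.range N).filter (fun j => I j = ∅)).card + (ann z t δ).card := by omega
    have h4 : (N:ℝ) ≤ ((Finset.range N).filter (fun j => I j = ∅)).card + (ann z t δ).card := by exact_mod_cast h3
    linarith
  · have h1 := Finset.sum_le_sum hper
    rw [Finset.sum_add_distrib, Finset.sum_sub_distrib, Finset.sum_add_distrib, ← Finset.sum_mul, ← Finset.sum_filter] at h1
    simp only [Finset.sum_const, Finset.card_range, nsmul_eq_mul] at h1
    have h2 : ∑ j ∈ Finset.range N, ((I j).card : ℝ) ≤ 2 * N := by
      have : ∑ j ∈ Finset.range N, (I j).card ≤ 2 * N := by omega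
      exact_mod_cast this
    have h3 := mul_le_mul_of_nonneg_right h2 hC0
    linarith

end Lyap

namespace Lyap
open Real Filter Topology MeasureTheory

abbrev V2 := Fin 2 → ℂ

lemma V2_norm_le {v : V2} {C : ℝ} (h0 : ‖v 0‖ ≤ C) (h1 : ‖v 1‖ ≤ C) : ‖v‖ ≤ C := by
  have hC : 0 ≤ C := (norm_nonneg _).trans h0
  rw [pi_norm_le_iff_of_nonneg hC]
  intro i; fin_cases i
  · exact h0
  · exact h1

lemma nrm_mulVec (A : Matrix (Fin 2) (Fin 2) ℂ) (v : V2) : ‖A.mulVec v‖ ≤ nrm A * ‖v‖ := by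
  have h0 := norm_le_pi_norm v 0
  have h1 := norm_le_pi_norm v 1
  have hv := norm_nonneg v
  have key : ∀ i, ‖A.mulVec v i‖ ≤ ‖A i 0‖ * ‖v‖ + ‖A i 1‖ * ‖v‖ := by
    intro i
    simp only [Matrix.mulVec, dotProduct, Fin.sum_univ_two]
    refine (norm_add_le _ _).trans ?_
    rw [norm_mul, norm_mul]
    gcongr
  unfold nrm
  apply V2_norm_le
  · refine (key 0).trans ?_
    have := mul_nonneg (norm_nonneg (A 1 0)) hv
    have := mul_nonneg (norm_nonneg (A 1 1)) hv
    linarith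
  · refine (key 1).trans ?_
    have := mul_nonneg (norm_nonneg (A 0 0)) hv
    have := mul_nonneg (norm_nonneg (A 0 1)) hv
    linarith

lemma nrm_prod_vec (P B : Matrix (Fin 2) (Fin 2) ℂ) (w : V2) :
    nrm (P * B) * ‖w‖ ≤ 2 * nrm B * ‖P.mulVec w‖ + 2 * nrm P * ‖B.adjugate.mulVec w‖ := by
  set X := ‖P.mulVec w‖ with hX
  set Y := ‖B.adjugate.mulVec w‖ with hY
  have e0 : P.mulVec w 0 = P 0 0 * w 0 + P 0 1 * w 1 := by
    simp [Matrix.mulVec, dotProduct, Fin.sum_univ_two]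
  have e1 : P.mulVec w 1 = P 1 0 * w 0 + P 1 1 * w 1 := by
    simp [Matrix.mulVec, dotProduct, Fin.sum_univ_two]
  have e2 : B.adjugate.mulVec w 0 = B 1 1 * w 0 - B 0 1 * w 1 := by
    simp [Matrix.adjugate_fin_two, Matrix.mulVec, dotProduct, Fin.sum_univ_two]; ring
  have e3 : B.adjugate.mulVec w 1 = - (B 1 0 * w 0 - B 0 0 * w 1) := by
    simp [Matrix.adjugate_fin_two, Matrix.mulVec, dotProduct, Fin.sum_univ_two]; ring
  have p0 : ‖P 0 0 * w 0 + P 0 1 * w 1‖ ≤ X := by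
    rw [← e0]; exact norm_le_pi_norm _ 0
  have p1 : ‖P 1 0 * w 0 + P 1 1 * w 1‖ ≤ X := by
    rw [← e1]; exact norm_le_pi_norm _ 1
  have q0 : ‖B 1 1 * w 0 - B 0 1 * w 1‖ ≤ Y := by
    rw [← e2]; exact norm_le_pi_norm _ 0
  have q1 : ‖B 1 0 * w 0 - B 0 0 * w 1‖ ≤ Y := by
    rw [← norm_neg, ← e3]; exact norm_le_pi_norm _ 1
  have hX0 : 0 ≤ X := norm_nonneg _
  have hY0 : 0 ≤ Y := norm_nonneg _
  have main : ∀ (s x y a e : ℂ), s = a * x + e * y → ∀ A Z D, ‖x‖ ≤ A → ‖e‖ ≤ Z → ‖y‖ ≤ D → 0 ≤ Z →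
      ‖s‖ ≤ ‖a‖ * A + Z * D := by
    intro s x y a e hs A Z D h1 h2 h3 h4
    rw [hs]
    refine (norm_add_le _ _).trans ?_
    rw [norm_mul, norm_mul]
    gcongr
  obtain ⟨k, hk⟩ : ∃ k : Fin 2, ‖w‖ = ‖w k‖ := by
    obtain ⟨k, hk⟩ := Finite.exists_max (fun k => ‖w k‖)
    refine ⟨k, le_antisymm ?_ (norm_le_pi_norm _ _)⟩
    rw [pi_norm_le_iff_of_nonneg (norm_nonneg _)]; exact hk
  rw [hk]
  have n1 := norm_nonneg (P 0 0)
  have n2 := norm_nonneg (P 0 1)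
  have n3 := norm_nonneg (P 1 0)
  have n4 := norm_nonneg (P 1 1)
  have b1 := norm_nonneg (B 0 0)
  have b2 := norm_nonneg (B 0 1)
  have b3 := norm_nonneg (B 1 0)
  have b4 := norm_nonneg (B 1 1)
  have hfin : nrm (P * B) * ‖w k‖ = ‖(P * B) 0 0 * w k‖ + ‖(P * B) 0 1 * w k‖ + ‖(P * B) 1 0 * w k‖ + ‖(P * B) 1 1 * w k‖ := by
    unfold nrm; simp only [norm_mul]; ring
  rw [hfin]
  simp only [Matrix.mul_apply, Fin.sum_univ_two]
  have z1 := mul_nonneg b1 hX0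
  have z2 := mul_nonneg b2 hX0
  have z3 := mul_nonneg b3 hX0
  have z4 := mul_nonneg b4 hX0
  have y1 := mul_nonneg n1 hY0
  have y2 := mul_nonneg n2 hY0
  have y3 := mul_nonneg n3 hY0
  have y4 := mul_nonneg n4 hY0
  unfold nrm
  fin_cases k
  · have s00 := main ((P 0 0 * B 0 0 + P 0 1 * B 1 0) * w 0) _ (P 0 1) (B 0 0) _ (by ring) X Y _ p0 q1 le_rfl hY0
    have s01 := main ((P 0 0 * B 0 1 + P 0 1 * B 1 1) * w 0) _ (P 0 1) (B 0 1) _ (by ring) X Y _ p0 q0 le_rfl hY0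
    have s10 := main ((P 1 0 * B 0 0 + P 1 1 * B 1 0) * w 0) _ (P 1 1) (B 0 0) _ (by ring) X Y _ p1 q1 le_rfl hY0
    have s11 := main ((P 1 0 * B 0 1 + P 1 1 * B 1 1) * w 0) _ (P 1 1) (B 0 1) _ (by ring) X Y _ p1 q0 le_rfl hY0
    simp only [Fin.zero_eta, Fin.isValue]
    linarith
  · have q0' : ‖B 0 1 * w 1 - B 1 1 * w 0‖ ≤ Y := by rw [norm_sub_rev]; exact q0
    have q1' : ‖B 0 0 * w 1 - B 1 0 * w 0‖ ≤ Y := by rw [norm_sub_rev]; exact q1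
    have s00 := main ((P 0 0 * B 0 0 + P 0 1 * B 1 0) * w 1) _ (P 0 0) (B 1 0) _ (by ring) X Y _ p0 q1' le_rfl hY0
    have s01 := main ((P 0 0 * B 0 1 + P 0 1 * B 1 1) * w 1) _ (P 0 0) (B 1 1) _ (by ring) X Y _ p0 q0' le_rfl hY0
    have s10 := main ((P 1 0 * B 0 0 + P 1 1 * B 1 0) * w 1) _ (P 1 0) (B 1 0) _ (by ring) X Y _ p1 q1' le_rfl hY0
    have s11 := main ((P 1 0 * B 0 1 + P 1 1 * B 1 1) * w 1) _ (P 1 0) (B 1 1) _ (by ring) X Y _ p1 q0' le_rfl hY0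
    simp only [Fin.mk_one, Fin.isValue]
    linarith

namespace Sys

/-- existence of a slowly growing orbit -/
def Bad (S : Sys) (E : ℂ) (t γ : ℝ) : Prop := ∃ ζ : ℂ, ‖ζ‖ = exp t ∧ ∃ W : ℤ → V2, W 0 ≠ 0 ∧
  (∀ k : ℤ, S.d (S.β ^ k * ζ) • W (k + 1) = (S.M E (S.β ^ k * ζ)).mulVec (W k)) ∧
  ∀ k : ℤ, ‖W k‖ ≤ exp (γ * |(k:ℝ)|) * ‖W 0‖

variable {S : Sys}

lemma orbit_iter {E ζ : ℂ} {W : ℤ → V2}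
    (hW : ∀ k : ℤ, S.d (S.β ^ k * ζ) • W (k + 1) = (S.M E (S.β ^ k * ζ)).mulVec (W k)) (k : ℤ) (n : ℕ) :
    S.Dn n (S.β ^ k * ζ) • W (k + n) = (S.Mn E n (S.β ^ k * ζ)).mulVec (W k) := by
  induction n with
  | zero => simp [Dn, Mn_zero]
  | succ n ih =>
    have e : S.β ^ n * (S.β ^ k * ζ) = S.β ^ (k + n) * ζ := by
      rw [zpow_add₀ S.β_ne, zpow_natCast]; ring
    rw [Mn_succ, ← Matrix.mulVec_mulVec, ← ih, Matrix.mulVec_smul, e, ← hW (k + n)]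
    unfold Dn
    rw [Finset.prod_range_succ, e, mul_smul]
    push_cast
    rw [add_assoc]

lemma norm_rotz {t : ℝ} {ζ : ℂ} (h : ‖ζ‖ = exp t) (k : ℤ) : ‖S.β ^ k * ζ‖ = exp t := by
  rw [norm_mul, S.norm_βzpow, one_mul, h]

lemma Bad_est {E : ℂ} {t γ : ℝ} (ht : S.ok t) (hbad : S.Bad E t γ) :
    ∃ ζ : ℂ, ‖ζ‖ = exp t ∧ ∀ κ' > 0, ∃ C > 0, ∀ N j : ℕ, j ≤ N →
      nrm (S.Mn E N ((S.β⁻¹) ^ j * ζ)) ≤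
        C * (exp (j * (S.F E t + κ') + ((N:ℝ) - j) * (S.κ + t + γ + κ')) + exp (((N:ℝ) - j) * (S.F E t + κ') + j * (S.κ + t + γ + κ'))) := by
  obtain ⟨ζ, hζ, W, hW0, hW, hWb⟩ := hbad
  refine ⟨ζ, hζ, fun κ' hκ => ?_⟩
  obtain ⟨C1, hC1, h1⟩ := upper_circle ht E hκ
  obtain ⟨C2, hC2, h2⟩ := upper_D ht hκ
  refine ⟨2 * C1 * C2, by positivity, fun N j hj => ?_⟩
  set ζj := (S.β⁻¹) ^ j * ζ with hζj
  have hζj' : ζj = S.β ^ (-(j:ℤ)) * ζ := by rw [hζj, zpow_neg, zpow_natCast, inv_pow]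
  have hζjn : ‖ζj‖ = exp t := by rw [hζj']; exact norm_rotz hζ _
  have hback : S.β ^ j * ζj = ζ := by
    rw [hζj, ← mul_assoc, ← mul_pow, mul_inv_cancel₀ S.β_ne, one_pow, one_mul]
  have hM : S.Mn E N ζj = S.Mn E (N - j) ζ * S.Mn E j ζj := by
    conv_lhs => rw [show N = (N - j) + j by omega, Mn_add, hback]
  set P := S.Mn E (N - j) ζ with hP
  set B := S.Mn E j ζj with hB
  have hPW : S.Dn (N - j) ζ • W ((N - j : ℕ) : ℤ) = P.mulVec (W 0) := by
    have := orbit_iter hW 0 (N - j)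
    simpa using this
  have hBW : S.Dn j ζj • W 0 = B.mulVec (W (-(j:ℤ))) := by
    have := orbit_iter hW (-(j:ℤ)) j
    rw [← hζj'] at this
    simpa using this
  have hadj : B.adjugate.mulVec (W 0) = S.Dn j ζj • W (-(j:ℤ)) := by
    have hD : S.Dn j ζj ≠ 0 := Dn_ne ht hζjn j
    have e1 : S.Dn j ζj • B.adjugate.mulVec (W 0) = S.Dn j ζj • (S.Dn j ζj • W (-(j:ℤ))) := by
      rw [← Matrix.mulVec_smul, hBW, Matrix.mulVec_mulVec, Matrix.adjugate_mul, hB, det_Mn,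
        Matrix.smul_mulVec, Matrix.one_mulVec, smul_smul, sq]
    exact smul_right_injective _ hD e1
  have hw0 : 0 < ‖W 0‖ := norm_pos_iff.2 hW0
  have key := nrm_prod_vec P B (W 0)
  rw [← hM, ← hPW, hadj, norm_smul, norm_smul] at key
  have g1 := hWb ((N - j : ℕ) : ℤ)
  have g2 := hWb (-(j:ℤ))
  have cast1 : ((N - j : ℕ) : ℝ) = (N:ℝ) - j := by push_cast [hj]; ring
  rw [Int.cast_natCast, Nat.abs_cast, cast1] at g1
  rw [Int.cast_neg, Int.cast_natCast, abs_neg, Nat.abs_cast] at g2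
  have f1 := h1 j ζj hζjn
  have f2 := h1 (N - j) ζ hζ
  have f3 := h2 j ζj hζjn
  have f4 := h2 (N - j) ζ hζ
  rw [cast1] at f2 f4
  rw [← hB] at f1
  rw [← hP] at f2
  have k1 : 2 * nrm B * (‖S.Dn (N - j) ζ‖ * ‖W ((N - j : ℕ) : ℤ)‖) ≤
      2 * (C1 * exp (j * (S.F E t + κ'))) * ((C2 * exp (((N:ℝ) - j) * (S.κ + t + κ'))) * (exp (γ * ((N:ℝ) - j)) * ‖W 0‖)) := by
    have := nrm_nonneg B
    gcongr
  have k2 : 2 * nrm P * (‖S.Dn j ζj‖ * ‖W (-(j:ℤ))‖) ≤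
      2 * (C1 * exp (((N:ℝ) - j) * (S.F E t + κ'))) * ((C2 * exp (j * (S.κ + t + κ'))) * (exp (γ * j) * ‖W 0‖)) := by
    have := nrm_nonneg P
    gcongr
  have e1 : exp (j * (S.F E t + κ') + ((N:ℝ) - j) * (S.κ + t + γ + κ')) =
      exp (j * (S.F E t + κ')) * (exp (((N:ℝ) - j) * (S.κ + t + κ')) * exp (γ * ((N:ℝ) - j))) := by
    rw [← exp_add, ← exp_add]; congr 1; ring
  have e2 : exp (((N:ℝ) - j) * (S.F E t + κ') + j * (S.κ + t + γ + κ')) =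
      exp (((N:ℝ) - j) * (S.F E t + κ')) * (exp (j * (S.κ + t + κ')) * exp (γ * j)) := by
    rw [← exp_add, ← exp_add]; congr 1; ring
  rw [e1, e2]
  have := key.trans (add_le_add k1 k2)
  refine le_of_mul_le_mul_right (this.trans (le_of_eq ?_)) hw0
  ring

lemma zero_count {m : ℕ} (c : ℂ) (z : Fin m → ℂ) {t1 t t2 δ : ℝ} (hδ : 0 < δ) (h1 : t1 ≤ t - δ) (h2 : t + δ < t2) :
    ((ann z t δ).card : ℝ) ≤ (jen c z t2 - jen c z t) / (t2 - t - δ) - (jen c z t - jen c z t1 - m * δ) / (t - t1) := by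
  classical
  set A := Finset.univ.filter (fun i => ‖z i‖ < exp (t + δ)) with hA
  set A' := Finset.univ.filter (fun i => ‖z i‖ ≤ exp (t - δ)) with hA'
  have hcard : (ann z t δ).card + A'.card = A.card := by
    rw [← Finset.card_union_of_disjoint]
    · congr 1
      ext i
      simp only [ann, hA, hA', Finset.mem_union, Finset.mem_filter, Finset.mem_univ, true_and]
      have : exp (t - δ) < exp (t + δ) := exp_lt_exp.2 (by linarith)
      constructor
      · rintro (h | h)
        · exact h.2
        · linarith
      · intro h
        rcases lt_or_ge (exp (t - δ)) ‖z i‖ with h3 | h3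
        · exact Or.inl ⟨h3, h⟩
        · exact Or.inr h3
    · rw [Finset.disjoint_left]
      intro i hi hi'
      simp only [ann, hA', Finset.mem_filter, Finset.mem_univ, true_and] at hi hi'
      linarith
  have hup : (A.card : ℝ) * (t2 - t - δ) ≤ jen c z t2 - jen c z t := by
    have e : jen c z t2 - jen c z t = ∑ i, (log (max (exp t2) ‖z i‖) - log (max (exp t) ‖z i‖)) := by
      unfold jen; rw [Finset.sum_sub_distrib]; ring
    rw [e, ← nsmul_eq_mul, ← Finset.sum_const, hA, Finset.sum_filter]
    apply Finset.sum_le_sum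
    intro i _
    split_ifs with h
    · have a1 := lmax_ge ‖z i‖ t2
      have a2 : log (max (exp t) ‖z i‖) ≤ t + δ := by
        rw [log_le_iff_le_exp (lt_max_of_lt_left (exp_pos _))]
        exact max_le (exp_le_exp.2 (by linarith)) h.le
      linarith
    · linarith [lmax_mono ‖z i‖ (show t ≤ t2 by linarith)]
  have hlow : jen c z t - jen c z t1 - m * δ ≤ (A'.card : ℝ) * (t - t1) := by
    have e : jen c z t - jen c z t1 - m * δ = ∑ i, (log (max (exp t) ‖z i‖) - log (max (exp t1) ‖z i‖) - δ) := by
      unfold jen; rw [Finset.sum_sub_distrib, Finset.sum_sub_distrib]; simp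
    rw [e, ← nsmul_eq_mul, ← Finset.sum_const, hA', Finset.sum_filter]
    apply Finset.sum_le_sum
    intro i _
    split_ifs with h
    · have := lmax_slope ‖z i‖ (show t1 ≤ t by linarith)
      linarith
    · push Not at h
      have h3 := lmax_slope ‖z i‖ (show t - δ ≤ t by linarith)
      have h4 : max (exp (t - δ)) ‖z i‖ ≤ max (exp t1) ‖z i‖ := by
        rw [max_eq_right h.le]; exact le_max_right _ _
      have h5 := log_le_log (lt_max_of_lt_left (exp_pos _)) h4
      linarith
  rw [← le_div_iff₀ (by linarith)] at hup
  rw [← div_le_iff₀ (by linarith)] at hlow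
  have : ((ann z t δ).card : ℝ) + A'.card = A.card := by exact_mod_cast hcard
  linarith

end Sys
end Lyap

namespace Lyap
open Real Filter Topology MeasureTheory

lemma comb {N : ℕ} {J : Finset ℕ} {c : ℝ} (hc : 0 < c) (hJ : J ⊆ Finset.range N) (h : 4 * c * N ≤ J.card) :
    (2 * c * N - 2) * (c * N) ≤ ∑ j ∈ J, min (j:ℝ) ((N:ℝ) - j) := by
  classical
  set T := J.filter (fun j : ℕ => min (j:ℝ) ((N:ℝ) - j) < c * N) with hT
  set T' := J.filter (fun j : ℕ => ¬ min (j:ℝ) ((N:ℝ) - j) < c * N) with hT'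
  have hcN : 0 ≤ c * N := by positivity
  have hTc : (T.card : ℝ) ≤ 2 * (c * N + 1) := by
    have hsub : T ⊆ Finset.range ⌈c * N⌉₊ ∪ Finset.Ico (N - ⌈c * N⌉₊) N := by
      intro j hj
      simp only [hT, Finset.mem_filter] at hj
      have hjN := Finset.mem_range.1 (hJ hj.1)
      simp only [Finset.mem_union, Finset.mem_range, Finset.mem_Ico]
      rcases min_lt_iff.1 hj.2 with h1 | h1
      · left
        have : (j:ℝ) < ⌈c * N⌉₊ := h1.trans_le (Nat.le_ceil _)
        exact_mod_cast this
      · right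
        refine ⟨?_, hjN⟩
        have : (N:ℝ) < ⌈c * N⌉₊ + j := by linarith [Nat.le_ceil (c * N)]
        have : N < ⌈c * N⌉₊ + j := by exact_mod_cast this
        omega
    have h1 := (Finset.card_le_card hsub).trans (Finset.card_union_le _ _)
    rw [Finset.card_range, Nat.card_Ico] at h1
    have h2 : T.card ≤ 2 * ⌈c * N⌉₊ := by omega
    have h3 : (T.card : ℝ) ≤ 2 * ⌈c * N⌉₊ := by exact_mod_cast h2
    linarith [Nat.ceil_lt_add_one hcN]
  have hsplit : (T.card : ℝ) + T'.card = J.card := by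
    have := Finset.card_filter_add_card_filter_not (s := J) (fun j : ℕ => min (j:ℝ) ((N:ℝ) - j) < c * N)
    rw [← Nat.cast_add]
    exact congrArg Nat.cast this
  have h1 : (T'.card : ℝ) * (c * N) ≤ ∑ j ∈ T', min (j:ℝ) ((N:ℝ) - j) := by
    rw [← nsmul_eq_mul]
    apply Finset.card_nsmul_le_sum
    intro j hj
    simp only [hT', Finset.mem_filter, not_lt] at hj
    exact hj.2
  have h2 : ∑ j ∈ T', min (j:ℝ) ((N:ℝ) - j) ≤ ∑ j ∈ J, min (j:ℝ) ((N:ℝ) - j) := by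
    apply Finset.sum_le_sum_of_subset_of_nonneg (Finset.filter_subset _ _)
    intro j hj _
    have hjN := Finset.mem_range.1 (hJ hj)
    have : (j:ℝ) ≤ N := by exact_mod_cast hjN.le
    exact le_min (by positivity) (by linarith)
  refine le_trans (mul_le_mul_of_nonneg_right ?_ hcN) (h1.trans h2)
  linarith

namespace Sys
variable {S : Sys}

set_option maxHeartbeats 1000000 in
lemma K_jump {E : ℂ} {t1 t t2 γ : ℝ} (h1 : S.ok t1) (h2 : S.ok t2) (ht1 : t1 < t) (ht2 : t < t2)
    (hγ : γ < S.F E t - S.κ - t) (hbad : S.Bad E t γ) :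
    1 ≤ (S.F E t2 - S.F E t) / (t2 - t) - (S.F E t - S.F E t1) / (t - t1) := by
  by_contra hcon
  push Not at hcon
  have ht : S.ok t := h1.conv h2 ht1.le ht2.le
  set F := S.F E t with hF
  set F1 := S.F E t1 with hF1
  set F2 := S.F E t2 with hF2
  set g := F - S.κ - t - γ with hg
  have hg0 : 0 < g := by rw [hg]; linarith
  set c := (1 - ((F2 - F) / (t2 - t) - (F - F1) / (t - t1))) / 5 with hc
  have hc0 : 0 < c := by rw [hc]; apply div_pos <;> linarith
  have hφ : ∀ᶠ s in 𝓝 (0:ℝ), (F2 - F + s) / (t2 - t - s) - (F - F1 - s - 2 * s) / (t - t1) < 1 - 4 * c := by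
    have hcont : ContinuousAt (fun s : ℝ => (F2 - F + s) / (t2 - t - s) - (F - F1 - s - 2 * s) / (t - t1)) 0 := by
      apply ContinuousAt.sub
      · apply ContinuousAt.div (by fun_prop) (by fun_prop)
        simp; linarith
      · apply ContinuousAt.div (by fun_prop) (by fun_prop)
        linarith
    apply hcont.eventually_lt_const
    simp only [add_zero, sub_zero, mul_zero]
    rw [show (F2 - F) / (t2 - t) - (F - F1) / (t - t1) = 1 - 5 * c by rw [hc]; ring]
    linarith
  have hev : ∀ᶠ s in 𝓝 (0:ℝ), S.ok (t + 2 * s) ∧ s < t - t1 ∧ s < t2 - t ∧ 7 * s < g * c ^ 2 := by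
    refine Filter.Eventually.and ?_ (Filter.Eventually.and ?_ (Filter.Eventually.and ?_ ?_))
    · have hcont : Continuous (fun s : ℝ => t + 2 * s) := by fun_prop
      exact ((isOpen_ok (S := S)).preimage hcont).mem_nhds (by simpa using ht)
    · exact eventually_lt_nhds (by linarith)
    · exact eventually_lt_nhds (by linarith)
    · have hcont : ContinuousAt (fun s : ℝ => 7 * s) 0 := by fun_prop
      apply hcont.eventually_lt_const
      simp; positivity
  obtain ⟨s, ⟨⟨hφs, hok, hs1, hs2, hs3⟩, hs0⟩⟩ : ∃ s : ℝ, (((F2 - F + s) / (t2 - t - s) - (F - F1 - s - 2 * s) / (t - t1) < 1 - 4 * c) ∧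
      (S.ok (t + 2 * s) ∧ s < t - t1 ∧ s < t2 - t ∧ 7 * s < g * c ^ 2)) ∧ 0 < s := by
    have h := ((hφ.and hev).filter_mono (nhdsWithin_le_nhds (s := Set.Ioi 0))).and (self_mem_nhdsWithin (a := (0:ℝ)) (s := Set.Ioi 0))
    exact h.exists
  obtain ⟨ζ, hζ, hest⟩ := Bad_est ht hbad
  obtain ⟨C, hC, hest⟩ := hest s hs0
  obtain ⟨Cd, hCd, hdisc⟩ := upper_disc hok E hs0
  set C' := max Cd (2 * C) with hC'
  have hC'0 : 0 < C' := lt_max_of_lt_left hCd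
  set K0 := log C' + log 12 + 4 * log (4 / (2 * (1 - exp (-s)))) + 2 * g * c with hK0
  have hs12 : 0 < s / 2 := by positivity
  have e1 : ∀ᶠ n : ℕ in atTop, S.a E t1 n / n < F1 + s / 2 := (F_tendsto h1 E).eventually_lt_const (by linarith)
  have e2 : ∀ᶠ n : ℕ in atTop, S.a E t2 n / n < F2 + s / 2 := (F_tendsto h2 E).eventually_lt_const (by linarith)
  have e3 : ∀ᶠ n : ℕ in atTop, log 12 / (s / 2) < n := tendsto_natCast_atTop_atTop.eventually_gt_atTop _
  have e4 : ∀ᶠ n : ℕ in atTop, K0 / (g * c ^ 2 - 7 * s + g * c ^ 2) < n := tendsto_natCast_atTop_atTop.eventually_gt_atTop _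
  obtain ⟨N0, hN0⟩ := (((e1.and e2).and (e3.and e4)).and (eventually_gt_atTop 0)).exists_forall_of_atTop
  obtain ⟨N, hNN0, hsl⟩ := S.sumlog hs0 N0
  obtain ⟨⟨⟨f1, f2⟩, f3, f4⟩, hN⟩ := hN0 N hNN0
  have hNr : (0:ℝ) < N := by exact_mod_cast hN
  obtain ⟨m, cc, z, hm, hcc, hle, hopt⟩ := exists_h ht E N
  have haF : N * F ≤ S.a E t N := by
    have := F_le ht E hN.ne'
    rw [le_div_iff₀ hNr] at this; linarith
  have j1 : jen cc z t1 ≤ N * (F1 + s / 2) := by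
    have := jen_le_a h1 hcc hle
    rw [div_lt_iff₀ hNr] at f1; linarith
  have j2 : jen cc z t2 ≤ N * (F2 + s / 2) := by
    have := jen_le_a h2 hcc hle
    rw [div_lt_iff₀ hNr] at f2; linarith
  rw [div_lt_iff₀ hs12] at f3
  have hmR : (m:ℝ) ≤ 2 * N := by exact_mod_cast hm
  have hcount : ((ann z t s).card : ℝ) ≤ N * (1 - 4 * c) := by
    refine (zero_count cc z hs0 (t1 := t1) (t2 := t2) (by linarith) (by linarith)).trans ?_
    have q1 : (jen cc z t2 - jen cc z t) / (t2 - t - s) ≤ N * ((F2 - F + s) / (t2 - t - s)) := by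
      rw [← mul_div_assoc]
      apply div_le_div_of_nonneg_right _ (by linarith)
      linarith
    have q2 : N * ((F - F1 - s - 2 * s) / (t - t1)) ≤ (jen cc z t - jen cc z t1 - m * s) / (t - t1) := by
      rw [← mul_div_assoc]
      apply div_le_div_of_nonneg_right _ (by linarith)
      have : m * s ≤ 2 * N * s := by gcongr
      linarith
    have q3 := mul_le_mul_of_nonneg_left hφs.le hNr.le
    linarith
  set U := log C' + N * (F + 5 * s) with hU
  have hFs : S.F E (t + 2 * s) ≤ F + 4 * s := by
    have := F_slope ht hok (by linarith) E
    linarith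
  obtain ⟨J, hJ, hJc, hfin⟩ := K_core (N := N) (m := m) (t := t) (δ := s) (κ' := s) (U := U)
    (ζ := fun j => S.β⁻¹ ^ j * ζ) (c := cc) (z := z)
    (fun j => by rw [norm_mul, norm_pow, norm_inv, S.norm_β]; simp [hζ]) hcc hm hN hs0 hs0
    (fun z => hsl t ζ hζ z)
    (fun ξ hξ => by
      refine (hle ξ).trans ((hdisc N ξ hξ).trans ?_)
      rw [hU, exp_add, exp_log hC'0]
      have hx : exp (N * (S.F E (t + 2 * s) + s)) ≤ exp (N * (F + 5 * s)) := by
        apply exp_le_exp.2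
        apply mul_le_mul_of_nonneg_left _ hNr.le
        linarith
      exact mul_le_mul (le_max_left _ _) hx (exp_pos _).le hC'0.le)
    (B := fun j => g * min (j:ℝ) ((N:ℝ) - j))
    (fun j hj => by
      refine (hle _).trans ((hest N j hj.le).trans ?_)
      have hjN : (j:ℝ) ≤ N := by exact_mod_cast hj.le
      have b1 : exp (j * (F + s) + ((N:ℝ) - j) * (S.κ + t + γ + s)) ≤ exp (N * (F + 5 * s) - g * min (j:ℝ) ((N:ℝ) - j)) := by
        apply exp_le_exp.2
        have : g * min (j:ℝ) ((N:ℝ) - j) ≤ g * ((N:ℝ) - j) := mul_le_mul_of_nonneg_left (min_le_right _ _) hg0.le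
        have e : S.κ + t + γ = F - g := by rw [hg]; ring
        rw [e]
        have := mul_pos hNr hs0
        linarith
      have b2 : exp (((N:ℝ) - j) * (F + s) + j * (S.κ + t + γ + s)) ≤ exp (N * (F + 5 * s) - g * min (j:ℝ) ((N:ℝ) - j)) := by
        apply exp_le_exp.2
        have : g * min (j:ℝ) ((N:ℝ) - j) ≤ g * j := mul_le_mul_of_nonneg_left (min_le_left _ _) hg0.le
        have e : S.κ + t + γ = F - g := by rw [hg]; ring
        rw [e]
        have := mul_pos hNr hs0
        linarith
      rw [hU, add_sub_assoc, exp_add (log C'), exp_log hC'0]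
      calc _ ≤ C * (exp (N * (F + 5 * s) - g * min (j:ℝ) ((N:ℝ) - j)) + exp (N * (F + 5 * s) - g * min (j:ℝ) ((N:ℝ) - j))) := by gcongr
        _ = (2 * C) * exp (N * (F + 5 * s) - g * min (j:ℝ) ((N:ℝ) - j)) := by ring
        _ ≤ _ := by gcongr; exact le_max_right _ _)
  have hcomb := comb hc0 hJ (by linarith)
  rw [← Finset.mul_sum] at hfin
  have hB := mul_le_mul_of_nonneg_left hcomb hg0.le
  have hjen : N * (N * F - log 12) ≤ N * jen cc z t := by gcongr; linarith
  rw [div_lt_iff₀ (by nlinarith [mul_pos hg0 (pow_pos hc0 2)])] at f4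
  have hfin2 : N * (N * (2 * g * c ^ 2 - 7 * s)) ≤ N * K0 := by
    rw [hK0]
    rw [hU] at hfin
    ring_nf at hfin hB hjen ⊢
    linarith
  have := le_of_mul_le_mul_left hfin2 hNr
  linarith

end Sys
end Lyap

namespace Lyap
open Real Filter Topology MeasureTheory

namespace Sys
variable {S : Sys}

lemma tendsto_MV {E ζ0 : ℂ} {w0 : V2} {ζ : ℕ → ℂ} {w : ℕ → V2} (h1 : Tendsto ζ atTop (𝓝 ζ0))
    (h2 : Tendsto w atTop (𝓝 w0)) :
    Tendsto (fun n => (S.M E (ζ n)).mulVec (w n)) atTop (𝓝 ((S.M E ζ0).mulVec w0)) := by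
  have h5 : Continuous (fun ζ : ℂ => S.M E ζ) := (S.continuous_M2).comp (by fun_prop : Continuous fun ζ : ℂ => (E, ζ))
  rw [tendsto_pi_nhds] at h2 ⊢
  intro i
  simp only [Matrix.mulVec, dotProduct, Fin.sum_univ_two]
  have h8 : ∀ j, Tendsto (fun n => S.M E (ζ n) i j) atTop (𝓝 (S.M E ζ0 i j)) := fun j =>
    ((h5.matrix_elem i j).tendsto ζ0).comp h1
  exact ((h8 0).mul (h2 0)).add ((h8 1).mul (h2 1))

set_option maxHeartbeats 1000000 in
lemma cpt {E : ℂ} {t γ : ℝ} (hb : ¬ S.Bad E t γ) : ∃ n0 : ℕ, ∃ δ0 > 0, ∀ (ζ : ℤ → ℂ) (W : ℤ → V2), W 0 ≠ 0 →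
    |‖ζ 0‖ - exp t| ≤ δ0 → (∀ k : ℤ, |k| ≤ n0 → ‖ζ k - S.β ^ k * ζ 0‖ ≤ δ0) →
    (∀ k : ℤ, |k| ≤ n0 → ‖S.d (ζ k) • W (k + 1) - (S.M E (ζ k)).mulVec (W k)‖ ≤ δ0 * ‖W 0‖) →
    ∃ j : ℤ, |j| ≤ n0 ∧ exp (γ * |(j:ℝ)|) * ‖W 0‖ < ‖W j‖ := by
  by_contra! hcon
  have key : ∀ n : ℕ, ∃ (ζ : ℤ → ℂ) (W : ℤ → V2), ‖W 0‖ = 1 ∧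
    |‖ζ 0‖ - exp t| ≤ 1 / ((n:ℝ) + 1) ∧ (∀ k : ℤ, |k| ≤ n → ‖ζ k - S.β ^ k * ζ 0‖ ≤ 1 / ((n:ℝ) + 1)) ∧
    (∀ k : ℤ, |k| ≤ n → ‖S.d (ζ k) • W (k + 1) - (S.M E (ζ k)).mulVec (W k)‖ ≤ 1 / ((n:ℝ) + 1)) ∧
    ∀ j : ℤ, |j| ≤ n → ‖W j‖ ≤ exp (γ * |(j:ℝ)|) := by
    intro n
    obtain ⟨ζ, W, hW0, h1, h2, h3, h4⟩ := hcon n (1 / ((n:ℝ) + 1)) (by positivity)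
    have hw : 0 < ‖W 0‖ := norm_pos_iff.2 hW0
    have hs : ‖((‖W 0‖⁻¹ : ℝ) : ℂ)‖ = ‖W 0‖⁻¹ := by
      rw [Complex.norm_real, Real.norm_eq_abs, abs_of_pos (by positivity)]
    refine ⟨ζ, fun k => ((‖W 0‖⁻¹ : ℝ) : ℂ) • W k, ?_, h1, h2, ?_, ?_⟩
    · rw [norm_smul, hs, inv_mul_cancel₀ hw.ne']
    · intro k hk
      have e : S.d (ζ k) • (((‖W 0‖⁻¹ : ℝ) : ℂ) • W (k + 1)) - (S.M E (ζ k)).mulVec (((‖W 0‖⁻¹ : ℝ) : ℂ) • W k) =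
          ((‖W 0‖⁻¹ : ℝ) : ℂ) • (S.d (ζ k) • W (k + 1) - (S.M E (ζ k)).mulVec (W k)) := by
        rw [Matrix.mulVec_smul, smul_comm, smul_sub]
      rw [e, norm_smul, hs, inv_mul_le_iff₀ hw, mul_comm]
      exact h3 k hk
    · intro j hj
      rw [norm_smul, hs, inv_mul_le_iff₀ hw, mul_comm]
      exact h4 j hj
  choose ζ W hW0 h1 h2 h3 h4 using key
  let W' : ℕ → ℤ → V2 := fun n k => if |k| ≤ n then W n k else 0
  let Kset : Set (ℂ × (ℤ → V2)) := (Metric.closedBall 0 (exp t + 1)) ×ˢ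
    (Set.univ.pi fun j : ℤ => Metric.closedBall (0 : V2) (exp (γ * |(j:ℝ)|)))
  have hK : IsCompact Kset := (isCompact_closedBall _ _).prod (isCompact_univ_pi fun j => isCompact_closedBall _ _)
  have hmem : ∀ n, ((ζ n 0, W' n) : ℂ × (ℤ → V2)) ∈ Kset := by
    intro n
    refine ⟨?_, ?_⟩
    · simp only [mem_closedBall_zero_iff]
      have := (abs_le.1 (h1 n)).2
      have h5 : 1 / ((n:ℝ) + 1) ≤ 1 := by
        rw [div_le_one (by positivity)]
        have : (0:ℝ) ≤ n := by positivity
        linarith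
      linarith
    · intro j _
      simp only [W', mem_closedBall_zero_iff]
      split_ifs with h
      · exact h4 n j h
      · rw [norm_zero]; exact (exp_pos _).le
  obtain ⟨⟨ζi, Wi⟩, hl, φ, hφ, hlim⟩ := hK.tendsto_subseq hmem
  have hzero : Tendsto (fun n : ℕ => 1 / (((φ n : ℕ) : ℝ) + 1)) atTop (𝓝 0) :=
    (tendsto_one_div_add_atTop_nhds_zero_nat (𝕜 := ℝ)).comp hφ.tendsto_atTop
  have hζ : Tendsto (fun n => ζ (φ n) 0) atTop (𝓝 ζi) := (continuous_fst.tendsto _).comp hlim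
  have hWlim' : Tendsto (fun n => W' (φ n)) atTop (𝓝 Wi) := (continuous_snd.tendsto _).comp hlim
  have hlarge : ∀ k : ℤ, ∀ᶠ n in atTop, |k| ≤ (φ n : ℕ) := by
    intro k
    filter_upwards [hφ.tendsto_atTop.eventually_ge_atTop k.natAbs] with n hn
    rw [Int.abs_eq_natAbs]; exact_mod_cast hn
  have hWlim : ∀ k : ℤ, Tendsto (fun n => W (φ n) k) atTop (𝓝 (Wi k)) := by
    intro k
    refine ((tendsto_pi_nhds.1 hWlim') k).congr' ?_
    filter_upwards [hlarge k] with n hn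
    simp only [W', if_pos hn]
  have hζk : ∀ k : ℤ, Tendsto (fun n => ζ (φ n) k) atTop (𝓝 (S.β ^ k * ζi)) := by
    intro k
    have e1 : Tendsto (fun n => ζ (φ n) k - S.β ^ k * ζ (φ n) 0) atTop (𝓝 0) := by
      apply squeeze_zero_norm' _ hzero
      filter_upwards [hlarge k] with n hn
      exact h2 (φ n) k hn
    have := e1.add (hζ.const_mul (S.β ^ k))
    simpa using this
  have hnorm0 : ‖Wi 0‖ = 1 := by
    refine tendsto_nhds_unique (hWlim 0).norm ?_
    simp [hW0]
  apply hb
  refine ⟨ζi, ?_, Wi, ?_, ?_, ?_⟩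
  · have e1 : Tendsto (fun n => ‖ζ (φ n) 0‖ - exp t) atTop (𝓝 0) := by
      apply squeeze_zero_norm' _ hzero
      filter_upwards with n
      exact h1 (φ n)
    have := tendsto_nhds_unique e1 (hζ.norm.sub_const _)
    linarith
  · intro h; rw [h, norm_zero] at hnorm0; norm_num at hnorm0
  · intro k
    have e2 : Tendsto (fun n => (S.M E (ζ (φ n) k)).mulVec (W (φ n) k)) atTop (𝓝 ((S.M E (S.β ^ k * ζi)).mulVec (Wi k))) :=
      tendsto_MV (hζk k) (hWlim k)
    have e3 : Tendsto (fun n => S.d (ζ (φ n) k) • W (φ n) (k + 1)) atTop (𝓝 (S.d (S.β ^ k * ζi) • Wi (k + 1))) :=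
      ((S.continuous_d.tendsto _).comp (hζk k)).smul (hWlim (k + 1))
    have e1 : Tendsto (fun n => S.d (ζ (φ n) k) • W (φ n) (k + 1) - (S.M E (ζ (φ n) k)).mulVec (W (φ n) k)) atTop (𝓝 0) := by
      apply squeeze_zero_norm' _ hzero
      filter_upwards [hlarge k] with n hn
      exact h3 (φ n) k hn
    exact sub_eq_zero.1 (tendsto_nhds_unique (e3.sub e2) e1)
  · intro k
    rw [hnorm0, mul_one]
    refine le_of_tendsto (hWlim k).norm ?_
    filter_upwards [hlarge k] with n hn
    exact h4 (φ n) k hn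

end Sys

/-- recurrence of rotation -/
lemma recur {w : ℂ} (hw : ‖w‖ = 1) {ε : ℝ} (hε : 0 < ε) (N : ℕ) : ∃ n : ℕ, N ≤ n ∧ 0 < n ∧ ‖w ^ n - 1‖ ≤ ε := by
  have hmem : ∀ n : ℕ, w ^ n ∈ Metric.closedBall (0:ℂ) 1 := by
    intro n; simp [hw]
  obtain ⟨a, _, φ, hφ, hlim⟩ := (isCompact_closedBall (0:ℂ) 1).tendsto_subseq hmem
  obtain ⟨n1, hn1⟩ := Metric.cauchySeq_iff.1 hlim.cauchySeq ε hε
  have h1 : φ n1 + (N + 1) ≤ φ (n1 + (N + 1)) := by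
    have : ∀ k, φ n1 + k ≤ φ (n1 + k) := by
      intro k
      induction k with
      | zero => simp
      | succ k ih =>
        have := hφ (show n1 + k < n1 + (k + 1) by omega)
        omega
    exact this _
  refine ⟨φ (n1 + (N + 1)) - φ n1, by omega, by omega, ?_⟩
  have := hn1 (n1 + (N + 1)) (by omega) n1 le_rfl
  rw [dist_eq_norm] at this
  simp only [Function.comp] at this
  have e : w ^ (φ (n1 + (N + 1))) - w ^ (φ n1) = w ^ (φ n1) * (w ^ (φ (n1 + (N + 1)) - φ n1) - 1) := by
    rw [mul_sub, ← pow_add, Nat.add_sub_cancel' (by omega), mul_one]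
  rw [e, norm_mul, norm_pow, hw, one_pow, one_mul] at this
  exact this.le

/-- multiplier estimate -/
lemma mult_est {x : ℤ → ℝ} {n n0 : ℕ} {ρ γ : ℝ} (hn : 0 < n) (hx : ∀ k, 0 < x k) (hρ : 0 < ρ)
    (hper : ∀ k, x (k + n) = ρ * x k) (hstar : ∀ k, ∃ j : ℤ, |j| ≤ n0 ∧ exp (γ * |(j:ℝ)|) * x k < x (k + j)) :
    γ * n < |log ρ| := by
  set σ := log ρ / n with hσ
  have hnr : (0:ℝ) < n := by exact_mod_cast hn
  set y : ℤ → ℝ := fun k => x k * exp (-(σ * k)) with hy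
  have hyper : ∀ k, y (k + n) = y k := by
    intro k
    simp only [hy]
    rw [hper]
    have : exp (-(σ * ((k + n : ℤ) : ℝ))) = exp (-(σ * k)) * ρ⁻¹ := by
      rw [← exp_log (inv_pos.2 hρ), ← exp_add, log_inv]
      congr 1
      push_cast
      rw [hσ]; field_simp; ring
    rw [this]; field_simp
  have hyp : Function.Periodic y (n : ℤ) := hyper
  obtain ⟨k, hk⟩ : ∃ k, ∀ j, y j ≤ y k := by
    obtain ⟨k, hk, hmax⟩ := Finset.exists_max_image (Finset.Ico (0:ℤ) n) y ⟨0, by simp [hn]⟩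
    refine ⟨k, fun j => ?_⟩
    have hnz : (n:ℤ) ≠ 0 := by exact_mod_cast hn.ne'
    have : y j = y (j % n) := by
      have := hyp.sub_zsmul_eq (x := j) (j / n)
      rw [← this]
      congr 1
      rw [smul_eq_mul, Int.emod_def]; ring
    rw [this]
    apply hmax
    simp only [Finset.mem_Ico]
    exact ⟨Int.emod_nonneg _ hnz, Int.emod_lt_of_pos _ (by exact_mod_cast hn)⟩
  obtain ⟨j, _, hj⟩ := hstar k
  have h1 := hk (k + j)
  simp only [hy] at h1
  have h2 : x (k + j) ≤ x k * exp (σ * j) := by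
    have : exp (-(σ * ((k + j : ℤ) : ℝ))) = exp (-(σ * k)) * (exp (σ * j))⁻¹ := by
      rw [← exp_neg, ← exp_add]; congr 1; push_cast; ring
    rw [this, ← mul_assoc] at h1
    have e := exp_pos (σ * j)
    have e2 := exp_pos (-(σ * (k:ℝ)))
    rw [← div_eq_mul_inv, div_le_iff₀ e] at h1
    nlinarith
  have h3 : exp (γ * |(j:ℝ)|) < exp (σ * j) := by
    have := hj.trans_le h2
    rw [mul_comm] at this
    exact lt_of_mul_lt_mul_left this (hx k).le
  rw [exp_lt_exp] at h3
  have h4 : σ * j ≤ |σ| * |(j:ℝ)| := by rw [← abs_mul]; exact le_abs_self _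
  have h5 : γ < |σ| := by
    have h6 : γ * |(j:ℝ)| < |σ| * |(j:ℝ)| := h3.trans_le h4
    exact lt_of_mul_lt_mul_right h6 (abs_nonneg _)
  rw [hσ, abs_div, abs_of_pos hnr, lt_div_iff₀ hnr] at h5
  exact h5

/-- expansion estimate -/
lemma expand_est {x : ℤ → ℝ} {n n0 : ℕ} {ρ γ C0 : ℝ} (hn : 0 < n) (hx : ∀ k, 0 < x k) (hγ : 0 < γ)
    (hC0 : 1 ≤ C0) (hback : ∀ k, x (k - 1) ≤ C0 * x k) (hρ : exp (γ * n) ≤ ρ)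
    (hper : ∀ k, x (k + n) = ρ * x k) (hstar : ∀ k, ∃ j : ℤ, |j| ≤ n0 ∧ exp (γ * |(j:ℝ)|) * x k < x (k + j))
    (k : ℤ) (i : ℕ) : exp (γ * i) * x (k - i) ≤ (C0 * exp γ) ^ n0 * x k := by
  set f : ℕ → ℝ := fun i => exp (γ * i) * x (k - i) with hf
  have hρ0 : 0 < ρ := (exp_pos _).trans_le hρ
  have hstep : ∀ i, f (i + n) ≤ f i := by
    intro i
    simp only [hf]
    have e1 : x (k - i) = ρ * x (k - (i + n : ℕ)) := by
      rw [← hper]; congr 1; push_cast; ring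
    rw [e1]
    have e2 : exp (γ * ((i + n : ℕ) : ℝ)) = exp (γ * i) * exp (γ * n) := by
      rw [← exp_add]; congr 1; push_cast; ring
    rw [e2, mul_assoc]
    have := hx (k - (i + n : ℕ))
    gcongr
  obtain ⟨i0, hi0⟩ : ∃ i0, ∀ i, f i ≤ f i0 := by
    obtain ⟨i0, h0, hmax⟩ := Finset.exists_max_image (Finset.range n) f ⟨0, by simp [hn]⟩
    refine ⟨i0, fun i => ?_⟩
    induction i using Nat.strong_induction_on with
    | _ i ih =>
      rcases lt_or_ge i n with h | h
      · exact hmax i (Finset.mem_range.2 h)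
      · have := hstep (i - n)
        rw [Nat.sub_add_cancel h] at this
        exact this.trans (ih (i - n) (by omega))
  have hi0n : i0 < n0 := by
    by_contra! hcon
    obtain ⟨j, hj, hlt⟩ := hstar (k - i0)
    have hj2 : j ≤ i0 := (le_abs_self j).trans (hj.trans (by exact_mod_cast hcon))
    have h1 := hi0 ((i0:ℤ) - j).toNat
    have hc : ((((i0:ℤ) - j).toNat : ℤ)) = (i0:ℤ) - j := Int.toNat_of_nonneg (by linarith)
    have hcr : ((((i0:ℤ) - j).toNat : ℕ) : ℝ) = (i0:ℝ) - j := by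
      have : ((((i0:ℤ) - j).toNat : ℤ) : ℝ) = (((i0:ℤ) - j : ℤ) : ℝ) := by rw [hc]
      push_cast at this; exact this
    simp only [hf] at h1
    rw [hc, hcr, show k - ((i0:ℤ) - j) = k - i0 + j by ring] at h1
    have e : exp (γ * ((i0:ℝ) - j)) = exp (γ * i0) * exp (-(γ * j)) := by
      rw [← exp_add]; congr 1; ring
    rw [e, mul_assoc] at h1
    have h2 := le_of_mul_le_mul_left h1 (exp_pos _)
    have h3 : exp (-(γ * (j:ℝ))) * (exp (γ * |(j:ℝ)|) * x (k - i0)) < x (k - i0) :=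
      (mul_lt_mul_of_pos_left hlt (exp_pos _)).trans_le h2
    rw [← mul_assoc, ← exp_add] at h3
    have h4 : 1 ≤ exp (-(γ * (j:ℝ)) + γ * |(j:ℝ)|) := by
      apply one_le_exp
      nlinarith [le_abs_self (j:ℝ)]
    nlinarith [hx (k - i0)]
  have hpow : ∀ i : ℕ, f i ≤ (C0 * exp γ) ^ i * x k := by
    intro i
    induction i with
    | zero => simp [hf]
    | succ i ih =>
      simp only [hf] at ih ⊢
      have h1 := hback (k - i)
      have e : exp (γ * ((i + 1 : ℕ) : ℝ)) = exp (γ * i) * exp γ := by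
        rw [← exp_add]; congr 1; push_cast; ring
      rw [e, show k - ((i + 1 : ℕ) : ℤ) = k - i - 1 by push_cast; ring]
      calc exp (γ * i) * exp γ * x (k - i - 1) ≤ exp (γ * i) * exp γ * (C0 * x (k - i)) := by gcongr
        _ = (C0 * exp γ) * (exp (γ * i) * x (k - i)) := by ring
        _ ≤ (C0 * exp γ) * ((C0 * exp γ) ^ i * x k) := by gcongr
        _ = _ := by rw [pow_succ]; ring
  refine (hi0 i).trans ((hpow i0).trans ?_)
  have h1 : 1 ≤ C0 * exp γ := by
    have := one_le_exp hγ.le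
    nlinarith
  have := hx k
  gcongr

end Lyap

namespace Lyap
open Real Filter Topology MeasureTheory

lemma exists_root2 (B : Matrix (Fin 2) (Fin 2) ℂ) : ∃ ν1 ν2 : ℂ, ν1 + ν2 = B.trace ∧ ν1 * ν2 = B.det := by
  obtain ⟨s, hs⟩ := IsAlgClosed.exists_pow_nat_eq (B.trace ^ 2 - 4 * B.det) (n := 2) (by norm_num)
  refine ⟨(B.trace + s) / 2, (B.trace - s) / 2, by ring, ?_⟩
  have : (B.trace + s) / 2 * ((B.trace - s) / 2) = (B.trace ^ 2 - s ^ 2) / 4 := by ring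
  rw [this, hs]; ring

lemma exists_eigvec (B : Matrix (Fin 2) (Fin 2) ℂ) {ν1 ν2 : ℂ} (h1 : ν1 + ν2 = B.trace) (h2 : ν1 * ν2 = B.det) :
    ∃ w : V2, ‖w‖ = 1 ∧ B.mulVec w = ν1 • w := by
  have hd : (B - ν1 • (1 : Matrix (Fin 2) (Fin 2) ℂ)).det = 0 := by
    rw [Matrix.trace_fin_two] at h1
    rw [Matrix.det_fin_two] at h2
    simp only [Matrix.det_fin_two, Matrix.sub_apply, Matrix.smul_apply, Matrix.one_apply, smul_eq_mul]
    norm_num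
    linear_combination ν1 * h1 - h2
  obtain ⟨v, hv, he⟩ := Matrix.exists_mulVec_eq_zero_iff.2 hd
  have hn : 0 < ‖v‖ := norm_pos_iff.2 hv
  have he' : B.mulVec v = ν1 • v := by
    rw [Matrix.sub_mulVec, Matrix.smul_mulVec, Matrix.one_mulVec] at he
    exact sub_eq_zero.1 he
  refine ⟨((‖v‖⁻¹ : ℝ) : ℂ) • v, ?_, ?_⟩
  · rw [norm_smul, Complex.norm_real, Real.norm_eq_abs, abs_of_pos (by positivity), inv_mul_cancel₀ hn.ne']
  · rw [Matrix.mulVec_smul, he', smul_comm]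

lemma nrm_adj (A : Matrix (Fin 2) (Fin 2) ℂ) : nrm A.adjugate = nrm A := by
  unfold nrm
  rw [Matrix.adjugate_fin_two]
  simp; ring

/-- step bounds -/
lemma step_bound {A : Matrix (Fin 2) (Fin 2) ℂ} {δ : ℂ} {v w : V2} (hδ : δ ≠ 0) (hdet : A.det = δ ^ 2)
    (h : δ • w = A.mulVec v) : ‖w‖ ≤ nrm A / ‖δ‖ * ‖v‖ ∧ ‖v‖ ≤ nrm A / ‖δ‖ * ‖w‖ := by
  have hp : 0 < ‖δ‖ := norm_pos_iff.2 hδ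
  constructor
  · have := nrm_mulVec A v
    rw [← h, norm_smul] at this
    rw [div_mul_eq_mul_div, le_div_iff₀ hp]; linarith
  · have e : A.adjugate.mulVec w = δ • v := by
      have e1 : δ • A.adjugate.mulVec w = δ • (δ • v) := by
        rw [← Matrix.mulVec_smul, h, Matrix.mulVec_mulVec, Matrix.adjugate_mul, hdet,
          Matrix.smul_mulVec, Matrix.one_mulVec, smul_smul, sq]
      exact smul_right_injective _ hδ e1
    have := nrm_mulVec A.adjugate w
    rw [e, norm_smul, nrm_adj] at this
    rw [div_mul_eq_mul_div, le_div_iff₀ hp]; linarith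

lemma nrm_eig {B : Matrix (Fin 2) (Fin 2) ℂ} {ν1 ν2 : ℂ} {v w : V2} (hv : ‖v‖ = 1) (hw : ‖w‖ = 1)
    (h1 : B.mulVec v = ν1 • v) (h2 : B.mulVec w = ν2 • w) (hν : ‖ν2‖ ≤ ‖ν1‖) :
    ‖v 0 * w 1 - v 1 * w 0‖ * nrm B ≤ 32 * ‖ν1‖ := by
  set P : Matrix (Fin 2) (Fin 2) ℂ := !![v 0, w 0; v 1, w 1] with hP
  have hBP : B * P = P * !![ν1, 0; 0, ν2] := by
    have a0 := congrFun h1 0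
    have a1 := congrFun h1 1
    have b0 := congrFun h2 0
    have b1 := congrFun h2 1
    simp only [Matrix.mulVec, dotProduct, Fin.sum_univ_two, Pi.smul_apply, smul_eq_mul] at a0 a1 b0 b1
    ext i j
    fin_cases i <;> fin_cases j <;> simp [hP, Matrix.mul_apply, Fin.sum_univ_two]
    · linear_combination a0
    · linear_combination b0
    · linear_combination a1
    · linear_combination b1
  have hdet : P.det = v 0 * w 1 - v 1 * w 0 := by rw [hP, Matrix.det_fin_two_of]; ring
  have e : P.det • B = P * !![ν1, 0; 0, ν2] * P.adjugate := by
    rw [← hBP, Matrix.mul_assoc, Matrix.mul_adjugate, Matrix.mul_smul, Matrix.mul_one]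
  have hPn : nrm P ≤ 4 := by
    have p1 := norm_le_pi_norm v 0
    have p2 := norm_le_pi_norm v 1
    have p3 := norm_le_pi_norm w 0
    have p4 := norm_le_pi_norm w 1
    simp only [nrm, hP]
    simp
    linarith
  have hD : nrm !![ν1, 0; 0, ν2] ≤ 2 * ‖ν1‖ := by
    simp [nrm]; linarith
  rw [← hdet, ← nrm_smul, e]
  calc _ ≤ nrm P * nrm !![ν1, 0; 0, ν2] * nrm P.adjugate :=
        (nrm_mul_le _ _).trans (mul_le_mul_of_nonneg_right (nrm_mul_le _ _) (nrm_nonneg _))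
    _ ≤ 4 * (2 * ‖ν1‖) * 4 := by
        rw [nrm_adj]
        have := nrm_nonneg P
        have := nrm_nonneg !![ν1, 0; 0, ν2]
        gcongr
    _ = _ := by ring

/-- nearly parallel unit vectors -/
lemma near_par {v w : V2} (hv : ‖v‖ = 1) (hw : ‖w‖ = 1) : ∃ c : ℂ, ‖c‖ ≤ 1 ∧ ‖v - c • w‖ ≤ ‖v 0 * w 1 - v 1 * w 0‖ := by
  have p1 := norm_le_pi_norm v 0
  have p2 := norm_le_pi_norm v 1
  have hk : ‖w 0‖ = 1 ∨ ‖w 1‖ = 1 := by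
    by_contra! hcon
    have q1 := (hw ▸ norm_le_pi_norm w 0).lt_of_ne hcon.1
    have q2 := (hw ▸ norm_le_pi_norm w 1).lt_of_ne hcon.2
    have : ‖w‖ < 1 := by
      rw [pi_norm_lt_iff (by norm_num)]
      intro i; fin_cases i
      · exact q1
      · exact q2
    linarith
  rcases hk with h | h
  · have hne : w 0 ≠ 0 := by intro h0; rw [h0, norm_zero] at h; norm_num at h
    refine ⟨v 0 / w 0, by rw [norm_div, h]; linarith, ?_⟩
    apply V2_norm_le
    · simp [hne]
    · have : (v - (v 0 / w 0) • w) 1 = -(v 0 * w 1 - v 1 * w 0) / w 0 := by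
        simp; field_simp
      rw [this, norm_div, h, norm_neg, div_one]
  · have hne : w 1 ≠ 0 := by intro h0; rw [h0, norm_zero] at h; norm_num at h
    refine ⟨v 1 / w 1, by rw [norm_div, h]; linarith, ?_⟩
    apply V2_norm_le
    · have : (v - (v 1 / w 1) • w) 0 = (v 0 * w 1 - v 1 * w 0) / w 1 := by
        simp; field_simp
      rw [this, norm_div, h, div_one]
    · simp [hne]

namespace Sys
variable {S : Sys}

lemma per_orbit {E ζ μ : ℂ} {t : ℝ} (ht : S.ok t) (hζ : ‖ζ‖ = exp t) {n : ℕ} (hn : 0 < n) {w : V2}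
    (hμ : μ ≠ 0) (he : (S.Mn E n ζ).mulVec w = (μ * S.Dn n ζ) • w) :
    ∃ W : ℤ → V2, W 0 = w ∧ (∀ k, W (k + n) = μ • W k) ∧
      ∀ k : ℤ, S.d (S.β ^ (k % n) * ζ) • W (k + 1) = (S.M E (S.β ^ (k % n) * ζ)).mulVec (W k) := by
  set V : ℕ → V2 := fun r => (S.Dn r ζ)⁻¹ • (S.Mn E r ζ).mulVec w with hV
  set W : ℤ → V2 := fun k => μ ^ (k / n) • V (k % n).toNat with hW
  have hnz : (n:ℤ) ≠ 0 := by exact_mod_cast hn.ne'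
  have hD : ∀ r, S.Dn r ζ ≠ 0 := fun r => Dn_ne ht hζ r
  have hV0 : V 0 = w := by simp only [hV]; rw [Mn_zero, Matrix.one_mulVec]; simp [Dn]
  have hVn : V n = μ • w := by
    simp only [hV]
    rw [he, smul_smul]
    congr 1
    have := hD n
    field_simp
  have hVs : ∀ r : ℕ, S.d (S.β ^ r * ζ) • V (r + 1) = (S.M E (S.β ^ r * ζ)).mulVec (V r) := by
    intro r
    simp only [hV]
    rw [Matrix.mulVec_smul, Mn_succ, ← Matrix.mulVec_mulVec, smul_smul]
    congr 1
    have h1 := hD r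
    have h2 : S.d (S.β ^ r * ζ) ≠ 0 := d_ne ht (norm_rot hζ r)
    have h3 : S.Dn (r + 1) ζ = S.Dn r ζ * S.d (S.β ^ r * ζ) := by unfold Dn; rw [Finset.prod_range_succ]
    rw [h3]; field_simp
  have hWlt : ∀ (q : ℤ) (r : ℕ), r < n → W (n * q + r) = μ ^ q • V r := by
    intro q r hr
    have hr' : (r:ℤ) < n := by exact_mod_cast hr
    have e1 : ((n:ℤ) * q + r) / n = q := by
      rw [Int.mul_add_ediv_left _ _ hnz, Int.ediv_eq_zero_of_lt (by positivity) hr', add_zero]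
    have e2 : ((n:ℤ) * q + r) % n = r := by
      rw [Int.mul_add_emod_self_left, Int.emod_eq_of_lt (by positivity) hr']
    simp only [hW]
    rw [e1, e2, Int.toNat_natCast]
  have hWle : ∀ (q : ℤ) (r : ℕ), r ≤ n → W (n * q + r) = μ ^ q • V r := by
    intro q r hr
    rcases hr.lt_or_eq with h | h
    · exact hWlt q r h
    · rw [h, show (n:ℤ) * q + n = n * (q + 1) + (0:ℕ) by push_cast; ring, hWlt _ 0 hn, hV0, hVn, smul_smul,
        zpow_add_one₀ hμ]
  refine ⟨W, ?_, ?_, ?_⟩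
  · have := hWlt 0 0 hn
    simpa [hV0] using this
  · intro k
    simp only [hW]
    rw [Int.add_emod_right, Int.add_ediv_of_dvd_right (dvd_refl _), Int.ediv_self hnz, zpow_add_one₀ hμ, mul_comm, mul_smul]
  · intro k
    obtain ⟨r, hr⟩ : ∃ r : ℕ, k % n = r := ⟨(k % n).toNat, (Int.toNat_of_nonneg (Int.emod_nonneg _ hnz)).symm⟩
    have hrn : r < n := by
      have := Int.emod_lt_of_pos k (show (0:ℤ) < n by exact_mod_cast hn)
      rw [hr] at this; exact_mod_cast this
    have hk : k = n * (k / n) + r := by rw [← hr]; exact (Int.mul_ediv_add_emod k n).symm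
    rw [hr, zpow_natCast]
    have e1 : W k = μ ^ (k / n) • V r := by
      conv_lhs => rw [hk]
      exact hWlt _ r hrn
    have e2 : W (k + 1) = μ ^ (k / n) • V (r + 1) := by
      have : k + 1 = n * (k / n) + ((r + 1 : ℕ) : ℤ) := by push_cast; linarith
      conv_lhs => rw [this]
      exact hWle _ (r + 1) hrn
    rw [e1, e2, Matrix.mulVec_smul, smul_comm, hVs]

lemma phase_err {n n0 : ℕ} (hn : 0 < n) (hn0 : n0 ≤ n) (k j : ℤ) (hj : |j| ≤ n0) :
    ‖S.β ^ ((k + j) % n) - S.β ^ j * S.β ^ (k % n)‖ ≤ ‖S.β ^ n - 1‖ := by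
  have hnz : (n:ℤ) ≠ 0 := by exact_mod_cast hn.ne'
  have hn' : (0:ℤ) < n := by exact_mod_cast hn
  set s := k / n - (k + j) / n with hs
  have e : (k + j) % n = j + k % n + n * s := by
    rw [Int.emod_def, Int.emod_def, hs]; ring
  have b1 := Int.emod_nonneg (k + j) hnz
  have b2 := Int.emod_lt_of_pos (k + j) hn'
  have b3 := Int.emod_nonneg k hnz
  have b4 := Int.emod_lt_of_pos k hn'
  have hj' : |j| ≤ n := hj.trans (by exact_mod_cast hn0)
  have hj1 := (abs_le.1 hj').1
  have hj2 := (abs_le.1 hj').2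
  have s1 : s < 2 := by
    by_contra! h
    have : (n:ℤ) * 2 ≤ n * s := mul_le_mul_of_nonneg_left h hn'.le
    linarith
  have s2 : -2 < s := by
    by_contra! h
    have : (n:ℤ) * s ≤ n * (-2) := mul_le_mul_of_nonneg_left h hn'.le
    linarith
  have e2 : S.β ^ ((k + j) % n) - S.β ^ j * S.β ^ (k % n) = S.β ^ j * S.β ^ (k % n) * ((S.β ^ n) ^ s - 1) := by
    rw [e, zpow_add₀ S.β_ne, zpow_add₀ S.β_ne, zpow_mul, zpow_natCast]; ring
  rw [e2, norm_mul, norm_mul, S.norm_βzpow, S.norm_βzpow, one_mul, one_mul]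
  obtain h | h | h : s = -1 ∨ s = 0 ∨ s = 1 := by omega
  · rw [h, zpow_neg_one]
    have hne : S.β ^ n ≠ 0 := pow_ne_zero _ S.β_ne
    have : (S.β ^ n)⁻¹ - 1 = -(S.β ^ n - 1) / S.β ^ n := by field_simp; ring
    rw [this, norm_div, norm_neg, S.norm_βpow, div_one]
  · rw [h]; simp
  · rw [h, zpow_one]

end Sys
end Lyap

namespace Lyap
open Real Filter Topology MeasureTheory
namespace Sys
variable {S : Sys}

/-- the conclusion of `cpt` as a property -/
def Star (S : Sys) (E : ℂ) (t γ : ℝ) (n0 : ℕ) (δ0 : ℝ) : Prop :=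
  ∀ (ζ : ℤ → ℂ) (W : ℤ → V2), W 0 ≠ 0 →
    |‖ζ 0‖ - exp t| ≤ δ0 → (∀ k : ℤ, |k| ≤ n0 → ‖ζ k - S.β ^ k * ζ 0‖ ≤ δ0) →
    (∀ k : ℤ, |k| ≤ n0 → ‖S.d (ζ k) • W (k + 1) - (S.M E (ζ k)).mulVec (W k)‖ ≤ δ0 * ‖W 0‖) →
    ∃ j : ℤ, |j| ≤ n0 ∧ exp (γ * |(j:ℝ)|) * ‖W 0‖ < ‖W j‖

lemma orb_star {E ζ : ℂ} {t γ δ0 : ℝ} {n0 n : ℕ} (hs : S.Star E t γ n0 δ0) (hδ : 0 < δ0) (hn : 0 < n) (hn0 : n0 ≤ n)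
    (hζ : |‖ζ‖ - exp t| ≤ δ0) (hβ : ‖S.β ^ n - 1‖ * ‖ζ‖ ≤ δ0) {W : ℤ → V2} (hW : ∀ k, W k ≠ 0)
    (hr : ∀ k : ℤ, S.d (S.β ^ (k % n) * ζ) • W (k + 1) = (S.M E (S.β ^ (k % n) * ζ)).mulVec (W k)) (k : ℤ) :
    ∃ j : ℤ, |j| ≤ n0 ∧ exp (γ * |(j:ℝ)|) * ‖W k‖ < ‖W (k + j)‖ := by
  have := hs (fun l => S.β ^ ((k + l) % n) * ζ) (fun l => W (k + l)) (hW _) ?_ ?_ ?_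
  · simpa using this
  · rw [norm_mul, S.norm_βzpow, one_mul]; exact hζ
  · intro l hl
    have h1 := phase_err (S := S) hn hn0 k l hl
    have : S.β ^ ((k + l) % n) * ζ - S.β ^ l * (S.β ^ ((k + 0) % n) * ζ) =
        (S.β ^ ((k + l) % n) - S.β ^ l * S.β ^ (k % n)) * ζ := by rw [add_zero]; ring
    rw [this, norm_mul]
    exact (mul_le_mul_of_nonneg_right h1 (norm_nonneg _)).trans hβ
  · intro l _
    have : k + (l + 1) = k + l + 1 := by ring
    simp only [this, hr (k + l), sub_self, norm_zero]
    positivity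

lemma orb_step {E ζ : ℂ} {t' C0 : ℝ} {n : ℕ} (ht : S.ok t') (hζ : ‖ζ‖ = exp t')
    (hC : ∀ ζ : ℂ, ‖ζ‖ = exp t' → nrm (S.M E ζ) / ‖S.d ζ‖ ≤ C0) {W : ℤ → V2}
    (hr : ∀ k : ℤ, S.d (S.β ^ (k % n) * ζ) • W (k + 1) = (S.M E (S.β ^ (k % n) * ζ)).mulVec (W k)) (k : ℤ) :
    ‖W (k + 1)‖ ≤ C0 * ‖W k‖ ∧ ‖W k‖ ≤ C0 * ‖W (k + 1)‖ := by
  have hz : ‖S.β ^ (k % n) * ζ‖ = exp t' := by rw [norm_mul, S.norm_βzpow, one_mul, hζ]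
  obtain ⟨a, b⟩ := step_bound (d_ne ht hz) (S.det_M E _) (hr k)
  have := hC _ hz
  exact ⟨a.trans (mul_le_mul_of_nonneg_right this (norm_nonneg _)),
    b.trans (mul_le_mul_of_nonneg_right this (norm_nonneg _))⟩

lemma orb_ne {C0 : ℝ} {W : ℤ → V2} (h0 : W 0 ≠ 0)
    (hs : ∀ k, ‖W (k + 1)‖ ≤ C0 * ‖W k‖ ∧ ‖W k‖ ≤ C0 * ‖W (k + 1)‖) (k : ℤ) : W k ≠ 0 := by
  induction k using Int.induction_on with
  | zero => exact h0
  | succ i ih =>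
    intro h
    have := (hs i).2
    rw [h, norm_zero, mul_zero] at this
    exact ih (norm_le_zero_iff.1 this)
  | pred i ih =>
    intro h
    have := (hs (-i - 1)).1
    rw [h, norm_zero, mul_zero, sub_add_cancel] at this
    exact ih (norm_le_zero_iff.1 this)

lemma orb_pow {C0 : ℝ} (hC0 : 0 ≤ C0) {W : ℤ → V2}
    (hs : ∀ k, ‖W (k + 1)‖ ≤ C0 * ‖W k‖) (m : ℕ) : ‖W m‖ ≤ C0 ^ m * ‖W 0‖ := by
  induction m with
  | zero => simp
  | succ m ih =>
    push_cast
    refine (hs m).trans ?_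
    rw [pow_succ', mul_assoc]
    exact mul_le_mul_of_nonneg_left ih hC0

lemma hyp_core {E ζ : ℂ} {t t' γ δ0 C0 : ℝ} {n0 n m : ℕ} (hs : S.Star E t γ n0 δ0) (hδ : 0 < δ0) (hn : 0 < n) (hn0 : n0 ≤ n)
    (hγ : 0 < γ) (ht : S.ok t') (hζ' : ‖ζ‖ = exp t') (hC01 : 1 ≤ C0)
    (hC : ∀ ζ : ℂ, ‖ζ‖ = exp t' → nrm (S.M E ζ) / ‖S.d ζ‖ ≤ C0)
    (hζ : |‖ζ‖ - exp t| ≤ δ0) (hβ : ‖S.β ^ n - 1‖ * ‖ζ‖ ≤ δ0)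
    (hn2 : 2 ≤ exp (γ * n)) (hm : 2 * (C0 * exp γ) ^ n0 ≤ exp (γ * m)) :
    nrm (S.Mn E n ζ) ≤ 64 * C0 ^ m * ‖(S.Mn E n ζ).trace‖ ∧
      exp (γ * n) * ‖S.Dn n ζ‖ ≤ 2 * ‖(S.Mn E n ζ).trace‖ := by
  set B := S.Mn E n ζ with hB
  set D := S.Dn n ζ with hD
  have hD0 : D ≠ 0 := Dn_ne ht hζ' n
  obtain ⟨ν1, ν2, h1, h2, hle⟩ : ∃ ν1 ν2 : ℂ, ν1 + ν2 = B.trace ∧ ν1 * ν2 = B.det ∧ ‖ν2‖ ≤ ‖ν1‖ := by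
    obtain ⟨ν1, ν2, h1, h2⟩ := exists_root2 B
    rcases le_total ‖ν2‖ ‖ν1‖ with h | h
    · exact ⟨ν1, ν2, h1, h2, h⟩
    · exact ⟨ν2, ν1, by rw [add_comm, h1], by rw [mul_comm, h2], h⟩
  have hdet : ν1 * ν2 = D ^ 2 := by rw [h2, hB, det_Mn]
  have hν1 : ν1 ≠ 0 := by
    intro h; rw [h, zero_mul] at hdet; exact pow_ne_zero 2 hD0 hdet.symm
  have hν2 : ν2 ≠ 0 := by
    intro h; rw [h, mul_zero] at hdet; exact pow_ne_zero 2 hD0 hdet.symm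
  obtain ⟨v, hv, hev⟩ := exists_eigvec B h1 h2
  obtain ⟨w, hw, hew⟩ := exists_eigvec B (by rw [add_comm, h1] : ν2 + ν1 = B.trace) (by rw [mul_comm, h2] : ν2 * ν1 = B.det)
  set μ1 := ν1 / D with hμ1
  set μ2 := ν2 / D with hμ2
  have hmuA : μ1 ≠ 0 := div_ne_zero hν1 hD0
  have hmuB : μ2 ≠ 0 := div_ne_zero hν2 hD0
  have e1 : μ1 * D = ν1 := by rw [hμ1]; field_simp
  have e2 : μ2 * D = ν2 := by rw [hμ2]; field_simp
  have hμ : μ1 * μ2 = 1 := by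
    rw [hμ1, hμ2, div_mul_div_comm, hdet, sq]; field_simp
  have hμnorm : ‖μ1‖ * ‖μ2‖ = 1 := by rw [← norm_mul, hμ, norm_one]
  have hmupA : 0 < ‖μ1‖ := norm_pos_iff.2 hmuA
  have hmupB : 0 < ‖μ2‖ := norm_pos_iff.2 hmuB
  have hDp : 0 < ‖D‖ := norm_pos_iff.2 hD0
  have hμle : ‖μ2‖ ≤ ‖μ1‖ := by
    rw [hμ1, hμ2, norm_div, norm_div]; gcongr
  have hμge : 1 ≤ ‖μ1‖ := by
    by_contra! h
    nlinarith
  obtain ⟨P, hP0, hPper, hPr⟩ := per_orbit (E := E) ht hζ' hn hmuA (w := v) (by rw [← hD, e1]; exact hev)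
  obtain ⟨Q, hQ0, hQper, hQr⟩ := per_orbit (E := E) ht hζ' hn hmuB (w := w) (by rw [← hD, e2]; exact hew)
  have hPs := orb_step ht hζ' hC hPr
  have hQs := orb_step ht hζ' hC hQr
  have hv0 : v ≠ 0 := by intro h; rw [h, norm_zero] at hv; norm_num at hv
  have hw0 : w ≠ 0 := by intro h; rw [h, norm_zero] at hw; norm_num at hw
  have hPn := orb_ne (by rw [hP0]; exact hv0) hPs
  have hQn := orb_ne (by rw [hQ0]; exact hw0) hQs
  have hPst := orb_star hs hδ hn hn0 hζ hβ hPn hPr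
  have hQst := orb_star hs hδ hn hn0 hζ hβ hQn hQr
  have hPx : ∀ k : ℤ, ‖P (k + n)‖ = ‖μ1‖ * ‖P k‖ := fun k => by rw [hPper, norm_smul]
  have hμbig : exp (γ * n) < ‖μ1‖ := by
    have := mult_est (x := fun k => ‖P k‖) hn (fun k => norm_pos_iff.2 (hPn k)) hmupA hPx hPst
    rw [abs_of_nonneg (log_nonneg hμge)] at this
    exact (lt_log_iff_exp_lt hmupA).1 this
  have hQx : ∀ k : ℤ, ‖Q (-(k + n))‖ = ‖μ1‖ * ‖Q (-k)‖ := fun k => by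
    have := hQper (-(k + n))
    rw [show -(k + (n:ℤ)) + n = -k by ring] at this
    rw [this, norm_smul, ← mul_assoc, hμnorm, one_mul]
  have hQst' : ∀ k : ℤ, ∃ j : ℤ, |j| ≤ n0 ∧ exp (γ * |(j:ℝ)|) * ‖Q (-k)‖ < ‖Q (-(k + j))‖ := by
    intro k
    obtain ⟨j, hj, h⟩ := hQst (-k)
    refine ⟨-j, by rwa [abs_neg], ?_⟩
    rw [Int.cast_neg, abs_neg, show -(k + -j) = -k + j by ring]; exact h
  have x1 := expand_est (x := fun k => ‖P k‖) hn (fun k => norm_pos_iff.2 (hPn k)) hγ hC01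
    (fun k => by have := (hPs (k - 1)).2; rwa [sub_add_cancel] at this) hμbig.le hPx hPst m m
  have x2 := expand_est (x := fun k => ‖Q (-k)‖) hn (fun k => norm_pos_iff.2 (hQn (-k))) hγ hC01
    (fun k => by have := (hQs (-k)).1; rwa [show -(k - 1) = -k + 1 by ring]) hμbig.le hQx hQst' 0 m
  simp only [sub_self, hP0, hv, mul_one, zero_sub, neg_neg, neg_zero, hQ0, hw] at x1 x2
  set X := (C0 * exp γ) ^ n0 with hX
  have hXp : 0 < X := by positivity
  have y1 : 2 ≤ ‖P m‖ := by
    by_contra! h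
    nlinarith
  have y2 : ‖Q m‖ ≤ 1 := by
    by_contra! h
    nlinarith
  obtain ⟨c, hc, hcd⟩ := near_par hv hw
  have hU := orb_pow (C0 := C0) (by linarith) (W := fun k => P k - c • Q k) (fun k => (orb_step ht hζ' hC (n := n) (W := fun k => P k - c • Q k)
    (fun k => by
      simp only [smul_sub, Matrix.mulVec_sub, Matrix.mulVec_smul, ← hPr, ← hQr]
      rw [smul_comm c]) k).1) m
  simp only [hP0, hQ0] at hU
  set δ := ‖v 0 * w 1 - v 1 * w 0‖ with hδd
  have hCm : 0 < C0 ^ m := by positivity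
  have z1 : 1 ≤ C0 ^ m * δ := by
    have a1 : ‖P m‖ - ‖c • Q m‖ ≤ ‖P m - c • Q m‖ := norm_sub_norm_le _ _
    rw [norm_smul] at a1
    have a2 : ‖c‖ * ‖Q m‖ ≤ 1 := by nlinarith [norm_nonneg c, norm_nonneg (Q m)]
    have a3 : C0 ^ m * ‖v - c • w‖ ≤ C0 ^ m * δ := by gcongr
    linarith
  have z2 := nrm_eig hv hw hev hew hle
  have f1 : ‖ν1‖ = ‖μ1‖ * ‖D‖ := by rw [← e1, norm_mul]
  have f2 : ‖ν2‖ = ‖μ2‖ * ‖D‖ := by rw [← e2, norm_mul]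
  have hmusB : ‖μ2‖ ≤ ‖μ1‖ / 2 := by nlinarith
  have htr : ‖ν1‖ / 2 ≤ ‖B.trace‖ := by
    have : ‖ν1‖ - ‖-ν2‖ ≤ ‖ν1 - -ν2‖ := norm_sub_norm_le _ _
    rw [sub_neg_eq_add, h1, norm_neg] at this
    have : ‖ν2‖ ≤ ‖ν1‖ / 2 := by rw [f1, f2]; nlinarith
    linarith
  constructor
  · have : nrm B ≤ C0 ^ m * δ * nrm B := le_mul_of_one_le_left (nrm_nonneg _) z1
    calc nrm B ≤ C0 ^ m * (δ * nrm B) := by rw [← mul_assoc]; exact this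
      _ ≤ C0 ^ m * (32 * ‖ν1‖) := by gcongr
      _ ≤ C0 ^ m * (32 * (2 * ‖B.trace‖)) := by gcongr; linarith
      _ = _ := by ring
  · have : exp (γ * n) * ‖D‖ ≤ ‖ν1‖ := by rw [f1]; gcongr
    linarith

lemma hyp_uniform {E : ℂ} {t γ : ℝ} (ht : S.ok t) (hγ : 0 < γ) (hb : ¬ S.Bad E t γ) :
    ∃ ε > 0, S.ok (t - ε) ∧ S.ok (t + ε) ∧ ∃ K : ℝ, 1 ≤ K ∧ ∀ N : ℕ, ∃ n, N ≤ n ∧ 0 < n ∧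
      ∀ t' ∈ Set.Icc (t - ε) (t + ε), ∀ ζ : ℂ, ‖ζ‖ = exp t' →
        nrm (S.Mn E n ζ) ≤ K * ‖(S.Mn E n ζ).trace‖ ∧
        exp (γ * n) * ‖S.Dn n ζ‖ ≤ 2 * ‖(S.Mn E n ζ).trace‖ := by
  obtain ⟨n0, δ0, hδ0, hs⟩ := cpt hb
  have hs : S.Star E t γ n0 δ0 := hs
  have hev1 : ∀ᶠ x in 𝓝 t, S.ok x := (isOpen_ok S).mem_nhds ht
  have hev2 : ∀ᶠ x in 𝓝 t, |exp x - exp t| ≤ δ0 := by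
    have := Metric.tendsto_nhds.1 (continuous_exp.tendsto t) δ0 hδ0
    filter_upwards [this] with x hx
    rw [Real.dist_eq] at hx; exact hx.le
  obtain ⟨ε', hε', hball⟩ := Metric.eventually_nhds_iff.1 (hev1.and hev2)
  set ε := ε' / 2 with hε
  have hεp : 0 < ε := by positivity
  have hin : ∀ t' ∈ Set.Icc (t - ε) (t + ε), S.ok t' ∧ |exp t' - exp t| ≤ δ0 := by
    intro t' h
    apply hball
    rw [Real.dist_eq, abs_lt]
    constructor <;> linarith [h.1, h.2]
  have hcomp : ∃ C0 : ℝ, 1 ≤ C0 ∧ ∀ t' ∈ Set.Icc (t - ε) (t + ε), ∀ ζ : ℂ, ‖ζ‖ = exp t' → nrm (S.M E ζ) / ‖S.d ζ‖ ≤ C0 := by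
    have hK : IsCompact {ζ : ℂ | exp (t - ε) ≤ ‖ζ‖ ∧ ‖ζ‖ ≤ exp (t + ε)} := by
      apply (isCompact_closedBall (0:ℂ) (exp (t + ε))).of_isClosed_subset
      · exact (isClosed_le continuous_const continuous_norm).inter (isClosed_le continuous_norm continuous_const)
      · intro ζ hζ; simpa using hζ.2
    have hcont : ContinuousOn (fun ζ => nrm (S.M E ζ) / ‖S.d ζ‖) {ζ : ℂ | exp (t - ε) ≤ ‖ζ‖ ∧ ‖ζ‖ ≤ exp (t + ε)} := by
      apply ContinuousOn.div
      · exact (continuous_nrm.comp ((S.continuous_M2).comp (by fun_prop : Continuous fun ζ : ℂ => (E, ζ)))).continuousOn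
      · exact S.continuous_d.norm.continuousOn
      · intro ζ hζ
        have hp : 0 < ‖ζ‖ := (exp_pos _).trans_le hζ.1
        have h1 : t - ε ≤ log ‖ζ‖ := (le_log_iff_exp_le hp).2 hζ.1
        have h2 : log ‖ζ‖ ≤ t + ε := (log_le_iff_le_exp hp).2 hζ.2
        exact norm_ne_zero_iff.2 (d_ne (hin _ ⟨h1, h2⟩).1 (exp_log hp).symm)
    obtain ⟨C, hC⟩ := hK.bddAbove_image hcont
    refine ⟨max C 1, le_max_right _ _, ?_⟩
    intro t' ht' ζ hζ
    refine le_trans (hC ⟨ζ, ⟨?_, ?_⟩, rfl⟩) (le_max_left _ _)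
    · rw [hζ]; exact exp_le_exp.2 ht'.1
    · rw [hζ]; exact exp_le_exp.2 ht'.2
  obtain ⟨C0, hC01, hC0⟩ := hcomp
  have hbig : ∀ y : ℝ, ∃ m : ℕ, ∀ n ≥ m, y ≤ exp (γ * n) := by
    intro y
    have : Tendsto (fun n : ℕ => exp (γ * n)) atTop atTop :=
      tendsto_exp_atTop.comp (tendsto_natCast_atTop_atTop.const_mul_atTop hγ)
    exact eventually_atTop.1 (this.eventually_ge_atTop y)
  obtain ⟨m, hm⟩ := hbig (2 * (C0 * exp γ) ^ n0)
  obtain ⟨m2, hm2⟩ := hbig 2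
  refine ⟨ε, hεp, (hin _ ⟨le_rfl, by linarith⟩).1, (hin _ ⟨by linarith, le_rfl⟩).1, 64 * C0 ^ m, ?_, ?_⟩
  · have := one_le_pow₀ hC01 (n := m)
    linarith
  intro N
  obtain ⟨n, hnN, hn, hβ⟩ := recur S.norm_β (ε := δ0 / exp (t + ε)) (by positivity) (max N (max n0 m2))
  refine ⟨n, (le_max_left _ _).trans hnN, hn, ?_⟩
  intro t' ht' ζ hζ
  have hmx := le_max_right N (max n0 m2)
  refine hyp_core hs hδ0 hn ((le_max_left n0 m2).trans (hmx.trans hnN)) hγ (hin t' ht').1 hζ hC01 (hC0 t' ht') ?_ ?_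
    (hm2 n ((le_max_right n0 m2).trans (hmx.trans hnN))) (hm m le_rfl)
  · rw [hζ]; exact (hin t' ht').2
  · rw [hζ]
    calc _ ≤ δ0 / exp (t + ε) * exp (t + ε) := by
          have := exp_le_exp.2 ht'.2
          gcongr
      _ = δ0 := by field_simp

end Sys
end Lyap

namespace Lyap
open Real Filter Topology MeasureTheory

lemma jen_affine {m : ℕ} (c : ℂ) (z : Fin m → ℂ) {l r t1 s t2 : ℝ} (hl : l ≤ t1) (h1 : t1 ≤ s) (h2 : s ≤ t2) (hr : t2 ≤ r)
    (hz : ∀ i, ‖z i‖ < exp l ∨ exp r < ‖z i‖) :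
    (t2 - s) * jen c z t1 + (s - t1) * jen c z t2 = (t2 - t1) * jen c z s := by
  have key : ∀ i, (t2 - s) * log (max (exp t1) ‖z i‖) + (s - t1) * log (max (exp t2) ‖z i‖) =
      (t2 - t1) * log (max (exp s) ‖z i‖) := by
    intro i
    rcases hz i with h | h
    · have g : ∀ x, l ≤ x → log (max (exp x) ‖z i‖) = x := by
        intro x hx
        rw [max_eq_left (h.le.trans (exp_le_exp.2 hx)), log_exp]
      rw [g _ hl, g _ (hl.trans h1), g _ (hl.trans (h1.trans h2))]; ring
    · have g : ∀ x, x ≤ r → log (max (exp x) ‖z i‖) = log ‖z i‖ := by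
        intro x hx
        rw [max_eq_right ((exp_le_exp.2 hx).trans h.le)]
      rw [g _ hr, g _ (h2.trans hr), g _ (h1.trans (h2.trans hr))]; ring
  unfold jen
  have : ∑ i, ((t2 - s) * log (max (exp t1) ‖z i‖) + (s - t1) * log (max (exp t2) ‖z i‖)) =
      ∑ i, (t2 - t1) * log (max (exp s) ‖z i‖) := Finset.sum_congr rfl fun i _ => key i
  rw [Finset.sum_add_distrib, ← Finset.mul_sum, ← Finset.mul_sum, ← Finset.mul_sum] at this
  linear_combination this

lemma trace_le_nrm (A : Matrix (Fin 2) (Fin 2) ℂ) : ‖A.trace‖ ≤ nrm A := by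
  rw [Matrix.trace_fin_two]
  refine (norm_add_le _ _).trans ?_
  unfold nrm
  linarith [norm_nonneg (A 0 1), norm_nonneg (A 1 0)]

namespace Sys
variable {S : Sys}
open Polynomial in
lemma affine {E : ℂ} {t γ : ℝ} (ht : S.ok t) (hγ : 0 < γ) (hb : ¬ S.Bad E t γ) :
    γ ≤ S.F E t - S.κ - t ∧ ∃ ε > 0, S.ok (t - ε) ∧ S.ok (t + ε) ∧
      ∀ t1 s t2, t - ε ≤ t1 → t1 ≤ s → s ≤ t2 → t2 ≤ t + ε →
        (t2 - s) * S.F E t1 + (s - t1) * S.F E t2 ≤ (t2 - t1) * S.F E s := by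
  obtain ⟨ε, hε, hok1, hok2, K, hK, hN⟩ := hyp_uniform ht hγ hb
  have hok : ∀ x, t - ε ≤ x → x ≤ t + ε → S.ok x := fun x h1 h2 => hok1.conv hok2 h1 h2
  -- for such n, summary of estimates
  have main : ∀ N : ℕ, ∃ n, N ≤ n ∧ 0 < n ∧ ∃ T : ℝ → ℝ,
      (∀ x, t - ε ≤ x → x ≤ t + ε → T x ≤ S.a E x n ∧ S.a E x n ≤ T x + log K ∧ n * (S.κ + x) + γ * n - log 2 ≤ T x) ∧
      ∀ t1 s t2, t - ε ≤ t1 → t1 ≤ s → s ≤ t2 → t2 ≤ t + ε →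
        (t2 - s) * T t1 + (s - t1) * T t2 = (t2 - t1) * T s := by
    intro N
    obtain ⟨n, hn, hn0, hest⟩ := hN N
    obtain ⟨q0, _, hq0⟩ := S.Mn_poly E n 0 0
    obtain ⟨q1, _, hq1⟩ := S.Mn_poly E n 1 1
    have htr : ∀ ζ, (q0 + q1).eval ζ = (S.Mn E n ζ).trace := by
      intro ζ; rw [eval_add, hq0, hq1, Matrix.trace_fin_two]
    have hne : ∀ x, t - ε ≤ x → x ≤ t + ε → ∀ ζ : ℂ, ‖ζ‖ = exp x → 0 < ‖(S.Mn E n ζ).trace‖ := by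
      intro x h1 h2 ζ hζ
      have := (hest x ⟨h1, h2⟩ ζ hζ).2
      have h3 : 0 < ‖S.Dn n ζ‖ := norm_pos_iff.2 (Dn_ne (hok x h1 h2) hζ n)
      have : 0 < exp (γ * n) * ‖S.Dn n ζ‖ := by positivity
      linarith
    have hp : q0 + q1 ≠ 0 := by
      intro h
      have := hne t (by linarith) (by linarith) (exp t : ℝ) (by rw [Complex.norm_real, norm_eq_abs, abs_of_pos (exp_pos t)])
      rw [← htr, h] at this
      simp at this
    obtain ⟨c, z, hc, hfac⟩ := poly_factor hp
    have hz : ∀ i, ‖z i‖ < exp (t - ε) ∨ exp (t + ε) < ‖z i‖ := by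
      intro i
      by_contra! h
      have hpz : 0 < ‖z i‖ := (exp_pos _).trans_le h.1
      have := hne (log ‖z i‖) ((le_log_iff_exp_le hpz).2 h.1) ((log_le_iff_le_exp hpz).2 h.2) (z i) (exp_log hpz).symm
      rw [← htr, hfac, Finset.prod_eq_zero (Finset.mem_univ i) (sub_self _)] at this
      simp at this
    refine ⟨n, hn, hn0, jen c z, ?_, ?_⟩
    · intro x h1 h2
      have hx := hok x h1 h2
      have hT : jen c z x = CA (fun ζ => log ‖(S.Mn E n ζ).trace‖) x := by
        rw [← CA_jen hc]
        simp only [← hfac, htr]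
      have hIntg : CircleIntegrable (fun ζ => log ‖(S.Mn E n ζ).trace‖) 0 (exp x) := by
        apply CA_integrable
        apply ContinuousOn.log
        · exact ((S.continuous_Mn E n).matrix_trace).norm.continuousOn
        · intro ζ hζ; exact (hne x h1 h2 ζ hζ).ne'
      have hci : ∀ y : ℝ, CircleIntegrable (fun _ : ℂ => y) 0 (exp x) := fun y => CA_integrable continuousOn_const
      refine ⟨?_, ?_, ?_⟩
      · rw [hT]
        exact CA_mono hIntg (int_log_nrm hx E n) fun ζ hζ => log_le_log (hne x h1 h2 ζ hζ) (trace_le_nrm _)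
      · rw [hT, ← CA_const (log K) x, ← CA_add hIntg (hci _)]
        refine CA_mono (int_log_nrm hx E n) (hIntg.add (hci _)) fun ζ hζ => ?_
        rw [← log_mul (hne x h1 h2 ζ hζ).ne' (by positivity)]
        apply log_le_log (nrm_Mn_pos hx hζ E n)
        rw [mul_comm]; exact (hest x ⟨h1, h2⟩ ζ hζ).1
      · rw [hT, ← CA_log_Dn hx, add_sub_assoc, ← CA_const (γ * n - log 2) x, ← CA_add (int_log_Dn hx n) (hci _)]
        refine CA_mono ((int_log_Dn hx n).add (hci _)) hIntg fun ζ hζ => ?_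
        have hD : 0 < ‖S.Dn n ζ‖ := norm_pos_iff.2 (Dn_ne hx hζ n)
        have h3 := (hest x ⟨h1, h2⟩ ζ hζ).2
        have := log_le_log (by positivity) h3
        rw [log_mul (exp_pos _).ne' hD.ne', log_exp, log_mul (by norm_num) (hne x h1 h2 ζ hζ).ne'] at this
        linarith
    · intro t1 s t2 a1 a2 a3 a4
      exact jen_affine c z a1 a2 a3 a4 hz
  refine ⟨?_, ε, hε, hok1, hok2, ?_⟩
  · have hlim := Fn_tendsto_sub ht E (-log 2)
    have : S.κ + t + γ ≤ S.F E t := by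
      refine ge_of_tendsto_of_frequently hlim ?_
      rw [frequently_atTop]
      intro N
      obtain ⟨n, hn, hn0, T, hT, _⟩ := main N
      refine ⟨n, hn, ?_⟩
      obtain ⟨b1, b2, b3⟩ := hT t (by linarith) (by linarith)
      rw [le_div_iff₀ (by exact_mod_cast hn0)]
      linarith
    linarith
  · intro t1 s t2 a1 a2 a3 a4
    have hs := hok s (by linarith) (by linarith)
    have hlim := (Fn_tendsto_sub hs E (-log K)).const_mul (t2 - t1)
    refine ge_of_tendsto_of_frequently hlim ?_
    rw [frequently_atTop]
    intro N
    obtain ⟨n, hn, hn0, T, hT, hA⟩ := main N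
    refine ⟨n, hn, ?_⟩
    have hnr : (0:ℝ) < n := by exact_mod_cast hn0
    have b1 := (hT t1 (by linarith) (by linarith)).2.1
    have b2 := (hT t2 (by linarith) (by linarith)).2.1
    have b3 := (hT s (by linarith) (by linarith)).1
    have c1 := F_le (hok t1 (by linarith) (by linarith)) E hn0.ne'
    have c2 := F_le (hok t2 (by linarith) (by linarith)) E hn0.ne'
    rw [le_div_iff₀ hnr] at c1 c2
    have e := hA t1 s t2 a1 a2 a3 a4
    rw [← mul_div_assoc, le_div_iff₀ hnr]
    have d1 : (t2 - s) * (S.F E t1 * n) ≤ (t2 - s) * (T t1 + log K) :=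
      mul_le_mul_of_nonneg_left (c1.trans b1) (by linarith)
    have d2 : (s - t1) * (S.F E t2 * n) ≤ (s - t1) * (T t2 + log K) :=
      mul_le_mul_of_nonneg_left (c2.trans b2) (by linarith)
    have d3 : (t2 - t1) * T s ≤ (t2 - t1) * S.a E s n := mul_le_mul_of_nonneg_left b3 (by linarith)
    linarith

lemma Mn_zero_pt (E : ℂ) (m : ℕ) : S.Mn E m 0 = S.M E 0 ^ m := by
  induction m with
  | zero => simp [Mn_zero]
  | succ m ih => rw [Mn_succ, ih, mul_zero, pow_succ']

lemma Mn_mul_bound {E : ℂ} {m : ℕ} {B r : ℝ} (h : ∀ ζ : ℂ, ‖ζ‖ ≤ r → nrm (S.Mn E m ζ) ≤ B)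
    (k : ℕ) : ∀ ζ : ℂ, ‖ζ‖ ≤ r → nrm (S.Mn E (k * m) ζ) ≤ 2 * B ^ k := by
  induction k with
  | zero => intro ζ _; simp [Mn_zero, nrm_one]
  | succ k ih =>
    intro ζ hζ
    rw [show (k + 1) * m = m + k * m by ring, Mn_add]
    refine (nrm_mul_le _ _).trans ?_
    have h1 := h (S.β ^ (k * m) * ζ) (by rw [norm_mul, S.norm_βpow, one_mul]; exact hζ)
    have h2 := ih ζ hζ
    have := (nrm_nonneg _).trans h1
    calc _ ≤ B * (2 * B ^ k) := mul_le_mul h1 h2 (nrm_nonneg _) this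
      _ = _ := by ring

lemma jen_le_of_bound {m : ℕ} {c : ℂ} (hc : c ≠ 0) (z : Fin m → ℂ) {r B : ℝ}
    (h : ∀ ζ : ℂ, ‖ζ‖ ≤ exp r → ‖c * ∏ i, (ζ - z i)‖ ≤ exp B) : ∃ t', r - 1 ≤ t' ∧ t' ≤ r ∧ jen c z t' ≤ B := by
  have hinf : (Set.Icc (r - 1) r).Infinite := Set.Icc_infinite (by linarith)
  obtain ⟨t', ht', hn⟩ := hinf.exists_notMem_finite (Set.finite_range fun i => log ‖z i‖)
  refine ⟨t', ht'.1, ht'.2, ?_⟩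
  have hne : ∀ ζ : ℂ, ‖ζ‖ = exp t' → c * ∏ i, (ζ - z i) ≠ 0 := by
    intro ζ hζ
    refine mul_ne_zero hc (Finset.prod_ne_zero_iff.2 fun i _ hi => hn ⟨i, ?_⟩)
    simp only
    rw [← sub_eq_zero.1 hi, hζ, log_exp]
  rw [← CA_jen hc]
  apply CA_le_const
  · apply CA_integrable
    apply ContinuousOn.log
    · fun_prop
    · intro ζ hζ; exact norm_ne_zero_iff.2 (hne ζ hζ)
  · intro ζ hζ
    rw [log_le_iff_le_exp (norm_pos_iff.2 (hne ζ hζ))]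
    exact h ζ (by rw [hζ]; exact exp_le_exp.2 ht'.2)

lemma slope0 {E : ℂ} {t1 t2 γ : ℝ} (h1 : S.ok t1) (h2 : S.ok t2) (h12 : t1 < t2) (hF : S.F E t2 ≤ S.F E t1)
    {m : ℕ} (hm : 0 < m) (hg : nrm (S.M E 0 ^ m) < exp (m * γ)) : S.F E t1 ≤ γ := by
  obtain ⟨r, hr1, hr⟩ : ∃ r : ℝ, r ≤ t1 - 1 ∧ ∀ ζ : ℂ, ‖ζ‖ ≤ exp r → nrm (S.Mn E m ζ) ≤ exp (m * γ) := by
    have hc : Continuous (fun ζ => nrm (S.Mn E m ζ)) := continuous_nrm.comp (S.continuous_Mn E m)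
    have : ∀ᶠ ζ in 𝓝 (0:ℂ), nrm (S.Mn E m ζ) < exp (m * γ) := by
      apply (hc.tendsto 0).eventually_lt_const
      rw [Mn_zero_pt]; exact hg
    obtain ⟨ε, hε, hball⟩ := Metric.eventually_nhds_iff.1 this
    refine ⟨min (t1 - 1) (log (ε / 2)), min_le_left _ _, fun ζ hζ => (hball ?_).le⟩
    rw [dist_zero_right]
    have : exp (min (t1 - 1) (log (ε / 2))) ≤ ε / 2 := by
      calc _ ≤ exp (log (ε / 2)) := exp_le_exp.2 (min_le_right _ _)
        _ = _ := exp_log (by positivity)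
    linarith
  by_contra! hcon
  set R := t1 - r + 1 with hR
  have hRp : 0 < R := by rw [hR]; linarith
  set C := log 12 + log 2 with hC
  -- subsequence k*m
  have hsub : Tendsto (fun k : ℕ => k * m) atTop atTop := tendsto_id.atTop_mul_const' hm
  have l1 := (Fn_tendsto_sub h1 E C).comp hsub
  have l1b := (Fn_tendsto_sub h1 E (log 12)).comp hsub
  have l2 := (F_tendsto h2 E).comp hsub
  have key : S.F E t1 + (t2 - t1) / R * (S.F E t1 - γ) ≤ S.F E t2 := by
    refine le_of_tendsto_of_tendsto (l1b.add ((l1.sub_const γ).const_mul ((t2 - t1) / R))) l2 ?_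
    have hpos : ∀ᶠ k : ℕ in atTop, γ < ((fun n : ℕ => (S.a E t1 n - C) / n) ∘ fun k => k * m) k :=
      l1.eventually_const_lt hcon
    filter_upwards [eventually_gt_atTop 0, hpos] with k hk hpk
    simp only [Function.comp] at hpk ⊢
    set n := k * m with hn
    have hn0 : 0 < n := Nat.mul_pos hk hm
    have hnr : (0:ℝ) < n := by exact_mod_cast hn0
    obtain ⟨d, c, z, hd, hc, hle, hopt⟩ := exists_h h1 E n
    obtain ⟨t', ht1, ht2, hj⟩ := jen_le_of_bound hc z (r := r) (B := n * γ + log 2) (by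
      intro ζ hζ
      refine (hle ζ).trans ((Mn_mul_bound hr k ζ hζ).trans (le_of_eq ?_))
      rw [exp_add, exp_log (by norm_num), ← exp_nat_mul, hn]
      push_cast
      rw [show (k:ℝ) * (m * γ) = k * m * γ by ring]; ring)
    have hj2 := jen_le_a h2 hc hle
    have hconv := (jen_convex c z).slope_mono_adjacent (x := t') (y := t1) (z := t2) (Set.mem_univ _) (Set.mem_univ _) (by linarith) h12
    rw [lt_div_iff₀ hnr] at hpk
    rw [div_le_div_iff₀ (by linarith) (by linarith)] at hconv
    have q1 : (S.a E t1 n - log 12 - n * γ - log 2) * (t2 - t1) ≤ (jen c z t1 - jen c z t') * (t2 - t1) :=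
      mul_le_mul_of_nonneg_right (by linarith) (by linarith)
    have q0 : 0 ≤ jen c z t2 - jen c z t1 := sub_nonneg.2 (jen_mono c z h12.le)
    have q2 : (jen c z t2 - jen c z t1) * (t1 - t') ≤ (jen c z t2 - jen c z t1) * R :=
      mul_le_mul_of_nonneg_left (by rw [hR]; linarith) q0
    have q3 : (S.a E t1 n - log 12 - n * γ - log 2) * (t2 - t1) / R ≤ jen c z t2 - jen c z t1 := by
      rw [div_le_iff₀ hRp]; linarith
    have e : (S.a E t1 n - log 12) / n + (t2 - t1) / R * ((S.a E t1 n - C) / n - γ) =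
        (S.a E t1 n - log 12 + (S.a E t1 n - log 12 - n * γ - log 2) * (t2 - t1) / R) / n := by
      rw [hC]; field_simp; ring
    rw [e]
    gcongr
    linarith
  have : 0 < (t2 - t1) / R * (S.F E t1 - γ) := mul_pos (div_pos (by linarith) hRp) (by linarith)
  linarith

end Sys
end Lyap

namespace Lyap
open Real Filter Topology MeasureTheory

lemma circ_sq {ζ : ℂ} (h : ‖ζ‖ = 1) : ζ ^ 2 + 1 = 2 * (ζ.re : ℂ) * ζ := by
  have h1 : ζ * (starRingEnd ℂ) ζ = 1 := by
    rw [Complex.mul_conj, Complex.normSq_eq_norm_sq, h]; norm_num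
  have h2 : ζ + (starRingEnd ℂ) ζ = 2 * (ζ.re : ℂ) := by
    rw [Complex.add_conj]; push_cast; ring
  rw [← h2, ← h1]; ring

/-- growth for nonreal energies -/
lemma nonreal_growth {u : ℤ → ℂ} {v : ℤ → ℝ} {E : ℂ} {γ C : ℝ}
    (hrec : ∀ k, u (k + 1) + u (k - 1) = (E - v k) * u k) (hbd : ∀ k : ℤ, ‖u k‖ ≤ exp (γ * |(k:ℝ)|) * C)
    (hγ0 : 0 ≤ γ) (hγ : exp (4 * γ) < 1 + 2 * |E.im|) : u 0 = 0 ∧ u (-1) = 0 := by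
  set J : ℤ → ℝ := fun k => (u (k + 1) * (starRingEnd ℂ) (u k)).im with hJ
  have hJs : ∀ k, J k - J (k - 1) = E.im * ‖u k‖ ^ 2 := by
    intro k
    have h1 := congrArg (fun w => (w * (starRingEnd ℂ) (u k)).im) (hrec k)
    simp only [hJ, sub_add_cancel]
    have e : ‖u k‖ ^ 2 = (u k).re ^ 2 + (u k).im ^ 2 := by
      rw [← Complex.normSq_eq_norm_sq, Complex.normSq_apply]; ring
    rw [e]
    simp only [Complex.mul_im, Complex.mul_re, Complex.add_re, Complex.add_im, Complex.conj_re, Complex.conj_im,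
      Complex.sub_re, Complex.sub_im, Complex.ofReal_re, Complex.ofReal_im] at h1 ⊢
    linear_combination h1
  have hJb : ∀ k, |J k| ≤ (‖u (k + 1)‖ ^ 2 + ‖u k‖ ^ 2) / 2 := by
    intro k
    have := Complex.abs_im_le_norm (u (k + 1) * (starRingEnd ℂ) (u k))
    rw [norm_mul, RCLike.norm_conj] at this
    simp only [hJ]
    nlinarith [sq_nonneg (‖u (k + 1)‖ - ‖u k‖)]
  set s : ℕ → ℝ := fun n => ‖u 0‖ ^ 2 + ∑ i ∈ Finset.range n, (‖u (i + 1)‖ ^ 2 + ‖u (-i - 1)‖ ^ 2) with hs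
  have hs1 : ∀ n : ℕ, s (n + 1) = s n + (‖u (n + 1)‖ ^ 2 + ‖u (-n - 1)‖ ^ 2) := by
    intro n; simp only [hs]; rw [Finset.sum_range_succ]; ring
  have hsp : ∀ n, 0 ≤ s n := fun n => by simp only [hs]; positivity
  have htel : ∀ n : ℕ, J n - J (-n - 1) = E.im * s n := by
    intro n
    induction n with
    | zero => have := hJs 0; simpa [hs] using this
    | succ n ih =>
      have a := hJs (n + 1)
      have b := hJs (-n - 1)
      rw [hs1]
      push_cast
      rw [add_sub_cancel_right] at a
      rw [show (-(n + 1 : ℤ) - 1) = -n - 1 - 1 by ring]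
      linear_combination ih + a + b
  have hgrow : ∀ n : ℕ, (1 + 2 * |E.im|) * s n ≤ s (n + 2) := by
    intro n
    have h1 := htel (n + 1)
    have h2 : |E.im| * s (n + 1) = |J ((n + 1 : ℕ) : ℤ) - J (-((n + 1 : ℕ) : ℤ) - 1)| := by
      rw [h1, abs_mul, abs_of_nonneg (hsp _)]
    have h3 := abs_sub (J ((n + 1 : ℕ) : ℤ)) (J (-((n + 1 : ℕ) : ℤ) - 1))
    have h4 := hJb ((n + 1 : ℕ) : ℤ)
    have h5 := hJb (-((n + 1 : ℕ) : ℤ) - 1)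
    rw [sub_add_cancel] at h5
    have h6 := hs1 (n + 1)
    have h7 := hs1 n
    rw [← h2] at h3
    have h8 : s n ≤ s (n + 1) := by rw [h7]; linarith [sq_nonneg ‖u (n + 1)‖, sq_nonneg ‖u (-n - 1)‖]
    have h9 : |E.im| * s n ≤ |E.im| * s (n + 1) := mul_le_mul_of_nonneg_left h8 (abs_nonneg _)
    have e1 : (((n + 1 : ℕ) : ℤ)) = (n:ℤ) + 1 := by push_cast; ring
    have e2 : (-((n:ℤ) + 1)) = -n - 1 := by ring
    simp only [e1, e2] at h3 h4 h5 h6 h7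
    change s (n + 1 + 1) = _ at h6
    change _ ≤ s (n + 1 + 1)
    linarith
  have hlow : ∀ n : ℕ, (1 + 2 * |E.im|) ^ n * s 1 ≤ s (2 * n + 1) := by
    intro n
    induction n with
    | zero => simp
    | succ n ih =>
      have := hgrow (2 * n + 1)
      rw [show 2 * (n + 1) + 1 = 2 * n + 1 + 2 by ring, pow_succ']
      have hp : 0 < 1 + 2 * |E.im| := by positivity
      calc _ = (1 + 2 * |E.im|) * ((1 + 2 * |E.im|) ^ n * s 1) := by ring
        _ ≤ (1 + 2 * |E.im|) * s (2 * n + 1) := by gcongr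
        _ ≤ _ := this
  have hC : 0 ≤ C := by have := (norm_nonneg _).trans (hbd 0); simpa using this
  have hup : ∀ n : ℕ, s n ≤ (2 * n + 1) * (exp (γ * n) * C) ^ 2 := by
    intro n
    have hk : ∀ k : ℤ, |(k:ℝ)| ≤ n → ‖u k‖ ^ 2 ≤ (exp (γ * n) * C) ^ 2 := by
      intro k hk
      have : exp (γ * |(k:ℝ)|) ≤ exp (γ * n) := exp_le_exp.2 (mul_le_mul_of_nonneg_left hk hγ0)
      exact pow_le_pow_left₀ (norm_nonneg _) ((hbd k).trans (mul_le_mul_of_nonneg_right this hC)) 2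
    have h0 := hk 0 (by simp)
    have hsum : ∑ i ∈ Finset.range n, (‖u (i + 1)‖ ^ 2 + ‖u (-i - 1)‖ ^ 2) ≤ ∑ i ∈ Finset.range n, 2 * (exp (γ * n) * C) ^ 2 := by
      apply Finset.sum_le_sum
      intro i hi
      have hi' : (i:ℝ) + 1 ≤ n := by exact_mod_cast Finset.mem_range.1 hi
      have a := hk (i + 1) (by push_cast; rw [abs_of_nonneg (by positivity)]; exact hi')
      have b := hk (-i - 1) (by push_cast; rw [show -(i:ℝ) - 1 = -(i + 1) by ring, abs_neg, abs_of_nonneg (by positivity)]; exact hi')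
      linarith
    rw [Finset.sum_const, Finset.card_range, nsmul_eq_mul] at hsum
    simp only [hs]
    linarith
  have hs10 : s 1 ≤ 0 := by
    set p := 1 + 2 * |E.im| with hp
    have hpp : 0 < p := by positivity
    set q := exp (4 * γ) / p with hq
    have hq1 : q < 1 := by rw [hq, div_lt_one hpp]; exact hγ
    have hq0 : 0 ≤ q := by positivity
    have hlim : Tendsto (fun n : ℕ => (4 * ((n:ℝ) * q ^ n) + 3 * q ^ n) * (exp (2 * γ) * C ^ 2)) atTop (𝓝 0) := by
      have a := tendsto_self_mul_const_pow_of_lt_one hq0 hq1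
      have b := tendsto_pow_atTop_nhds_zero_of_lt_one hq0 hq1
      have := ((a.const_mul 4).add (b.const_mul 3)).mul_const (exp (2 * γ) * C ^ 2)
      simpa using this
    refine ge_of_tendsto hlim ?_
    filter_upwards with n
    have h1 := (hlow n).trans (hup (2 * n + 1))
    have hpn : 0 < p ^ n := by positivity
    have e : (2 * ((2 * n + 1 : ℕ) : ℝ) + 1) * (exp (γ * ((2 * n + 1 : ℕ) : ℝ)) * C) ^ 2 =
        p ^ n * ((4 * ((n:ℝ) * q ^ n) + 3 * q ^ n) * (exp (2 * γ) * C ^ 2)) := by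
      have e1 : exp (γ * ((2 * n + 1 : ℕ) : ℝ)) ^ 2 = exp (4 * γ) ^ n * exp (2 * γ) := by
        rw [← exp_nat_mul, ← exp_nat_mul, ← exp_add]; congr 1; push_cast; ring
      have e2 : p ^ n * q ^ n = exp (4 * γ) ^ n := by
        rw [← mul_pow, hq, mul_div_cancel₀ _ hpp.ne']
      rw [mul_pow, e1, ← e2]; push_cast; ring
    rw [e] at h1
    exact le_of_mul_le_mul_left h1 hpn
  have : s 1 = ‖u 0‖ ^ 2 + (‖u 1‖ ^ 2 + ‖u (-1)‖ ^ 2) := by simp [hs]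
  rw [this] at hs10
  have a1 := sq_nonneg ‖u 0‖
  have a2 := sq_nonneg ‖u 1‖
  have a3 := sq_nonneg ‖u (-1)‖
  exact ⟨norm_eq_zero.1 (pow_eq_zero_iff (two_ne_zero) |>.1 (by linarith)),
    norm_eq_zero.1 (pow_eq_zero_iff (two_ne_zero) |>.1 (by linarith))⟩

namespace Sys
variable {S : Sys}

/-- the potential on the circle -/
noncomputable def vv (S : Sys) (ζ : ℂ) : ℝ := 2 * S.lam * ζ.re / (1 - S.α * ζ.re)

lemma vv_den {ζ : ℂ} (h : ‖ζ‖ = 1) : 0 < 1 - S.α * ζ.re := by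
  have h1 := Complex.abs_re_le_norm ζ
  rw [h] at h1
  have h2 := S.hα
  have h3 : |S.α * ζ.re| < 1 := by
    rw [abs_mul]; nlinarith [abs_nonneg S.α, abs_nonneg ζ.re]
  linarith [le_abs_self (S.α * ζ.re)]

lemma d_circ {ζ : ℂ} (h : ‖ζ‖ = 1) : S.d ζ = ζ * ((1 - S.α * ζ.re : ℝ) : ℂ) := by
  unfold d; rw [circ_sq h]; push_cast; ring

lemma M_circ (E : ℂ) {ζ : ℂ} (h : ‖ζ‖ = 1) : S.M E ζ = S.d ζ • !![E - S.vv ζ, -1; 1, 0] := by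
  have h0 := (vv_den (S := S) h).ne'
  have e : (S.lam : ℂ) * (ζ ^ 2 + 1) = S.d ζ * (S.vv ζ : ℂ) := by
    rw [circ_sq h, d_circ h, mul_assoc ζ, ← Complex.ofReal_mul]
    have : (1 - S.α * ζ.re) * S.vv ζ = 2 * S.lam * ζ.re := by
      unfold vv; field_simp
    rw [this]; push_cast; ring
  unfold M
  rw [e]
  ext i j
  fin_cases i <;> fin_cases j <;> simp
  ring

lemma not_Bad_nonreal {E : ℂ} {γ : ℝ} (hγ0 : 0 ≤ γ) (hγ : exp (4 * γ) < 1 + 2 * |E.im|) : ¬ S.Bad E 0 γ := by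
  rintro ⟨ζ, hζ, W, hW0, hrec, hbd⟩
  rw [exp_zero] at hζ
  have hz : ∀ k : ℤ, ‖S.β ^ k * ζ‖ = 1 := fun k => by rw [norm_mul, S.norm_βzpow, one_mul, hζ]
  have hstep : ∀ k : ℤ, W (k + 1) = (!![E - S.vv (S.β ^ k * ζ), -1; 1, 0]).mulVec (W k) := by
    intro k
    have h := hrec k
    rw [M_circ E (hz k), Matrix.smul_mulVec] at h
    exact smul_right_injective _ (d_ne (S.ok_zero) (by rw [hz k, exp_zero])) h
  have h1 : ∀ k, W (k + 1) 1 = W k 0 := by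
    intro k; rw [hstep]; simp [Matrix.mulVec, dotProduct, Fin.sum_univ_two]
  have h0 : ∀ k, W (k + 1) 0 = (E - S.vv (S.β ^ k * ζ)) * W k 0 - W k 1 := by
    intro k; rw [hstep]; simp [Matrix.mulVec, dotProduct, Fin.sum_univ_two]; ring
  obtain ⟨a, b⟩ := nonreal_growth (u := fun k => W k 0) (v := fun k => S.vv (S.β ^ k * ζ)) (E := E) (γ := γ) (C := ‖W 0‖)
    (fun k => by
      have := h1 (k - 1)
      rw [sub_add_cancel] at this
      rw [h0, ← this]; ring)
    (fun k => (norm_le_pi_norm _ _).trans (hbd k)) hγ0 hγ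
  apply hW0
  ext i
  fin_cases i
  · exact a
  · have := h1 (-1)
    simp only [neg_add_cancel] at this
    exact this.trans b

lemma F_lip {t1 t2 : ℝ} (h1 : S.ok t1) (h2 : S.ok t2) (E : ℂ) : |S.F E t2 - S.F E t1| ≤ 2 * |t2 - t1| := by
  rcases le_total t1 t2 with h | h
  · have a := F_mono h1 h2 h E
    have b := F_slope h1 h2 h E
    rw [abs_of_nonneg (by linarith), abs_of_nonneg (by linarith)]; linarith
  · have a := F_mono h2 h1 h E
    have b := F_slope h2 h1 h E
    rw [abs_of_nonpos (by linarith), abs_of_nonpos (by linarith)]; linarith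

lemma Zlem {E : ℂ} (hE : E.im ≠ 0) {t : ℝ} (ht : S.ok t) (ht0 : t ≤ 0) {m : ℕ} {γ : ℝ} (hm : 0 < m)
    (hg : nrm (S.M E 0 ^ m) < exp (m * γ)) : S.F E t ≤ max γ (S.F E 0 + t) := by
  obtain ⟨γ0, hγ0, hγ1⟩ : ∃ γ0 > 0, exp (4 * γ0) < 1 + 2 * |E.im| := by
    have hp : 0 < |E.im| := abs_pos.2 hE
    have : 0 < log (1 + 2 * |E.im|) := log_pos (by linarith)
    refine ⟨log (1 + 2 * |E.im|) / 8, by positivity, ?_⟩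
    rw [← lt_log_iff_exp_lt (by positivity)]; linarith
  have hok : ∀ x, t ≤ x → x ≤ 0 → S.ok x := fun x h1 h2 => ht.conv S.ok_zero h1 h2
  obtain ⟨hL, ε, hε, hε1, hε2, haff⟩ := affine S.ok_zero hγ0 (not_Bad_nonreal (S := S) (E := E) hγ0.le hγ1)
  set A : Set ℝ := {s | t ≤ s ∧ s ≤ 0 ∧ S.F E s = S.F E 0 + s} with hA
  have h0A : (0:ℝ) ∈ A := ⟨ht0, le_rfl, by simp⟩
  have hbd : BddBelow A := ⟨t, fun s hs => hs.1⟩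
  have hge : ∀ x, t ≤ x → x ≤ 0 → S.F E 0 + x ≤ S.F E x := fun x h1 h2 => F_ge_zero (hok x h1 h2) E
  set τ := sInf A with hτ
  have hτt : t ≤ τ := le_csInf ⟨0, h0A⟩ fun s hs => hs.1
  have hτ0 : τ ≤ 0 := csInf_le hbd h0A
  have hokτ := hok τ hτt hτ0
  -- τ ∈ A
  have hτA : S.F E τ = S.F E 0 + τ := by
    apply le_antisymm _ (hge τ hτt hτ0)
    apply le_of_forall_pos_le_add
    intro e he
    obtain ⟨s, hs, hs2⟩ := exists_lt_of_csInf_lt ⟨0, h0A⟩ (show sInf A < τ + e by rw [← hτ]; linarith)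
    have hs1 : τ ≤ s := csInf_le hbd hs
    have := F_mono hokτ (hok s hs.1 hs.2.1) hs1 E
    rw [hs.2.2] at this; linarith
  have hup : ∀ x, τ ≤ x → x ≤ 0 → S.F E x = S.F E 0 + x := by
    intro x h1 h2
    apply le_antisymm _ (hge x (hτt.trans h1) h2)
    rcases hτ0.eq_or_lt with h | h
    · have : x = 0 := by linarith
      rw [this]; simp
    · have := F_convex hokτ S.ok_zero h1 h2 E
      rw [hτA] at this
      have h3 : (0 - τ) * S.F E x ≤ (0 - τ) * (S.F E 0 + x) := by nlinarith
      exact le_of_mul_le_mul_left h3 (by linarith)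
  rcases hτt.eq_or_lt with h | htτ
  · rw [← h] at hτA
    rw [hτA]; exact le_max_right _ _
  -- τ < 0
  have hτneg : τ < 0 := by
    rcases hτ0.lt_or_eq with h | h
    · exact h
    exfalso
    set η := min ε (-t) with hη
    have hη0 : 0 < η := lt_min hε (by linarith)
    have hηε : η ≤ ε := min_le_left _ _
    have hηt : η ≤ -t := min_le_right _ _
    have := haff (-η) 0 η (by linarith) (by linarith) hη0.le (by linarith)
    have hok' : S.ok η := S.ok_zero.conv hε2 hη0.le (by linarith)
    have hsym := F_symm hok' E
    have hmem : -η ∈ A := by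
      refine ⟨by linarith, by linarith, le_antisymm ?_ (hge _ (by linarith) (by linarith))⟩
      have h3 : η * S.F E (-η) ≤ η * (S.F E 0 + -η) := by nlinarith
      exact le_of_mul_le_mul_left h3 hη0
    have := csInf_le hbd hmem
    linarith
  by_cases hbad : S.Bad E τ (γ0 / 2)
  · have hj := K_jump ht S.ok_zero htτ hτneg (by rw [hτA]; linarith) hbad
    rw [hτA] at hj
    have e : (S.F E 0 - (S.F E 0 + τ)) / (0 - τ) = 1 := by
      have : (0:ℝ) - τ ≠ 0 := by linarith
      field_simp; ring
    rw [e] at hj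
    have h2 : (S.F E 0 + τ - S.F E t) / (τ - t) ≤ 0 := by linarith
    have h3 : S.F E 0 + τ - S.F E t ≤ 0 := by
      by_contra! hc
      have := div_pos hc (show 0 < τ - t by linarith)
      linarith
    exact (slope0 ht hokτ htτ (by rw [hτA]; linarith) hm hg).trans (le_max_left _ _)
  · exfalso
    obtain ⟨_, ε', hε', h1', h2', haff'⟩ := affine hokτ (by positivity) hbad
    set η := min ε' (min (τ - t) (-τ)) with hη
    have hη0 : 0 < η := lt_min hε' (lt_min (by linarith) (by linarith))
    have a1 : η ≤ ε' := min_le_left _ _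
    have a2 : η ≤ τ - t := (min_le_right _ _).trans (min_le_left _ _)
    have a3 : η ≤ -τ := (min_le_right _ _).trans (min_le_right _ _)
    have := haff' (τ - η) τ (τ + η) (by linarith) (by linarith) (by linarith) (by linarith)
    rw [hτA, hup (τ + η) (by linarith) (by linarith)] at this
    have hmem : τ - η ∈ A := by
      refine ⟨by linarith, by linarith, le_antisymm ?_ (hge _ (by linarith) (by linarith))⟩
      have h3 : η * S.F E (τ - η) ≤ η * (S.F E 0 + (τ - η)) := by nlinarith
      exact le_of_mul_le_mul_left h3 hη0
    have := csInf_le hbd hmem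
    linarith

end Sys
end Lyap

namespace Lyap
open Real Filter Topology MeasureTheory

lemma exists_entry (A : Matrix (Fin 2) (Fin 2) ℂ) : ∃ i j, nrm A ≤ 4 * ‖A i j‖ := by
  by_contra! h
  have a := h 0 0
  have b := h 0 1
  have c := h 1 0
  have d := h 1 1
  unfold nrm at *
  linarith

lemma cm_off_finite (t : ℝ) {s : Set ℂ} (hs : s.Finite) : ∀ᵐ θ ∂cm, circleMap 0 (exp t) θ ∉ s := by
  have hz := cm_countable (hs.countable.preimage_circleMap 0 (exp_pos t).ne')
  exact measure_eq_zero_iff_ae_notMem.1 hz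

lemma jen_ge_zero {m : ℕ} {c : ℂ} (hc : c ≠ 0) (z : Fin m → ℂ) (hz : ∀ i, z i ≠ 0) (t : ℝ) :
    log ‖c * ∏ i, (0 - z i)‖ ≤ jen c z t := by
  unfold jen
  rw [norm_mul, norm_prod, log_mul (norm_ne_zero_iff.2 hc)
    (Finset.prod_ne_zero_iff.2 fun i _ => by simpa using hz i), log_prod (fun i _ => by simpa using hz i)]
  gcongr with i
  · simpa using hz i
  · simp

namespace Sys
variable {S : Sys}

open Polynomial in
lemma M_polyE (E0 ζ : ℂ) (i j : Fin 2) : ∃ q : ℂ[X], ∀ w, q.eval w = S.M (E0 + w) ζ i j := by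
  fin_cases i <;> fin_cases j
  · exact ⟨(C E0 + X) * C (S.d ζ) - C (S.lam * (ζ ^ 2 + 1) : ℂ), fun w => by simp [M]⟩
  · exact ⟨C (-S.d ζ), fun w => by simp [M]⟩
  · exact ⟨C (S.d ζ), fun w => by simp [M]⟩
  · exact ⟨0, fun w => by simp [M]⟩

open Polynomial in
lemma Mn_polyE (E0 ζ : ℂ) (n : ℕ) (i j : Fin 2) : ∃ q : ℂ[X], ∀ w, q.eval w = S.Mn (E0 + w) n ζ i j := by
  induction n generalizing i with
  | zero => exact ⟨C ((1 : Matrix (Fin 2) (Fin 2) ℂ) i j), fun ζ => by simp [Mn_zero]⟩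
  | succ n ih =>
    obtain ⟨q0, e0⟩ := M_polyE (S := S) E0 (S.β ^ n * ζ) i 0
    obtain ⟨q1, e1⟩ := M_polyE (S := S) E0 (S.β ^ n * ζ) i 1
    obtain ⟨p0, f0⟩ := ih 0
    obtain ⟨p1, f1⟩ := ih 1
    refine ⟨q0 * p0 + q1 * p1, fun w => ?_⟩
    rw [Mn_succ, Matrix.mul_apply, Fin.sum_univ_two]
    simp [e0, e1, f0, f1]

lemma cont_log_nrmE {t : ℝ} (ht : S.ok t) {ζ : ℂ} (hζ : ‖ζ‖ = exp t) (E0 : ℂ) (n : ℕ) :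
    Continuous (fun w => log (nrm (S.Mn (E0 + w) n ζ))) := by
  apply Continuous.log
  · exact continuous_nrm.comp ((S.continuous_Mn2 n).comp (by fun_prop : Continuous fun w : ℂ => (E0 + w, ζ)))
  · intro w; exact (nrm_Mn_pos ht hζ _ n).ne'

open Polynomial in
lemma submean {t : ℝ} (ht : S.ok t) {ζ : ℂ} (hζ : ‖ζ‖ = exp t) (E0 : ℂ) (n : ℕ) (ρ : ℝ) :
    log (nrm (S.Mn E0 n ζ)) ≤ log 4 + ∫ θ, log (nrm (S.Mn (E0 + circleMap 0 (exp ρ) θ) n ζ)) ∂cm := by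
  obtain ⟨i, j, hij⟩ := exists_entry (S.Mn E0 n ζ)
  have hpos := nrm_Mn_pos ht hζ E0 n
  have hne : 0 < ‖S.Mn E0 n ζ i j‖ := by linarith
  obtain ⟨q, hq⟩ := Mn_polyE (S := S) E0 ζ n i j
  have hq0 : q.eval 0 = S.Mn E0 n ζ i j := by rw [hq, add_zero]
  have hqn : q ≠ 0 := by
    intro h; rw [← hq0, h] at hne; simp at hne
  obtain ⟨c, z, hc, hfac⟩ := poly_factor hqn
  have hz : ∀ i, z i ≠ 0 := by
    intro k hk
    rw [← hq0, hfac, Finset.prod_eq_zero (Finset.mem_univ k) (by rw [hk, sub_zero])] at hne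
    simp at hne
  have h1 := jen_ge_zero hc z hz ρ
  rw [← hfac, hq0, ← CA_jen hc] at h1
  simp only [← hfac] at h1
  have h2 : log (nrm (S.Mn E0 n ζ)) ≤ log 4 + log ‖S.Mn E0 n ζ i j‖ := by
    rw [← log_mul (by norm_num) hne.ne']
    exact log_le_log hpos hij
  have hIntg : CircleIntegrable (fun w => log ‖q.eval w‖) 0 (exp ρ) :=
    (analyticOnNhd_id.aeval_polynomial q).meromorphicOn.circleIntegrable_log_norm
  have h3 : CA (fun w => log ‖q.eval w‖) ρ ≤ ∫ θ, log (nrm (S.Mn (E0 + circleMap 0 (exp ρ) θ) n ζ)) ∂cm := by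
    rw [CA_eq_cm]
    apply integral_mono_ae (cm_integrable hIntg)
    · exact cm_integrable (f := fun w => log (nrm (S.Mn (E0 + w) n ζ))) (CA_integrable (cont_log_nrmE ht hζ E0 n).continuousOn)
    · filter_upwards [cm_off_finite ρ (Set.finite_range z)] with θ hθ
      apply log_le_log
      · rw [norm_pos_iff, hfac]
        exact mul_ne_zero hc (Finset.prod_ne_zero_iff.2 fun k _ hk => hθ ⟨k, (sub_eq_zero.1 hk).symm⟩)
      · rw [hq]; exact entry_le_nrm _ _ _
  linarith

/-- joint continuity -/
lemma joint_cont {t : ℝ} (ht : S.ok t) (n : ℕ) :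
    Continuous (fun p : ℂ × ℝ => log (nrm (S.Mn p.1 n (circleMap 0 (exp t) p.2)))) := by
  apply Continuous.log
  · exact continuous_nrm.comp ((S.continuous_Mn2 n).comp (by fun_prop : Continuous fun p : ℂ × ℝ => (p.1, circleMap 0 (exp t) p.2)))
  · intro p; exact (nrm_Mn_pos ht (by simp) _ n).ne'

lemma joint_bdd {t : ℝ} (ht : S.ok t) (n : ℕ) (r : ℝ) : ∃ C, ∀ E : ℂ, ‖E‖ ≤ r → ∀ ζ : ℂ, ‖ζ‖ = exp t →
    |log (nrm (S.Mn E n ζ))| ≤ C := by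
  have hK : IsCompact (Metric.closedBall (0:ℂ) r ×ˢ Metric.sphere (0:ℂ) (exp t)) :=
    (isCompact_closedBall _ _).prod (isCompact_sphere _ _)
  have hc : ContinuousOn (fun p : ℂ × ℂ => log (nrm (S.Mn p.1 n p.2))) (Metric.closedBall (0:ℂ) r ×ˢ Metric.sphere (0:ℂ) (exp t)) := by
    apply ContinuousOn.log (continuous_nrm.comp (S.continuous_Mn2 n)).continuousOn
    rintro ⟨E, ζ⟩ h
    exact (nrm_Mn_pos ht (by simpa using h.2) _ n).ne'
  obtain ⟨C, hC⟩ := hK.exists_bound_of_continuousOn hc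
  refine ⟨C, fun E hE ζ hζ => ?_⟩
  exact hC (E, ζ) ⟨by simpa using hE, by simpa using hζ⟩

lemma a_cont {t : ℝ} (ht : S.ok t) (n : ℕ) : Continuous (fun E => S.a E t n) := by
  unfold a CA
  simp only [circleAverage_def]
  have h1 := intervalIntegral.continuous_parametric_intervalIntegral_of_continuous'
    (f := fun E θ => log (nrm (S.Mn E n (circleMap 0 (exp t) θ)))) (μ := volume) (joint_cont ht n) 0 (2 * π)
  exact h1.const_smul ((2 * π)⁻¹)

lemma a_submean {t : ℝ} (ht : S.ok t) (E0 : ℂ) (n : ℕ) (ρ : ℝ) :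
    S.a E0 t n ≤ log 4 + ∫ θ, S.a (E0 + circleMap 0 (exp ρ) θ) t n ∂cm := by
  obtain ⟨C, hC⟩ := joint_bdd ht n (‖E0‖ + exp ρ)
  have hcont : Continuous (fun p : ℝ × ℝ => log (nrm (S.Mn (E0 + circleMap 0 (exp ρ) p.2) n (circleMap 0 (exp t) p.1)))) :=
    (joint_cont ht n).comp (by fun_prop : Continuous fun p : ℝ × ℝ => (E0 + circleMap 0 (exp ρ) p.2, p.1))
  have hE : ∀ θ, ‖E0 + circleMap 0 (exp ρ) θ‖ ≤ ‖E0‖ + exp ρ := by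
    intro θ
    refine (norm_add_le _ _).trans ?_
    simp
  have hIntg : Integrable (Function.uncurry fun φ θ => log (nrm (S.Mn (E0 + circleMap 0 (exp ρ) θ) n (circleMap 0 (exp t) φ)))) (cm.prod cm) := by
    apply Integrable.of_bound (C := C)
    · exact hcont.aestronglyMeasurable
    · filter_upwards with p
      exact hC _ (hE _) _ (by simp)
  have hswap := integral_integral_swap hIntg
  have e : ∫ θ, S.a (E0 + circleMap 0 (exp ρ) θ) t n ∂cm =
      ∫ φ, ∫ θ, log (nrm (S.Mn (E0 + circleMap 0 (exp ρ) θ) n (circleMap 0 (exp t) φ))) ∂cm ∂cm := by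
    rw [hswap]
    simp only [a, CA_eq_cm]
  rw [e]
  have e2 : log 4 = ∫ _φ : ℝ, log 4 ∂cm := by simp
  have hi2 : Integrable (fun φ => ∫ θ, log (nrm (S.Mn (E0 + circleMap 0 (exp ρ) θ) n (circleMap 0 (exp t) φ))) ∂cm) cm :=
    hIntg.integral_prod_left
  rw [e2, ← integral_add (integrable_const _) hi2]
  unfold a
  rw [CA_eq_cm]
  apply integral_mono (cm_integrable (int_log_nrm ht E0 n))
  · exact (integrable_const _).add hi2
  · intro φ
    exact submean ht (by simp) E0 n ρ

lemma F_submean {t : ℝ} (ht : S.ok t) (E0 : ℝ) (ρ B : ℝ)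
    (h : ∀ E : ℂ, E.im ≠ 0 → ‖E - E0‖ = exp ρ → S.F E t ≤ B) : S.F E0 t ≤ B := by
  set f : ℕ → ℝ → ℝ := fun n θ => S.a (E0 + circleMap 0 (exp ρ) θ) t n / n with hf
  set g : ℕ → ℝ → ℝ := fun n θ => max (f n θ) B with hg
  have hE : ∀ θ, ‖(E0:ℂ) + circleMap 0 (exp ρ) θ‖ ≤ ‖(E0:ℂ)‖ + exp ρ := by
    intro θ
    refine (norm_add_le _ _).trans ?_
    simp
  have hfc : ∀ n, Continuous (f n) := fun n =>
    ((a_cont ht n).comp (by fun_prop : Continuous fun θ : ℝ => (E0:ℂ) + circleMap 0 (exp ρ) θ)).div_const _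
  have hgc : ∀ n, Continuous (g n) := fun n => (hfc n).max continuous_const
  obtain ⟨C, hC⟩ := joint_bdd ht 1 (‖(E0:ℂ)‖ + exp ρ)
  have ha1 : ∀ E : ℂ, ‖E‖ ≤ ‖(E0:ℂ)‖ + exp ρ → S.a E t 1 ≤ C := by
    intro E hE
    exact CA_le_const (int_log_nrm ht E 1) fun ζ hζ => (le_abs_self _).trans (hC E hE ζ hζ)
  have ha0 : ∀ E : ℂ, S.a E t 0 = log 2 := by
    intro E; unfold a; simp only [Mn_zero, nrm_one]; exact CA_const _ _
  have hl2 : 0 ≤ log 2 := log_nonneg (by norm_num)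
  set D := |C| + log 2 + |S.κ + t| + |B| with hD
  have hbd : ∀ n θ, |f n θ| ≤ D := by
    intro n θ
    have hDp : 0 ≤ D := by positivity
    rcases Nat.eq_zero_or_pos n with h0 | hn
    · simp [hf, h0, hDp]
    have hnr : (0:ℝ) < n := by exact_mod_cast hn
    have hn1 : (1:ℝ) ≤ n := by exact_mod_cast hn
    simp only [hf]
    set E := (E0:ℂ) + circleMap 0 (exp ρ) θ
    have h1 := a_lower ht E n
    have h2 := (a_subadd ht E).apply_mul_add_le n 1 0
    rw [mul_one, add_zero, ha0] at h2
    have h3 := ha1 E (hE θ)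
    have p1 := neg_abs_le (S.κ + t)
    have p2 := le_abs_self C
    have p3 := abs_nonneg C
    have p4 := abs_nonneg B
    have p5 := abs_nonneg (S.κ + t)
    rw [abs_le, le_div_iff₀ hnr, div_le_iff₀ hnr]
    constructor
    · have : -D * n ≤ (S.κ + t) * n := mul_le_mul_of_nonneg_right (by rw [hD]; linarith) hnr.le
      linarith
    · have : (n:ℝ) * S.a E t 1 ≤ n * |C| := mul_le_mul_of_nonneg_left (by linarith) hnr.le
      have : (|C| + log 2) * n ≤ D * n := mul_le_mul_of_nonneg_right (by rw [hD]; linarith) hnr.le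
      nlinarith
  have hgbd : ∀ n θ, |g n θ| ≤ D := by
    intro n θ
    have := hbd n θ
    refine (abs_max_le_max_abs_abs).trans (max_le this ?_)
    rw [hD]
    have p3 := abs_nonneg C
    have p5 := abs_nonneg (S.κ + t)
    linarith
  have hnon : ∀ᵐ θ ∂cm, Tendsto (fun n => g n θ) atTop (𝓝 B) := by
    have hfin : ({((exp ρ : ℝ) : ℂ), ((-exp ρ : ℝ) : ℂ)} : Set ℂ).Finite := by simp
    filter_upwards [cm_off_finite ρ hfin] with θ hθ
    have him : ((E0:ℂ) + circleMap 0 (exp ρ) θ).im ≠ 0 := by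
      intro h0
      apply hθ
      simp only [Complex.add_im, Complex.ofReal_im, zero_add] at h0
      set w := circleMap 0 (exp ρ) θ with hw
      have hwn : ‖w‖ = exp ρ := by simp [hw]
      have hwr : w = (w.re : ℂ) := by apply Complex.ext <;> simp [h0]
      have : |w.re| = exp ρ := by rw [← hwn, hwr, Complex.norm_real]; simp
      rcases eq_or_eq_neg_of_abs_eq this with h | h
      · left; rw [hwr, h]
      · right; rw [hwr, h]; rfl
    have hle := h _ him (by simp)
    have := (F_tendsto ht ((E0:ℂ) + circleMap 0 (exp ρ) θ)).max (tendsto_const_nhds (x := B))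
    rwa [max_eq_right hle] at this
  have hlim : Tendsto (fun n => ∫ θ, g n θ ∂cm) atTop (𝓝 (∫ _θ : ℝ, B ∂cm)) :=
    tendsto_integral_of_dominated_convergence (fun _ => D) (fun n => (hgc n).aestronglyMeasurable)
      (integrable_const _) (fun n => by filter_upwards with θ; exact hgbd n θ) hnon
  rw [integral_const] at hlim
  simp only [probReal_univ, one_smul] at hlim
  refine le_of_tendsto_of_tendsto (Fn_tendsto_sub ht E0 (log 4)) hlim ?_
  filter_upwards [eventually_gt_atTop 0] with n hn
  have hnr : (0:ℝ) < n := by exact_mod_cast hn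
  have h1 := a_submean ht E0 n ρ
  have hif : Integrable (f n) cm := Integrable.of_bound (C := D) (hfc n).aestronglyMeasurable (by filter_upwards with θ; exact hbd n θ)
  have hig : Integrable (g n) cm := Integrable.of_bound (C := D) (hgc n).aestronglyMeasurable (by filter_upwards with θ; exact hgbd n θ)
  have h2 : ∫ θ, f n θ ∂cm ≤ ∫ θ, g n θ ∂cm := integral_mono hif hig fun θ => le_max_left _ _
  have h3 : ∫ θ, f n θ ∂cm = (∫ θ, S.a (E0 + circleMap 0 (exp ρ) θ) t n ∂cm) / n := by
    simp only [hf]; rw [integral_div]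
  calc _ ≤ (∫ θ, S.a (E0 + circleMap 0 (exp ρ) θ) t n ∂cm) / n := by gcongr; linarith
    _ ≤ _ := by rw [← h3]; exact h2

lemma Jlem (E0 : ℝ) {t : ℝ} (ht : S.ok t) (ht0 : t ≤ 0) {m : ℕ} {γ : ℝ} (hm : 0 < m)
    (hg : nrm (S.M E0 0 ^ m) < exp (m * γ)) : S.F E0 t ≤ max γ (S.F E0 0 + t) := by
  apply le_of_forall_pos_le_add
  intro δ hδ
  have h1 : ∀ᶠ E in 𝓝 (E0:ℂ), nrm (S.M E 0 ^ m) < exp (m * γ) := by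
    have hc : Continuous fun E : ℂ => nrm (S.M E 0 ^ m) :=
      continuous_nrm.comp ((S.continuous_M2.comp (by fun_prop : Continuous fun E : ℂ => (E, (0:ℂ)))).pow m)
    exact (hc.tendsto (E0:ℂ)).eventually_lt_const hg
  have h2 : ∀ᶠ E in 𝓝 (E0:ℂ), S.F E 0 ≤ S.F E0 0 + δ := by
    have hl := (F_tendsto S.ok_zero (E0:ℂ)).eventually_lt_const (show S.F E0 0 < S.F E0 0 + δ by linarith)
    obtain ⟨n, hn, hn0⟩ := (hl.and (eventually_gt_atTop 0)).exists
    have hc : Continuous fun E : ℂ => S.a E 0 n / n := (a_cont S.ok_zero n).div_const _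
    filter_upwards [(hc.tendsto (E0:ℂ)).eventually_lt_const hn] with E hE
    exact (F_le S.ok_zero E hn0.ne').trans hE.le
  obtain ⟨ε, hε, hball⟩ := Metric.eventually_nhds_iff.1 (h1.and h2)
  refine F_submean ht E0 (log (ε / 2)) _ ?_
  intro E hE hEn
  rw [exp_log (by positivity)] at hEn
  obtain ⟨a1, a2⟩ := hball (y := E) (by rw [dist_eq_norm, hEn]; linarith)
  refine (Zlem hE ht ht0 hm a1).trans ?_
  apply max_le
  · linarith [le_max_left γ (S.F E0 0 + t)]
  · linarith [le_max_right γ (S.F E0 0 + t)]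

end Sys
end Lyap

namespace Lyap
open Real Filter Topology MeasureTheory

namespace Sys
variable {S : Sys}

lemma root_bd {τ : ℝ} (hτ : |τ| ≤ 1) {r : ℂ} (hr : r ^ 2 - τ * r + ((S.α ^ 2 / 4 : ℝ) : ℂ) = 0) :
    ‖r‖ ≤ S.K := by
  have hK := S.K_half
  have hq := S.alpha_sq
  have hKe := S.K_eq
  have h1 := congrArg Complex.re hr
  have h2 := congrArg Complex.im hr
  simp only [pow_two, Complex.add_re, Complex.sub_re, Complex.mul_re, Complex.ofReal_re, Complex.ofReal_im,
    Complex.add_im, Complex.sub_im, Complex.mul_im, Complex.zero_re, Complex.zero_im] at h1 h2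
  have hn : ‖r‖ ^ 2 = r.re ^ 2 + r.im ^ 2 := by rw [← Complex.normSq_eq_norm_sq, Complex.normSq_apply]; ring
  have h3 : r.im * (2 * r.re - τ) = 0 := by linarith
  rcases mul_eq_zero.mp h3 with h | h
  · rw [h] at hn h1
    have h4 : ‖r‖ ^ 2 - ‖r‖ + S.α ^ 2 / 4 ≤ 0 := by
      have h5 : |r.re| = ‖r‖ := by
        have : |r.re| ^ 2 = ‖r‖ ^ 2 := by rw [hn, sq_abs]; ring
        exact (pow_left_inj₀ (abs_nonneg _) (norm_nonneg _) two_ne_zero).mp this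
      have h6 : τ * r.re ≤ ‖r‖ := by
        refine (le_abs_self _).trans ?_
        rw [abs_mul, h5]; nlinarith [norm_nonneg r]
      nlinarith
    by_contra hc
    push Not at hc
    nlinarith
  · have h4 : ‖r‖ ^ 2 = S.α ^ 2 / 4 := by
      have : τ = 2 * r.re := by linarith
      rw [this] at h1
      rw [hn]; linarith
    have : ‖r‖ ^ 2 ≤ S.K ^ 2 := by nlinarith
    exact (pow_le_pow_iff_left₀ (norm_nonneg _) S.K_pos.le two_ne_zero).mp this

lemma growth {E0 : ℝ} (hE : |S.α * E0 + 2 * S.lam| ≤ 2) {γ : ℝ} (hγ : S.κ < γ) :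
    ∃ m : ℕ, 0 < m ∧ nrm (S.M E0 0 ^ m) < exp (m * γ) := by
  set C := S.M E0 0 with hC
  set τ : ℝ := -(E0 * S.α / 2 + S.lam) with hτ
  have hτ1 : |τ| ≤ 1 := by
    rw [abs_le] at hE ⊢; constructor <;> linarith [hE.1, hE.2]
  obtain ⟨s, hs⟩ := IsAlgClosed.exists_pow_nat_eq ((τ:ℂ) ^ 2 - 4 * ((S.α ^ 2 / 4 : ℝ) : ℂ)) (n := 2) (by norm_num)
  set r1 : ℂ := (τ + s) / 2 with hr1
  set r2 : ℂ := (τ - s) / 2 with hr2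
  have b1 : ‖r1‖ ≤ S.K := root_bd hτ1 (by rw [hr1]; linear_combination hs / 4)
  have b2 : ‖r2‖ ≤ S.K := root_bd hτ1 (by rw [hr2]; linear_combination hs / 4)
  have hsum : r1 + r2 = τ := by rw [hr1, hr2]; ring
  have hprod : r1 * r2 = ((S.α ^ 2 / 4 : ℝ) : ℂ) := by rw [hr1, hr2]; linear_combination - hs / 4
  have hCH : (C - r1 • (1 : Matrix (Fin 2) (Fin 2) ℂ)) * C = r2 • (C - r1 • (1 : Matrix (Fin 2) (Fin 2) ℂ)) := by
    have hsum' := hsum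
    have hprod' := hprod
    rw [hτ] at hsum'
    push_cast at hsum' hprod'
    have : r2 = -(E0 * S.α / 2 + S.lam) - r1 := by linear_combination hsum'
    rw [this] at hprod' ⊢
    have hM : C = !![-((E0:ℂ) * S.α / 2 + S.lam), (S.α / 2 : ℂ); -(S.α / 2 : ℂ), 0] := by
      rw [hC]; unfold M d
      ext i j
      fin_cases i <;> fin_cases j <;> simp <;> ring
    rw [hM]
    clear_value r1 r2
    clear hM this hsum'
    rw [Matrix.one_fin_two]
    simp only [Matrix.smul_of, Matrix.smul_cons, smul_eq_mul, Matrix.smul_empty, Matrix.of_sub_of, Matrix.sub_cons,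
      Matrix.head_cons, Matrix.tail_cons, Matrix.empty_sub_empty, Matrix.mul_fin_two]
    congr 1
    congr 1
    · congr 1
      · linear_combination hprod'
      · congr 1
        ring
    · congr 1
      congr 1
      · ring
      · congr 1
        linear_combination hprod'
  have hpow : ∀ n : ℕ, (C - r1 • (1 : Matrix (Fin 2) (Fin 2) ℂ)) * C ^ n = r2 ^ n • (C - r1 • (1 : Matrix (Fin 2) (Fin 2) ℂ)) := by
    intro n
    induction n with
    | zero => simp
    | succ n ih => rw [pow_succ, ← mul_assoc, ih, smul_mul_assoc, hCH, smul_smul, pow_succ]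
  set D := nrm (C - r1 • (1 : Matrix (Fin 2) (Fin 2) ℂ)) with hD
  have hD0 : 0 ≤ D := nrm_nonneg _
  have hK := S.K_pos
  have hb : ∀ n : ℕ, nrm (C ^ n) ≤ S.K ^ n * (2 + n * (D / S.K)) := by
    intro n
    induction n with
    | zero => simp [nrm_one]
    | succ n ih =>
      have e : C ^ (n + 1) = r1 • C ^ n + r2 ^ n • (C - r1 • (1 : Matrix (Fin 2) (Fin 2) ℂ)) := by
        rw [← hpow n, sub_mul, pow_succ']; simp
      rw [e]
      refine (nrm_add_le _ _).trans ?_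
      rw [nrm_smul, nrm_smul, norm_pow, ← hD]
      have h1 : ‖r1‖ * nrm (C ^ n) ≤ S.K * (S.K ^ n * (2 + n * (D / S.K))) :=
        mul_le_mul b1 ih (nrm_nonneg _) hK.le
      have h2 : ‖r2‖ ^ n * D ≤ S.K ^ n * D := by gcongr
      refine (add_le_add h1 h2).trans (le_of_eq ?_)
      push_cast
      field_simp
      ring
  set ε := γ - S.κ with hε
  have hε0 : 0 < ε := by linarith
  have hlim : Tendsto (fun n : ℕ => (2 + n * (D / S.K)) * exp (-ε) ^ n) atTop (𝓝 0) := by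
    have hx : |exp (-ε)| < 1 := by rw [abs_of_pos (exp_pos _)]; exact Real.exp_lt_one_iff.mpr (by linarith)
    have t1 := tendsto_self_mul_const_pow_of_abs_lt_one hx
    have t2 := tendsto_pow_atTop_nhds_zero_of_abs_lt_one hx
    have := (t2.const_mul 2).add (t1.const_mul (D / S.K))
    simp only [mul_zero, add_zero] at this
    refine this.congr fun n => by ring
  obtain ⟨m, hm, hm0⟩ := ((hlim.eventually (gt_mem_nhds one_pos)).and (eventually_gt_atTop 0)).exists
  refine ⟨m, hm0, (hb m).trans_lt ?_⟩
  have e1 : S.K = exp S.κ := by unfold κ; rw [exp_log hK]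
  have e2 : exp (m * γ) = S.K ^ m * exp ε ^ m := by
    rw [e1, ← exp_nat_mul, ← exp_nat_mul, ← exp_add]; congr 1; rw [hε]; ring
  rw [e2]
  apply mul_lt_mul_of_pos_left _ (by positivity)
  have e3 : exp (-ε) ^ m = (exp ε ^ m)⁻¹ := by rw [exp_neg, inv_pow]
  rw [e3, ← div_eq_mul_inv, div_lt_one (by positivity)] at hm
  exact hm

lemma not_bad {E0 : ℝ} (hE : |S.α * E0 + 2 * S.lam| ≤ 2) (hℓ : S.κ < S.F E0 0) :
    ∃ γ > 0, ¬ S.Bad E0 0 γ := by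
  refine ⟨(S.F E0 0 - S.κ) / 2, by linarith, fun hbad => ?_⟩
  obtain ⟨m, hm, hg⟩ := growth hE (γ := (S.F E0 0 + S.κ) / 2) (by linarith)
  have hop : ∀ᶠ t in 𝓝 (0:ℝ), S.ok t := S.isOpen_ok.mem_nhds S.ok_zero
  obtain ⟨ρ, hρ, hball⟩ := Metric.eventually_nhds_iff.mp hop
  set η := min (ρ / 2) ((S.F E0 0 - S.κ) / 2) with hη
  have hη0 : 0 < η := lt_min (by linarith) (by linarith)
  have hη2 : η ≤ (S.F E0 0 - S.κ) / 2 := min_le_right _ _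
  have hok : S.ok η := hball (by
    rw [Real.dist_eq, sub_zero, abs_of_pos hη0]; linarith [min_le_left (ρ / 2) ((S.F E0 0 - S.κ) / 2)])
  have h1 := Jlem E0 hok.neg (by linarith) hm hg
  rw [max_eq_right (by linarith)] at h1
  have h2 := F_symm hok E0
  have h3 := K_jump (E := E0) (γ := (S.F E0 0 - S.κ) / 2) hok.neg hok (neg_lt_zero.mpr hη0) hη0 (by linarith) hbad
  have e1 : (S.F E0 η - S.F E0 0) / (η - 0) ≤ 1 := by
    rw [div_le_one (by linarith)]; linarith
  have e2 : 1 ≤ (S.F E0 0 - S.F E0 (-η)) / (0 - -η) := by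
    rw [one_le_div (by linarith)]; linarith
  linarith

end Sys
end Lyap

namespace Lyap
open Real Filter Topology MeasureTheory

namespace Sys
variable {S : Sys}

lemma ptwise {E : ℂ} {γ : ℝ} (hγ : 0 < γ) (hb : ¬ S.Bad E 0 γ) {z : ℂ} (hz : ‖z‖ = 1) :
    ∃ C > 0, ∀ (u : ℤ → ℂ) (B : ℝ), (∀ k, ‖u k‖ ≤ B) → ∀ k : ℤ, ∃ l : ℤ,
      ‖u k‖ ≤ C * exp (-γ * |((l - k : ℤ) : ℝ)|) *
        ‖u (l + 1) + u (l - 1) + (S.vv (S.β ^ l * z) - E) * u l‖ := by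
  obtain ⟨n0, δ0, hδ0, hcpt⟩ := cpt hb
  refine ⟨2 / δ0 * exp (γ * n0), by positivity, fun u B hB k => ?_⟩
  set W : ℤ → V2 := fun i => ![u i, u (i - 1)] with hW
  have hB0 : 0 ≤ B := (norm_nonneg _).trans (hB 0)
  have hWB : ∀ i, ‖W i‖ ≤ B := fun i => V2_norm_le (by simpa [hW] using hB _) (by simpa [hW] using hB _)
  have hWu : ∀ i, ‖u i‖ ≤ ‖W i‖ := fun i => by simpa [hW] using norm_le_pi_norm (W i) 0
  by_cases h0 : W k = 0
  · refine ⟨k, ?_⟩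
    have := hWu k
    rw [h0, norm_zero] at this
    exact this.trans (by positivity)
  set f : ℤ → ℝ := fun i => exp (-γ * |((i - k : ℤ) : ℝ)|) * ‖W i‖ with hf
  have hfk : f k = ‖W k‖ := by simp [hf]
  have hpos : 0 < ‖W k‖ := norm_pos_iff.mpr h0
  have hmax : ∃ i, ∀ j, f j ≤ f i := by
    apply Continuous.exists_forall_ge' continuous_of_discreteTopology k
    rw [cocompact_eq_cofinite, eventually_cofinite]
    obtain ⟨N, hN⟩ := exists_nat_gt (B / (γ * ‖W k‖))
    apply (Set.finite_Icc (k - N) (k + N)).subset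
    intro i hi
    simp only [Set.mem_ofPred_eq, not_le, hfk] at hi
    by_contra hc
    have h1 : (N:ℤ) ≤ |i - k| := by
      by_contra h2
      push Not at h2
      rw [abs_lt] at h2
      exact hc ⟨by linarith, by linarith⟩
    have h2 : (N:ℝ) ≤ |((i - k : ℤ) : ℝ)| := by exact_mod_cast h1
    set x := |((i - k : ℤ) : ℝ)| with hx
    have h3 : f i ≤ exp (-γ * x) * B := by
      simp only [hf]; exact mul_le_mul_of_nonneg_left (hWB i) (exp_pos _).le
    have h4 : γ * x < exp (γ * x) := by linarith [add_one_le_exp (γ * x)]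
    have h5 : B < ‖W k‖ * (γ * x) := by
      rw [div_lt_iff₀ (by positivity)] at hN
      nlinarith [mul_le_mul_of_nonneg_right h2 (by positivity : 0 ≤ γ * ‖W k‖)]
    have h6 : B < ‖W k‖ * exp (γ * x) := h5.trans (by gcongr)
    have h7 : exp (-γ * x) * B < ‖W k‖ := by
      have : exp (-γ * x) * exp (γ * x) = 1 := by rw [← exp_add]; simp
      calc exp (-γ * x) * B < exp (-γ * x) * (‖W k‖ * exp (γ * x)) := by gcongr
        _ = ‖W k‖ := by rw [mul_left_comm, this, mul_one]
    linarith
  obtain ⟨i, hi⟩ := hmax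
  have hWi : W i ≠ 0 := by
    intro h
    have := hi k
    rw [hfk] at this
    simp only [hf, h, norm_zero, mul_zero] at this
    linarith
  have hgrow : ∀ j : ℤ, ‖W (i + j)‖ ≤ exp (γ * |(j:ℝ)|) * ‖W i‖ := by
    intro j
    have h1 := hi (i + j)
    simp only [hf] at h1
    have h2 : |((i + j - k : ℤ) : ℝ)| ≤ |((i - k : ℤ) : ℝ)| + |(j:ℝ)| := by
      have : ((i + j - k : ℤ) : ℝ) = ((i - k : ℤ) : ℝ) + j := by push_cast; ring
      rw [this]; exact abs_add_le _ _
    set x := |((i - k : ℤ) : ℝ)|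
    set y := |((i + j - k : ℤ) : ℝ)|
    calc ‖W (i + j)‖ = exp (γ * y) * (exp (-γ * y) * ‖W (i + j)‖) := by
          rw [← mul_assoc, ← exp_add]; simp
      _ ≤ exp (γ * (x + |(j:ℝ)|)) * (exp (-γ * x) * ‖W i‖) := by gcongr
      _ = exp (γ * |(j:ℝ)|) * ‖W i‖ := by
          rw [← mul_assoc, ← exp_add]; congr 2; ring
  have hex : ∃ j : ℤ, |j| ≤ n0 ∧ δ0 * ‖W i‖ < ‖S.d (S.β ^ (i + j) * z) • W (i + j + 1) - (S.M E (S.β ^ (i + j) * z)).mulVec (W (i + j))‖ := by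
    by_contra hc
    push Not at hc
    obtain ⟨j, hj, hj2⟩ := hcpt (fun j => S.β ^ (i + j) * z) (fun j => W (i + j)) (by simpa using hWi)
      (by simp [hz, S.norm_β]; exact hδ0.le) (by
        intro j _
        simp only [add_zero]
        rw [zpow_add₀ S.β_ne]
        have : S.β ^ i * S.β ^ j * z - S.β ^ j * (S.β ^ i * z) = 0 := by ring
        rw [this, norm_zero]; exact hδ0.le) (by
        intro j hj
        have := hc j hj
        simpa [add_assoc] using this)
    have := hgrow j
    simp only [add_zero] at hj2
    linarith
  obtain ⟨j, hj, hj2⟩ := hex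
  refine ⟨i + j, ?_⟩
  set l := i + j with hl
  set g := u (l + 1) + u (l - 1) + (S.vv (S.β ^ l * z) - E) * u l with hg
  have hn1 : ‖S.β ^ l * z‖ = 1 := by rw [norm_mul, S.norm_βzpow, hz, one_mul]
  have hres : S.d (S.β ^ l * z) • W (l + 1) - (S.M E (S.β ^ l * z)).mulVec (W l) = S.d (S.β ^ l * z) • ![g, 0] := by
    rw [M_circ E hn1]
    ext m
    fin_cases m
    · simp [hW, hg]; ring
    · simp [hW]; ring
  have hd : ‖S.d (S.β ^ l * z)‖ ≤ 2 := by
    rw [d_circ hn1, norm_mul, hn1, one_mul, Complex.norm_real, Real.norm_eq_abs, abs_of_pos (vv_den hn1)]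
    have h1 := Complex.abs_re_le_norm (S.β ^ l * z)
    rw [hn1] at h1
    have h2 : |S.α * (S.β ^ l * z).re| ≤ 1 := by
      rw [abs_mul]; nlinarith [abs_nonneg S.α, abs_nonneg (S.β ^ l * z).re, S.hα]
    linarith [neg_abs_le (S.α * (S.β ^ l * z).re)]
  rw [hres, norm_smul] at hj2
  have hgn : ‖(![g, 0] : V2)‖ ≤ ‖g‖ := V2_norm_le (by simp) (by simp)
  have h1 : δ0 * ‖W i‖ ≤ 2 * ‖g‖ := hj2.le.trans (by gcongr)
  have h2 : ‖W i‖ ≤ 2 / δ0 * ‖g‖ := by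
    rw [div_mul_eq_mul_div, le_div_iff₀ hδ0]; linarith
  have h3 : ‖u k‖ ≤ exp (-γ * |((i - k : ℤ) : ℝ)|) * ‖W i‖ := by
    have := hi k
    rw [hfk] at this
    exact (hWu k).trans this
  have h4 : |((l - k : ℤ) : ℝ)| ≤ |((i - k : ℤ) : ℝ)| + n0 := by
    have e : ((l - k : ℤ) : ℝ) = ((i - k : ℤ) : ℝ) + j := by rw [hl]; push_cast; ring
    have e2 : |(j:ℝ)| ≤ n0 := by exact_mod_cast hj
    rw [e]; linarith [abs_add_le ((i - k : ℤ) : ℝ) j]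
  have h5 : exp (-γ * |((i - k : ℤ) : ℝ)|) ≤ exp (γ * n0) * exp (-γ * |((l - k : ℤ) : ℝ)|) := by
    rw [← exp_add]
    apply exp_le_exp.mpr
    nlinarith
  calc ‖u k‖ ≤ exp (-γ * |((i - k : ℤ) : ℝ)|) * ‖W i‖ := h3
    _ ≤ (exp (γ * n0) * exp (-γ * |((l - k : ℤ) : ℝ)|)) * (2 / δ0 * ‖g‖) := by gcongr
    _ = _ := by ring

end Sys

lemma summable_exp_int {c : ℝ} (hc : 0 < c) : Summable (fun k : ℤ => exp (-c * |(k:ℝ)|)) := by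
  have h : Summable (fun n : ℕ => exp (-c * |(n:ℝ)|)) := by
    have h1 : Summable (fun n : ℕ => exp (-c) ^ n) :=
      summable_geometric_of_lt_one (exp_pos _).le (Real.exp_lt_one_iff.mpr (by linarith))
    refine h1.congr fun n => ?_
    rw [← exp_nat_mul]; simp [mul_comm]
  exact Summable.of_nat_of_neg (by simpa using h) (by simpa using h)

noncomputable abbrev L2 := lp (fun _ : ℤ => ℂ) 2

lemma schur {γ C : ℝ} (hγ : 0 < γ) (hC : 0 < C) : ∃ D : ℝ, 0 ≤ D ∧ ∀ u g : L2,
    (∀ k : ℤ, ∃ l : ℤ, ‖u k‖ ≤ C * exp (-γ * |((l - k : ℤ) : ℝ)|) * ‖g l‖) → ‖u‖ ≤ D * ‖g‖ := by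
  set Sg : ℝ := ∑' k : ℤ, exp (-(2 * γ) * |(k:ℝ)|) with hSg
  have hS0 : 0 ≤ Sg := tsum_nonneg fun _ => (exp_pos _).le
  have h2 : (0:ℝ) < (2 : ENNReal).toReal := by norm_num
  refine ⟨C * √Sg, by positivity, fun u g h => ?_⟩
  choose l hl using h
  apply lp.norm_le_of_forall_sum_le h2 (by positivity)
  intro s
  have hg := lp.sum_rpow_le_norm_rpow h2 g (s.image l)
  simp only [ENNReal.toReal_ofNat, Real.rpow_ofNat] at hg ⊢
  have hin : ∀ m : ℤ, ∑ k ∈ s, exp (-(2 * γ) * |((m - k : ℤ) : ℝ)|) ≤ Sg := by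
    intro m
    have e := (Equiv.subLeft m).tsum_eq (fun k : ℤ => exp (-(2 * γ) * |(k:ℝ)|))
    rw [hSg, ← e]
    refine Summable.sum_le_tsum (f := fun k : ℤ => exp (-(2 * γ) * |(((Equiv.subLeft m) k : ℤ):ℝ)|)) s (fun _ _ => (exp_pos _).le) ?_
    exact (Equiv.subLeft m).summable_iff.mpr (summable_exp_int (by linarith))
  calc ∑ k ∈ s, ‖u k‖ ^ 2 ≤ ∑ k ∈ s, ∑ m ∈ s.image l, C ^ 2 * (exp (-(2 * γ) * |((m - k : ℤ) : ℝ)|) * ‖g m‖ ^ 2) := by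
        apply Finset.sum_le_sum
        intro k hk
        have h1 : ‖u k‖ ^ 2 ≤ C ^ 2 * (exp (-(2 * γ) * |((l k - k : ℤ) : ℝ)|) * ‖g (l k)‖ ^ 2) := by
          calc ‖u k‖ ^ 2 ≤ (C * exp (-γ * |((l k - k : ℤ) : ℝ)|) * ‖g (l k)‖) ^ 2 := by gcongr; exact hl k
            _ = _ := by
              
              have e : exp (-(2 * γ) * |((l k - k : ℤ) : ℝ)|) = exp (-γ * |((l k - k : ℤ) : ℝ)|) ^ 2 := by
                rw [← exp_nat_mul]; congr 1; push_cast; ring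
              rw [e]; ring
        refine h1.trans ?_
        exact Finset.single_le_sum (f := fun m => C ^ 2 * (exp (-(2 * γ) * |((m - k : ℤ) : ℝ)|) * ‖g m‖ ^ 2))
          (fun _ _ => by positivity) (Finset.mem_image_of_mem l hk)
    _ = C ^ 2 * ∑ m ∈ s.image l, (∑ k ∈ s, exp (-(2 * γ) * |((m - k : ℤ) : ℝ)|)) * ‖g m‖ ^ 2 := by
        rw [Finset.sum_comm, Finset.mul_sum]
        apply Finset.sum_congr rfl
        intro m _
        rw [Finset.sum_mul, Finset.mul_sum]
    _ ≤ C ^ 2 * ∑ m ∈ s.image l, Sg * ‖g m‖ ^ 2 := by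
        gcongr with m _; exact hin m
    _ = C ^ 2 * (Sg * ∑ m ∈ s.image l, ‖g m‖ ^ 2) := by rw [← Finset.mul_sum]
    _ ≤ C ^ 2 * (Sg * ‖g‖ ^ 2) := by gcongr
    _ = (C * √Sg * ‖g‖) ^ 2 := by rw [mul_pow, mul_pow, sq_sqrt hS0]; ring

end Lyap

namespace Lyap
open Real Filter Topology MeasureTheory

lemma lp_comp {e : ℤ → ℤ} (he : Function.Injective e) {c : ℤ → ℂ} {B : ℝ} (hB : 0 ≤ B) (hc : ∀ n, ‖c n‖ ≤ B) (u : L2) :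
    ∃ w : L2, (∀ n, w n = c n * u (e n)) ∧ ‖w‖ ≤ B * ‖u‖ := by
  have h2 : (0:ℝ) < (2 : ENNReal).toReal := by norm_num
  have key : ∀ s : Finset ℤ, ∑ n ∈ s, ‖c n * u (e n)‖ ^ (2 : ENNReal).toReal ≤ (B * ‖u‖) ^ (2 : ENNReal).toReal := by
    intro s
    have hu := lp.sum_rpow_le_norm_rpow h2 u (s.image e)
    simp only [ENNReal.toReal_ofNat, Real.rpow_ofNat] at hu ⊢
    rw [Finset.sum_image he.injOn] at hu
    calc ∑ n ∈ s, ‖c n * u (e n)‖ ^ 2 ≤ ∑ n ∈ s, B ^ 2 * ‖u (e n)‖ ^ 2 := by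
          apply Finset.sum_le_sum
          intro n _
          rw [norm_mul, mul_pow]
          have := hc n
          gcongr
      _ = B ^ 2 * ∑ n ∈ s, ‖u (e n)‖ ^ 2 := by rw [Finset.mul_sum]
      _ ≤ B ^ 2 * ‖u‖ ^ 2 := by gcongr
      _ = (B * ‖u‖) ^ 2 := by ring
  refine ⟨⟨fun n => c n * u (e n), memℓp_gen' key⟩, fun n => rfl, ?_⟩
  exact lp.norm_le_of_forall_sum_le h2 (by positivity) key

lemma H_bound {V : ℝ → ℝ} {b θ : ℝ} {H : L2 →L[ℂ] L2} (hH : IsSchrodingerOp V b θ H) {v : ℝ} (hv0 : 0 ≤ v)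
    (hv : ∀ x, |V x| ≤ v) : ‖H‖ ≤ 2 + v := by
  apply ContinuousLinearMap.opNorm_le_bound _ (by linarith)
  intro u
  obtain ⟨w1, h1, n1⟩ := lp_comp (e := fun n => n + 1) (add_left_injective 1) (c := fun _ => 1) (B := 1) zero_le_one (by simp) u
  obtain ⟨w2, h2, n2⟩ := lp_comp (e := fun n => n - 1) (sub_left_injective) (c := fun _ => 1) (B := 1) zero_le_one (by simp) u
  obtain ⟨w3, h3, n3⟩ := lp_comp (e := fun n => n) Function.injective_id (c := fun n => (V ((n:ℝ) * b + θ) : ℂ)) (B := v) hv0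
    (by intro n; rw [Complex.norm_real]; exact hv _) u
  have e : H u = w1 + w2 + w3 := by
    ext n
    rw [hH u n]
    simp [h1, h2, h3]
  rw [e]
  refine (norm_add₃_le).trans ?_
  linarith

lemma unit_of_bound {V : ℝ → ℝ} {b θ : ℝ} {H : L2 →L[ℂ] L2} (hH : IsSchrodingerOp V b θ H) {E D : ℝ} (hD : 0 ≤ D)
    (hbd : ∀ u : L2, ‖u‖ ≤ D * ‖H u - (E:ℂ) • u‖) : (E:ℂ) ∉ spectrum ℂ H := by
  rw [spectrum.mem_iff, not_not]
  set T : L2 →L[ℂ] L2 := algebraMap ℂ (L2 →L[ℂ] L2) E - H with hT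
  have hTu : ∀ u, T u = (E:ℂ) • u - H u := fun u => by
    rw [hT, ContinuousLinearMap.sub_apply, Algebra.algebraMap_eq_smul_one]; rfl
  have hTbd : ∀ u : L2, ‖u‖ ≤ D * ‖T u‖ := fun u => by
    rw [hTu, norm_sub_rev]; exact hbd u
  have hanti : AntilipschitzWith ⟨D, hD⟩ T := T.antilipschitz_of_bound hTbd
  rw [ContinuousLinearMap.isUnit_iff_bijective]
  refine ⟨hanti.injective, ?_⟩
  have hcl : IsClosed (Set.range T) := hanti.isClosed_range T.uniformContinuous
  have horth : (LinearMap.range T.toLinearMap)ᗮ = ⊥ := by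
    rw [Submodule.eq_bot_iff]
    intro w hw
    rw [Submodule.mem_orthogonal] at hw
    have hw0 : T w = 0 := by
      ext n
      have h1 := hw (T (lp.single 2 n (1:ℂ))) ⟨_, rfl⟩
      have e : T (lp.single 2 n (1:ℂ)) = ((E - V ((n:ℝ) * b + θ) : ℝ):ℂ) • lp.single 2 n (1:ℂ) - lp.single 2 (n - 1) (1:ℂ) - lp.single 2 (n + 1) (1:ℂ) := by
        rw [hTu]
        ext m
        simp only [lp.coeFn_sub, lp.coeFn_smul, Pi.sub_apply, Pi.smul_apply, hH _ m, lp.single_apply, smul_eq_mul, Pi.single_apply]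
        by_cases a1 : m = n
        · have b1 : m + 1 ≠ n := by omega
          have b2 : m - 1 ≠ n := by omega
          have b3 : m ≠ n - 1 := by omega
          have b4 : m ≠ n + 1 := by omega
          rw [if_pos a1, if_neg b1, if_neg b2, if_neg b3, if_neg b4, a1]
          push_cast; ring
        · by_cases a2 : m + 1 = n
          · have b2 : m - 1 ≠ n := by omega
            have b3 : m = n - 1 := by omega
            have b4 : m ≠ n + 1 := by omega
            rw [if_neg a1, if_pos a2, if_neg b2, if_pos b3, if_neg b4]
            ring
          · by_cases a3 : m - 1 = n
            · have b3 : m ≠ n - 1 := by omega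
              have b4 : m = n + 1 := by omega
              rw [if_neg a1, if_neg a2, if_pos a3, if_neg b3, if_pos b4]
              ring
            · have a4 : m ≠ n - 1 := by omega
              have a5 : m ≠ n + 1 := by omega
              rw [if_neg a1, if_neg a2, if_neg a3, if_neg a4, if_neg a5]
              ring
      rw [e] at h1
      simp only [inner_sub_left, inner_smul_left, lp.inner_single_left] at h1
      simp at h1
      rw [hTu]
      simp only [lp.coeFn_sub, lp.coeFn_smul, Pi.sub_apply, Pi.smul_apply, hH _ n, smul_eq_mul]
      simp
      linear_combination h1
    have := hTbd w
    rw [hw0, norm_zero, mul_zero] at this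
    exact norm_le_zero_iff.mp this
  have htop := Submodule.topologicalClosure_eq_top_iff.mpr horth
  have hc2 : IsClosed ((LinearMap.range T.toLinearMap : Submodule ℂ L2) : Set L2) := by
    rw [LinearMap.coe_range]; exact hcl
  rw [IsClosed.submodule_topologicalClosure_eq hc2] at htop
  exact LinearMap.range_eq_top.mp htop

lemma potV_bd {α lam : ℝ} (hα : |α| < 1) (x : ℝ) : |potV α lam x| ≤ 2 * |lam| / (1 - |α|) := by
  unfold potV
  have hc := Real.abs_cos_le_one (2 * π * x)
  set c := Real.cos (2 * π * x)
  have h1 : |α * c| ≤ |α| := by rw [abs_mul]; nlinarith [abs_nonneg α]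
  have h2 : 1 - |α| ≤ 1 - α * c := by linarith [le_abs_self (α * c)]
  have h3 : 0 < 1 - |α| := by linarith
  rw [abs_div, abs_of_pos (h3.trans_le h2)]
  have h4 : |2 * lam * c| ≤ 2 * |lam| := by
    rw [abs_mul, abs_mul, abs_two]; nlinarith [abs_nonneg lam]
  exact div_le_div₀ (by positivity) h4 h3 h2

lemma E_bd {α lam b θ E : ℝ} (hα : |α| < 1) (hlam : |lam| ≤ (1 - |α|) ^ 2) {H : L2 →L[ℂ] L2}
    (hH : IsSchrodingerOp (potV α lam) b θ H) (hE : (E:ℂ) ∈ spectrum ℂ H) : |α * E + 2 * lam| ≤ 2 := by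
  have h3 : 0 < 1 - |α| := by linarith
  have hn := H_bound hH (v := 2 * |lam| / (1 - |α|)) (by positivity) (potV_bd hα)
  have : Nontrivial L2 := ⟨⟨lp.single 2 0 1, 0, fun h => by
    have := congrArg (fun f : L2 => f 0) h
    simp at this⟩⟩
  have h1 := spectrum.norm_le_norm_of_mem hE
  rw [Complex.norm_real, Real.norm_eq_abs] at h1
  have h2 : |lam| / (1 - |α|) ≤ 1 - |α| := by rw [div_le_iff₀ h3]; nlinarith
  have h4 : |E| ≤ 2 + 2 * (|lam| / (1 - |α|)) := by
    have : 2 * |lam| / (1 - |α|) = 2 * (|lam| / (1 - |α|)) := by ring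
    linarith
  have h5 : |lam| = (|lam| / (1 - |α|)) * (1 - |α|) := by field_simp
  set q := |lam| / (1 - |α|)
  calc |α * E + 2 * lam| ≤ |α| * |E| + 2 * |lam| := by
        refine (abs_add_le _ _).trans ?_; rw [abs_mul, abs_mul, abs_two]
    _ ≤ |α| * (2 + 2 * q) + 2 * |lam| := by gcongr
    _ = 2 * |α| + 2 * q := by rw [h5]; ring
    _ ≤ 2 := by linarith

namespace Sys
variable {S : Sys}

noncomputable def ph (x : ℝ) : ℂ := Complex.exp ((2 * π * x : ℝ) * Complex.I)

lemma ph_norm (x : ℝ) : ‖ph x‖ = 1 := Complex.norm_exp_ofReal_mul_I _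

lemma potV_ph (x : ℝ) : potV S.α S.lam x = S.vv (ph x) := by
  unfold potV vv ph
  rw [Complex.exp_ofReal_mul_I_re]

lemma ph_add (x : ℝ) (n : ℤ) : ph ((n:ℝ) * S.b + x) = S.β ^ n * ph x := by
  unfold ph β
  rw [← Complex.exp_int_mul, ← Complex.exp_add]
  congr 1; push_cast; ring

lemma not_spec {E θ γ : ℝ} (hγ : 0 < γ) (hb : ¬ S.Bad E 0 γ) {H : L2 →L[ℂ] L2}
    (hH : IsSchrodingerOp (potV S.α S.lam) S.b θ H) : (E:ℂ) ∉ spectrum ℂ H := by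
  obtain ⟨C, hC, hp⟩ := ptwise hγ hb (ph_norm θ)
  obtain ⟨D, hD, hs⟩ := schur hγ hC
  apply unit_of_bound hH hD
  intro u
  apply hs
  intro k
  obtain ⟨l, hl⟩ := hp u ‖u‖ (fun k => lp.norm_apply_le_norm two_ne_zero u k) k
  refine ⟨l, hl.trans (le_of_eq ?_)⟩
  congr 2
  simp only [lp.coeFn_sub, lp.coeFn_smul, Pi.sub_apply, Pi.smul_apply, hH _ l, smul_eq_mul]
  rw [potV_ph, ph_add]
  ring

end Sys
end Lyap

namespace Lyap
open Real Filter Topology MeasureTheory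

lemma opNorm2_le : ∃ C > 0, ∀ A : Matrix (Fin 2) (Fin 2) ℂ, opNorm2 A ≤ C * nrm A := by
  set B : Fin 2 → Fin 2 → Matrix (Fin 2) (Fin 2) ℂ := fun i j => Matrix.single i j 1 with hB
  have hop : ∀ A : Matrix (Fin 2) (Fin 2) ℂ, 0 ≤ opNorm2 A := fun A => norm_nonneg _
  refine ⟨opNorm2 (B 0 0) + opNorm2 (B 0 1) + opNorm2 (B 1 0) + opNorm2 (B 1 1) + 1, by
    linarith [hop (B 0 0), hop (B 0 1), hop (B 1 0), hop (B 1 1)], fun A => ?_⟩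
  have e : A = A 0 0 • B 0 0 + A 0 1 • B 0 1 + A 1 0 • B 1 0 + A 1 1 • B 1 1 := by
    ext i j
    fin_cases i <;> fin_cases j <;> simp [hB, Matrix.single_apply]
  have hadd : ∀ A B : Matrix (Fin 2) (Fin 2) ℂ, opNorm2 (A + B) ≤ opNorm2 A + opNorm2 B := fun A B => by
    unfold opNorm2; rw [map_add]; exact norm_add_le _ _
  have hsm : ∀ (c : ℂ) (A : Matrix (Fin 2) (Fin 2) ℂ), opNorm2 (c • A) = ‖c‖ * opNorm2 A := fun c A => by
    unfold opNorm2; rw [map_smul]; exact norm_smul _ _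
  have h1 : opNorm2 A ≤ ‖A 0 0‖ * opNorm2 (B 0 0) + ‖A 0 1‖ * opNorm2 (B 0 1) + ‖A 1 0‖ * opNorm2 (B 1 0) + ‖A 1 1‖ * opNorm2 (B 1 1) := by
    conv_lhs => rw [e]
    refine (hadd _ _).trans ?_
    rw [hsm (A 1 1)]
    gcongr
    refine (hadd _ _).trans ?_
    rw [hsm (A 1 0)]
    gcongr
    refine (hadd _ _).trans ?_
    rw [hsm, hsm]
  have a1 := mul_le_mul_of_nonneg_right (entry_le_nrm A 0 0) (hop (B 0 0))
  have a2 := mul_le_mul_of_nonneg_right (entry_le_nrm A 0 1) (hop (B 0 1))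
  have a3 := mul_le_mul_of_nonneg_right (entry_le_nrm A 1 0) (hop (B 1 0))
  have a4 := mul_le_mul_of_nonneg_right (entry_le_nrm A 1 1) (hop (B 1 1))
  nlinarith [nrm_nonneg A]

lemma entry_le_op (A : Matrix (Fin 2) (Fin 2) ℂ) (i j : Fin 2) : ‖A i j‖ ≤ opNorm2 A := by
  have h1 := (Matrix.toEuclideanCLM (𝕜 := ℂ) A).le_opNorm (EuclideanSpace.single j (1:ℂ))
  have h2 := PiLp.norm_apply_le ((Matrix.toEuclideanCLM (𝕜 := ℂ) A) (EuclideanSpace.single j (1:ℂ))) i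
  have e : ((Matrix.toEuclideanCLM (𝕜 := ℂ) A) (EuclideanSpace.single j (1:ℂ))) i = A i j := by
    simp [Matrix.ofLp_toEuclideanCLM]
  rw [e] at h2
  simp only [EuclideanSpace.norm_single, norm_one, mul_one] at h1
  exact h2.trans h1

lemma one_le_op {A : Matrix (Fin 2) (Fin 2) ℂ} (hA : A.det = 1) : 1 ≤ opNorm2 A := by
  by_contra hc
  push Not at hc
  have hpow : ∀ m : ℕ, opNorm2 (A ^ (m + 1)) ≤ opNorm2 A ^ (m + 1) := by
    intro m
    unfold opNorm2
    rw [map_pow]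
    exact norm_pow_le' _ (Nat.succ_pos m)
  have hlow : ∀ m : ℕ, 1 / 4 ≤ opNorm2 (A ^ m) := by
    intro m
    have h1 := det_le_nrm (A ^ m)
    rw [Matrix.det_pow, hA, one_pow, norm_one] at h1
    have h2 : 1 ≤ nrm (A ^ m) := by nlinarith [nrm_nonneg (A ^ m)]
    have h3 : nrm (A ^ m) ≤ 4 * opNorm2 (A ^ m) := by
      unfold nrm
      linarith [entry_le_op (A ^ m) 0 0, entry_le_op (A ^ m) 0 1, entry_le_op (A ^ m) 1 0, entry_le_op (A ^ m) 1 1]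
    linarith
  obtain ⟨m, hm⟩ := exists_pow_lt_of_lt_one (show (0:ℝ) < 1 / 4 by norm_num) hc
  have h0 : 0 ≤ opNorm2 A := norm_nonneg _
  have h1 : opNorm2 A ^ (m + 1) ≤ opNorm2 A ^ m := pow_le_pow_of_le_one h0 hc.le (Nat.le_succ m)
  linarith [hpow m, hlow (m + 1)]

lemma tProd_succ (V : ℝ → ℝ) (b : ℝ) (n : ℕ) (x : ℝ) (z : ℂ) :
    tProd V b (n + 1) x z = tMat V (x + (n:ℝ) * b) z * tProd V b n x z := by
  unfold tProd
  rw [List.range_succ, List.reverse_append]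
  simp

lemma det_tProd (V : ℝ → ℝ) (b : ℝ) (n : ℕ) (x : ℝ) (z : ℂ) : (tProd V b n x z).det = 1 := by
  induction n with
  | zero => simp [tProd]
  | succ n ih =>
    rw [tProd_succ, Matrix.det_mul, ih, mul_one]
    simp [tMat, Matrix.det_fin_two]

namespace Sys
variable {S : Sys}

lemma Mn_tProd (E : ℂ) (n : ℕ) (x : ℝ) : S.Mn E n (ph x) = S.Dn n (ph x) • tProd (potV S.α S.lam) S.b n x E := by
  induction n with
  | zero => simp [Mn_zero, Dn, tProd]
  | succ n ih =>
    have hp := ph_add (S := S) x n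
    rw [zpow_natCast] at hp
    have hn : ‖S.β ^ n * ph x‖ = 1 := by rw [norm_mul, S.norm_βpow, ph_norm, one_mul]
    have hD : S.Dn (n + 1) (ph x) = S.d (S.β ^ n * ph x) * S.Dn n (ph x) := by
      unfold Dn; rw [Finset.prod_range_succ, mul_comm]
    rw [Mn_succ, ih, tProd_succ, hD, M_circ E hn, Matrix.smul_mul, Matrix.mul_smul, smul_smul]
    congr 2
    unfold tMat
    rw [potV_ph, ← hp]
    congr 6
    push_cast
    ring

lemma int_ph {G : ℂ → ℝ} : ∫ x in (0:ℝ)..1, G (ph x) = CA G 0 := by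
  unfold CA
  rw [circleAverage_def, exp_zero]
  have h : ∀ x, ph x = circleMap 0 1 (2 * π * x) := fun x => by simp [ph, circleMap]
  simp only [h]
  rw [intervalIntegral.integral_comp_mul_left (fun θ => G (circleMap 0 1 θ)) (by positivity)]
  simp

lemma ph_cont : Continuous ph := by unfold ph; fun_prop

lemma exp0 {ζ : ℂ} (h : ‖ζ‖ = 1) : ‖ζ‖ = exp 0 := by rw [h, exp_zero]

lemma op_int_le {C : ℝ} (hC : 0 < C) (hop : ∀ A : Matrix (Fin 2) (Fin 2) ℂ, opNorm2 A ≤ C * nrm A) (E : ℂ) (n : ℕ) :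
    ∫ x in (0:ℝ)..1, log (opNorm2 (tProd (potV S.α S.lam) S.b n x E)) ≤ log C + S.a E 0 n - n * S.κ := by
  have hD : ∀ x, S.Dn n (ph x) ≠ 0 := fun x => Dn_ne S.ok_zero (exp0 (ph_norm x)) n
  have ht : ∀ x, tProd (potV S.α S.lam) S.b n x E = (S.Dn n (ph x))⁻¹ • S.Mn E n (ph x) := fun x => by
    rw [Mn_tProd, smul_smul, inv_mul_cancel₀ (hD x), one_smul]
  have hpos : ∀ x, 0 < opNorm2 (tProd (potV S.α S.lam) S.b n x E) := fun x =>
    zero_lt_one.trans_le (one_le_op (det_tProd _ _ _ _ _))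
  have hcD : Continuous fun x => S.Dn n (ph x) := (S.continuous_Dn n).comp ph_cont
  have hcM : Continuous fun x => S.Mn E n (ph x) := (S.continuous_Mn E n).comp ph_cont
  have hMpos : ∀ x, 0 < nrm (S.Mn E n (ph x)) := fun x => nrm_Mn_pos S.ok_zero (exp0 (ph_norm x)) E n
  have hct : Continuous fun x => tProd (potV S.α S.lam) S.b n x E := by
    simp only [ht]
    exact (hcD.inv₀ hD).smul hcM
  have hclin : Continuous (opNorm2) := by
    unfold opNorm2
    have : Continuous fun M : Matrix (Fin 2) (Fin 2) ℂ => Matrix.toEuclideanCLM (𝕜 := ℂ) M :=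
      LinearMap.continuous_of_finiteDimensional (Matrix.toEuclideanCLM (𝕜 := ℂ) (n := Fin 2)).toAlgEquiv.toLinearMap
    exact this.norm
  have hc1 : Continuous fun x => log (opNorm2 (tProd (potV S.α S.lam) S.b n x E)) :=
    (hclin.comp hct).log fun x => (hpos x).ne'
  have hc2 : Continuous fun x => log (nrm (S.Mn E n (ph x))) :=
    (continuous_nrm.comp hcM).log fun x => (hMpos x).ne'
  have hc3 : Continuous fun x => log ‖S.Dn n (ph x)‖ := hcD.norm.log fun x => norm_ne_zero_iff.mpr (hD x)
  have hc4 : Continuous fun x => log C + log (nrm (S.Mn E n (ph x))) := continuous_const.add hc2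
  have hc5 : Continuous fun x => log C + log (nrm (S.Mn E n (ph x))) - log ‖S.Dn n (ph x)‖ := hc4.sub hc3
  calc ∫ x in (0:ℝ)..1, log (opNorm2 (tProd (potV S.α S.lam) S.b n x E))
      ≤ ∫ x in (0:ℝ)..1, (log C + log (nrm (S.Mn E n (ph x))) - log ‖S.Dn n (ph x)‖) := by
        apply intervalIntegral.integral_mono_on zero_le_one (hc1.intervalIntegrable _ _)
          (hc5.intervalIntegrable _ _)
        intro x _
        have h1 := hop (tProd (potV S.α S.lam) S.b n x E)
        have h2 : nrm (tProd (potV S.α S.lam) S.b n x E) = ‖S.Dn n (ph x)‖⁻¹ * nrm (S.Mn E n (ph x)) := by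
          rw [ht, nrm_smul, norm_inv]
        rw [h2] at h1
        have hDp : 0 < ‖S.Dn n (ph x)‖ := norm_pos_iff.mpr (hD x)
        refine (log_le_log (hpos x) h1).trans (le_of_eq ?_)
        rw [log_mul hC.ne' (by have := hMpos x; positivity), log_mul (by positivity) (hMpos x).ne', log_inv]
        ring
    _ = log C + S.a E 0 n - n * S.κ := by
        rw [intervalIntegral.integral_sub (hc4.intervalIntegrable _ _) (hc3.intervalIntegrable _ _),
          intervalIntegral.integral_add (continuous_const.intervalIntegrable _ _) (hc2.intervalIntegrable _ _),
          int_ph (G := fun ζ => log (nrm (S.Mn E n ζ))), int_ph (G := fun ζ => log ‖S.Dn n ζ‖), CA_log_Dn S.ok_zero]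
        simp [a]

lemma term_nonneg (E : ℂ) (n : ℕ+) : 0 ≤ ((n : ℝ))⁻¹ * ∫ x in (0:ℝ)..(1:ℝ), Real.log (opNorm2 (tProd (potV S.α S.lam) S.b n x E)) := by
  apply mul_nonneg (by positivity)
  apply intervalIntegral.integral_nonneg zero_le_one
  intro x _
  exact log_nonneg (one_le_op (det_tProd _ _ _ _ _))

lemma lyap_nonneg (E : ℂ) : 0 ≤ lyap (potV S.α S.lam) S.b E := le_ciInf fun n => term_nonneg E n

lemma lyap_le (E : ℂ) : lyap (potV S.α S.lam) S.b E + S.κ ≤ S.F E 0 := by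
  obtain ⟨C, hC, hop⟩ := opNorm2_le
  have h1 := (F_tendsto S.ok_zero E).add ((tendsto_const_nhds (x := log C)).div_atTop tendsto_natCast_atTop_atTop)
  rw [add_zero] at h1
  refine ge_of_tendsto h1 ?_
  filter_upwards [eventually_gt_atTop 0] with n hn
  have hnr : (0:ℝ) < n := by exact_mod_cast hn
  have h2 : lyap (potV S.α S.lam) S.b E ≤ (n:ℝ)⁻¹ * ∫ x in (0:ℝ)..(1:ℝ), Real.log (opNorm2 (tProd (potV S.α S.lam) S.b n x E)) :=
    ciInf_le (f := fun n : ℕ+ => ((n : ℝ))⁻¹ * ∫ x in (0:ℝ)..(1:ℝ), Real.log (opNorm2 (tProd (potV S.α S.lam) S.b n x E)))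
      ⟨0, by rintro _ ⟨m, rfl⟩; exact term_nonneg E m⟩ ⟨n, hn⟩
  have h3 := mul_le_mul_of_nonneg_left (op_int_le (S := S) hC hop E n) (inv_nonneg.mpr hnr.le)
  have h4 : (n:ℝ)⁻¹ * (log C + S.a E 0 n - n * S.κ) = S.a E 0 n / n + log C / n - S.κ := by
    field_simp; ring
  linarith

end Sys
end Lyap

theorem lyapunov_zero_of_small_coupling (α lam b θ : ℝ) (hα : α ∈ Set.Ioo (-1 : ℝ) 1)
    (hb : Irrational b) (hlam : |lam| ≤ (1 - |α|) ^ 2)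
    (H : lp (fun _ : ℤ => ℂ) 2 →L[ℂ] lp (fun _ : ℤ => ℂ) 2)
    (hH : IsSchrodingerOp (potV α lam) b θ H)
    (E : ℝ) (hE : (E : ℂ) ∈ spectrum ℂ H) :
    lyap (potV α lam) b (E : ℂ) = 0 := by
  have hα1 : |α| < 1 := abs_lt.mpr hα
  set S : Lyap.Sys := ⟨α, lam, b, hα1, hb⟩ with hS
  by_contra hne
  have h0 : 0 ≤ lyap (potV α lam) b E := Lyap.Sys.lyap_nonneg (S := S) E
  have h1 : lyap (potV α lam) b E + S.κ ≤ S.F E 0 := Lyap.Sys.lyap_le (S := S) E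
  have h2 : 0 < lyap (potV α lam) b E := lt_of_le_of_ne h0 (Ne.symm hne)
  obtain ⟨γ, hγ, hbad⟩ := Lyap.Sys.not_bad (S := S) (E0 := E) (Lyap.E_bd hα1 hlam hH hE) (by linarith)
  exact Lyap.Sys.not_spec hγ hbad hH hE
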